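/- Let θ = (θ₁,…,θ_{d-1}) with 1, θ₁, …, θ_{d-1} real algebraic numbers linearly independent over ℚ, and φ ∈ 𝔖(ℝ^d) a Schwartz function. Then the sum 𝒮(θ, φ, T) = sup_{u ∈ ℝ^d} |Σ_{m_d ≠ 0} (e^{2πi m_d u_d}/m_d) ∏_{l=1}^{d-1} Σ_{m_l ∈ ℤ} e^{2πi m_l u_l}/(θ_l m_d − m_l) · φ(T^{−1}m)| satisfies 𝒮(θ, φ, T) = O_ε(T^ε) for every ε > 0 as T → ∞. -/

import Mathlib

open scoped BigOperators Real

/-- The term of the sum `𝒮(θ, φ, u, T)`: for `m = (m₁,…,m_{d-1}, m_d)` with `m_d ≠ 0`,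
`(e^{2πi m_d u_d}/m_d) ∏_l (e^{2πi m_l u_l}/(θ_l m_d - m_l)) · φ(T^{-1} m)`
(terms with `m_d = 0` are set to `0`). -/
noncomputable def sumTerm (n : ℕ) (θ : Fin n → ℝ)
    (φ : SchwartzMap (Fin (n + 1) → ℝ) ℝ) (u : Fin (n + 1) → ℝ) (T : ℝ)
    (p : (Fin n → ℤ) × ℤ) : ℂ :=
  if p.2 = 0 then 0 else
    (Complex.exp (2 * π * Complex.I * ((p.2 : ℝ) * u (Fin.last n) : ℝ)) / (p.2 : ℂ)) *
    (∏ l, Complex.exp (2 * π * Complex.I * ((p.1 l : ℝ) * u l.castSucc : ℝ)) /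
      ((θ l * (p.2 : ℝ) - (p.1 l : ℝ) : ℝ) : ℂ)) *
    ((φ (T⁻¹ • (Fin.snoc (fun j => (p.1 j : ℝ)) (p.2 : ℝ) : Fin (n + 1) → ℝ)) : ℝ) : ℂ)

section PartF1
open MvPolynomial

namespace Schmidt

noncomputable def DL {σ R : Type*} [CommRing R] (l : List σ) (P : MvPolynomial σ R) : MvPolynomial σ R :=
  l.foldr (fun i Q => pderiv i Q) P

@[simp] lemma DL_nil {σ R : Type*} [CommRing R] (P : MvPolynomial σ R) : DL [] P = P := rfl

@[simp] lemma DL_cons {σ R : Type*} [CommRing R] (s : σ) (l : List σ) (P : MvPolynomial σ R) :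
    DL (s :: l) P = pderiv s (DL l P) := rfl

lemma DL_add {σ R : Type*} [CommRing R] (l : List σ) (P Q : MvPolynomial σ R) :
    DL l (P + Q) = DL l P + DL l Q := by
  induction l with
  | nil => rfl
  | cons s l ih => simp [ih]

lemma DL_smul {σ R : Type*} [CommRing R] (l : List σ) (c : R) (P : MvPolynomial σ R) :
    DL l (c • P) = c • DL l P := by
  induction l with
  | nil => rfl
  | cons s l ih => simp [ih]

lemma DL_zero {σ R : Type*} [CommRing R] (l : List σ) :
    DL l (0 : MvPolynomial σ R) = 0 := by
  induction l with
  | nil => rfl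
  | cons s l ih => simp [ih]

lemma DL_sum {σ R ι : Type*} [CommRing R] (l : List σ) (s : Finset ι) (f : ι → MvPolynomial σ R) :
    DL l (∑ i ∈ s, f i) = ∑ i ∈ s, DL l (f i) := by
  classical
  induction s using Finset.induction_on with
  | empty => simp [DL_zero]
  | insert a s ha ih => simp [Finset.sum_insert ha, DL_add, ih]

noncomputable def shift {σ R : Type*} [CommRing R] (ξ : σ → R) : MvPolynomial σ R →ₐ[R] MvPolynomial σ R :=
  aeval (fun i => X i + C (ξ i))

lemma shift_pderiv {σ R : Type*} [CommRing R] (ξ : σ → R) (i : σ) (P : MvPolynomial σ R) :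
    shift ξ (pderiv i P) = pderiv i (shift ξ P) := by
  classical
  induction P using MvPolynomial.induction_on with
  | C a => simp [shift]
  | add p q hp hq => simp [hp, hq]
  | mul_X p j hp =>
    rw [Derivation.leibniz, map_add, map_mul, smul_eq_mul, smul_eq_mul, map_mul, map_mul, hp,
      Derivation.leibniz]
    simp only [shift, aeval_X, map_add, pderiv_C, add_zero, smul_eq_mul]
    by_cases h : i = j
    · subst h; simp
    · simp [pderiv_X, Ne.symm h]

lemma shift_DL {σ R : Type*} [CommRing R] (ξ : σ → R) (l : List σ) (P : MvPolynomial σ R) :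
    shift ξ (DL l P) = DL l (shift ξ P) := by
  induction l with
  | nil => rfl
  | cons s l ih => simp [shift_pderiv, ih]

lemma shift_neg_shift {σ R : Type*} [CommRing R] (ξ : σ → R) (P : MvPolynomial σ R) :
    shift (-ξ) (shift ξ P) = P := by
  have : ((shift (-ξ)).comp (shift ξ) : MvPolynomial σ R →ₐ[R] MvPolynomial σ R) = AlgHom.id R _ := by
    ext i; simp [shift]
  exact DFunLike.congr_fun this P

lemma shift_injective {σ R : Type*} [CommRing R] (ξ : σ → R) : Function.Injective (shift ξ) :=
  Function.LeftInverse.injective (shift_neg_shift ξ)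

lemma shift_eval_zero {σ R : Type*} [CommRing R] (ξ : σ → R) (P : MvPolynomial σ R) :
    constantCoeff (shift ξ P) = eval ξ P := by
  have : (constantCoeff.comp (shift ξ : MvPolynomial σ R →+* MvPolynomial σ R)) = eval ξ := by
    ext i <;> simp [shift]
  exact DFunLike.congr_fun this P

lemma coeff_pderiv' {σ R : Type*} [DecidableEq σ] [CommRing R] (i : σ) (P : MvPolynomial σ R) (k : σ →₀ ℕ) :
    coeff k (pderiv i P) = coeff (k + Finsupp.single i 1) P * (k i + 1) := by
  induction P using MvPolynomial.induction_on' with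
  | add p q hp hq => simp [hp, hq, add_mul]
  | monomial u a =>
    rw [pderiv_monomial, coeff_monomial, coeff_monomial]
    by_cases h : u = k + Finsupp.single i 1
    · subst h; simp
    · rw [if_neg h, zero_mul]
      split_ifs with h2
      · by_cases hu : u i = 0
        · simp [hu]
        · exfalso; apply h; rw [← h2]; ext j
          by_cases hj : j = i
          · subst hj; simp; omega
          · simp [Ne.symm hj]
      · rfl

noncomputable def cnt {σ : Type*} (l : List σ) : σ →₀ ℕ := (l.map (fun s => Finsupp.single s 1)).sum

lemma coeff_DL {σ R : Type*} [Field R] [CharZero R] (l : List σ) :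
    ∀ k : σ →₀ ℕ, ∃ c : R, c ≠ 0 ∧ ∀ P : MvPolynomial σ R, coeff k (DL l P) = c * coeff (k + cnt l) P := by
  classical
  induction l with
  | nil => intro k; exact ⟨1, one_ne_zero, by simp [cnt]⟩
  | cons s l ih =>
    intro k
    obtain ⟨c, hc, h⟩ := ih (k + Finsupp.single s 1)
    refine ⟨c * (k s + 1), mul_ne_zero hc (Nat.cast_add_one_ne_zero _), fun P => ?_⟩
    rw [DL_cons, coeff_pderiv', h]
    simp only [cnt, List.map_cons, List.sum_cons, add_assoc]
    ring

lemma exists_list_cnt {σ : Type*} (k : σ →₀ ℕ) : ∃ l : List σ, cnt l = k := by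
  classical
  induction k using Finsupp.induction_linear with
  | zero => exact ⟨[], rfl⟩
  | add f g hf hg =>
    obtain ⟨a, ha⟩ := hf; obtain ⟨b, hb⟩ := hg
    exact ⟨a ++ b, by simp [cnt] at *; rw [ha, hb]⟩
  | single a n =>
    refine ⟨List.replicate n a, ?_⟩
    simp [cnt]

lemma eq_zero_of_DL_eval {σ R : Type*} [Field R] [CharZero R] (P : MvPolynomial σ R) (ξ : σ → R)
    (h : ∀ l, eval ξ (DL l P) = 0) : P = 0 := by
  apply shift_injective ξ
  rw [map_zero]
  ext k
  obtain ⟨l, rfl⟩ := exists_list_cnt k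
  have := h l
  rw [← shift_eval_zero, shift_DL, constantCoeff_eq] at this
  obtain ⟨c, hc, h'⟩ := coeff_DL (R := R) l 0
  rw [h', zero_add] at this
  simpa [hc] using this

theorem exists_wronskian {σ : Type*} {k : ℕ} (φ : Fin k → MvPolynomial σ ℚ)
    (hφ : LinearIndependent ℚ φ) :
    ∃ l : Fin k → List σ, (∀ a, (l a).length ≤ a) ∧
      (Matrix.of fun a j => DL (l a) (φ j)).det ≠ 0 := by
  classical
  have key : ∀ n ≤ k, ∃ l : Fin n → List σ, (∀ a, (l a).length ≤ a) ∧
      LinearIndependent (MvPolynomial σ ℚ) (fun a => (fun j => DL (l a) (φ j) : Fin k → (MvPolynomial σ ℚ))) := by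
    intro n
    induction n with
    | zero => intro _; exact ⟨fun a => a.elim0, fun a => a.elim0, linearIndependent_empty_type⟩
    | succ n ih =>
      intro hn
      obtain ⟨l, hl, hli⟩ := ih (by omega)
      set v : Fin n → (Fin k → (MvPolynomial σ ℚ)) := fun a => (fun j => DL (l a) (φ j)) with hv
      by_contra hcon
      push Not at hcon
      have low : ∀ s : List σ, s.length ≤ n → ∃ g : (MvPolynomial σ ℚ), g ≠ 0 ∧
          g • (fun j => DL s (φ j) : Fin k → (MvPolynomial σ ℚ)) ∈ Submodule.span (MvPolynomial σ ℚ) (Set.range v) := by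
        intro s hs
        by_contra hno
        push Not at hno
        refine hcon (Fin.snoc l s) ?_ ?_
        · intro a
          refine Fin.lastCases ?_ (fun a => ?_) a
          · simpa using hs
          · simpa using hl a
        · have : (fun a => (fun j => DL ((Fin.snoc l s : Fin (n+1) → List σ) a) (φ j) : Fin k → (MvPolynomial σ ℚ))) =
              Fin.snoc v (fun j => DL s (φ j)) := by
            ext a : 1
            refine Fin.lastCases ?_ (fun a => ?_) a
            · simp
            · simp [v]
          rw [this]
          rw [Fintype.linearIndependent_iff]
          intro c hc
          rw [Fin.sum_univ_castSucc] at hc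
          simp only [Fin.snoc_castSucc, Fin.snoc_last] at hc
          have hlast : c (Fin.last n) = 0 := by
            by_contra h0
            apply hno _ h0
            have : c (Fin.last n) • (fun j => DL s (φ j) : Fin k → (MvPolynomial σ ℚ)) = -∑ i : Fin n, c i.castSucc • v i := by
              rw [eq_neg_iff_add_eq_zero, add_comm]; exact hc
            rw [this]
            exact Submodule.neg_mem _ (Submodule.sum_mem _ fun i _ =>
              Submodule.smul_mem _ _ (Submodule.subset_span ⟨i, rfl⟩))
          rw [hlast, zero_smul, add_zero] at hc
          have := Fintype.linearIndependent_iff.1 hli (fun i => c i.castSucc) hc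
          intro i
          refine Fin.lastCases hlast (fun i => this i) i
      obtain ⟨y, hy0, hy⟩ : ∃ y : Fin k → (MvPolynomial σ ℚ), y ≠ 0 ∧ ∀ a, ∑ j, v a j * y j = 0 := by
        let M : Matrix (Fin k) (Fin k) (MvPolynomial σ ℚ) := fun i j => if h : i.1 < n then v ⟨i.1, h⟩ j else 0
        have hdet : M.det = 0 := by
          apply Matrix.det_eq_zero_of_row_eq_zero (⟨n, by omega⟩ : Fin k)
          intro j; simp [M]
        obtain ⟨y, hy0, hy⟩ := Matrix.exists_mulVec_eq_zero_iff.2 hdet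
        refine ⟨y, hy0, fun a => ?_⟩
        have := congrFun hy ⟨a.1, by omega⟩
        simpa [Matrix.mulVec, dotProduct, M] using this
      have orth : ∀ x ∈ Submodule.span (MvPolynomial σ ℚ) (Set.range v), ∑ j, x j * y j = 0 := by
        intro x hx
        induction hx using Submodule.span_induction with
        | mem x h => obtain ⟨a, rfl⟩ := h; exact hy a
        | zero => simp
        | add x z _ _ hx hz => simp [add_mul, Finset.sum_add_distrib, hx, hz]
        | smul c x _ hx => simp [mul_assoc, ← Finset.mul_sum, hx]
      have orth' : ∀ x : Fin k → (MvPolynomial σ ℚ), (∃ g : (MvPolynomial σ ℚ), g ≠ 0 ∧ g • x ∈ Submodule.span (MvPolynomial σ ℚ) (Set.range v)) →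
          ∑ j, x j * y j = 0 := by
        rintro x ⟨g, hg, hx⟩
        have := orth _ hx
        simp only [Pi.smul_apply, smul_eq_mul, mul_assoc, ← Finset.mul_sum] at this
        exact (mul_eq_zero.1 this).resolve_left hg
      have all : ∀ s : List σ, ∃ g : (MvPolynomial σ ℚ), g ≠ 0 ∧
          g • (fun j => DL s (φ j) : Fin k → (MvPolynomial σ ℚ)) ∈ Submodule.span (MvPolynomial σ ℚ) (Set.range v) := by
        intro s
        induction s with
        | nil => exact low [] (by simp)
        | cons t s ih =>
          obtain ⟨g, hg, hmem⟩ := ih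
          obtain ⟨c, hc⟩ := (Submodule.mem_span_range_iff_exists_fun (MvPolynomial σ ℚ)).1 hmem
          have hv' : ∀ a, ∃ g : (MvPolynomial σ ℚ), g ≠ 0 ∧
              g • (fun j => pderiv t (v a j) : Fin k → (MvPolynomial σ ℚ)) ∈ Submodule.span (MvPolynomial σ ℚ) (Set.range v) := by
            intro a
            have := low (t :: l a) (by simp; have := hl a; omega)
            simpa [v] using this
          choose G hG0 hG using hv'
          let H : (MvPolynomial σ ℚ) := ∏ a, G a
          have hH : H ≠ 0 := Finset.prod_ne_zero_iff.2 fun a _ => hG0 a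
          have hGH : ∀ a, H • (fun j => pderiv t (v a j) : Fin k → (MvPolynomial σ ℚ)) ∈ Submodule.span (MvPolynomial σ ℚ) (Set.range v) := by
            intro a
            have : H = (∏ b ∈ Finset.univ.erase a, G b) * G a :=
              (Finset.prod_erase_mul _ _ (Finset.mem_univ a)).symm
            rw [this, mul_smul]
            exact Submodule.smul_mem _ _ (hG a)
          refine ⟨H * g * g, mul_ne_zero (mul_ne_zero hH hg) hg, ?_⟩
          have e : (H * g * g) • (fun j => DL (t :: s) (φ j) : Fin k → (MvPolynomial σ ℚ)) =
              (∑ a, (H * g * pderiv t (c a)) • v a) + (∑ a, (g * c a) • (H • (fun j => pderiv t (v a j) : Fin k → (MvPolynomial σ ℚ))))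
              - (H * pderiv t g) • (g • (fun j => DL s (φ j) : Fin k → (MvPolynomial σ ℚ))) := by
            funext j
            have hj : ∑ a, c a * v a j = g * DL s (φ j) := by
              have := congrFun hc j
              simpa using this
            have hd := congrArg (pderiv t) hj
            rw [map_sum, Derivation.leibniz] at hd
            simp only [Derivation.leibniz, smul_eq_mul, Finset.sum_add_distrib] at hd
            simp only [Pi.smul_apply, Pi.add_apply, Pi.sub_apply, Finset.sum_apply, smul_eq_mul, DL_cons]
            have h1 : ∑ a, H * g * pderiv t (c a) * v a j = H * g * ∑ a, v a j * pderiv t (c a) := by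
              rw [Finset.mul_sum]; refine Finset.sum_congr rfl fun a _ => by ring
            have h2 : ∑ a, g * c a * (H * pderiv t (v a j)) = H * g * ∑ a, c a * pderiv t (v a j) := by
              rw [Finset.mul_sum]; refine Finset.sum_congr rfl fun a _ => by ring
            rw [h1, h2]
            linear_combination (-(H * g)) * hd
          rw [e]
          refine Submodule.sub_mem _ (Submodule.add_mem _ ?_ ?_) (Submodule.smul_mem _ _ hmem)
          · exact Submodule.sum_mem _ fun a _ => Submodule.smul_mem _ _ (Submodule.subset_span ⟨a, rfl⟩)
          · exact Submodule.sum_mem _ fun a _ => Submodule.smul_mem _ _ (hGH a)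
      obtain ⟨j0, hj0⟩ := Function.ne_iff.1 hy0
      obtain ⟨ξ, hξ⟩ : ∃ ξ : σ → ℚ, eval ξ (y j0) ≠ 0 := by
        by_contra hno
        push Not at hno
        exact hj0 (MvPolynomial.funext (by simpa using hno))
      have hz : ∑ j, eval ξ (y j) • φ j = 0 := by
        apply eq_zero_of_DL_eval _ ξ
        intro s
        have := congrArg (eval ξ) (orth' _ (all s))
        simp only [map_sum, map_mul, map_zero] at this
        rw [DL_sum, map_sum]
        simp only [DL_smul, smul_eval]
        rw [← this]
        exact Finset.sum_congr rfl fun j _ => by ring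
      exact hξ (Fintype.linearIndependent_iff.1 hφ _ hz j0)
  obtain ⟨l, hl, hli⟩ := key k le_rfl
  refine ⟨l, hl, fun hdet => ?_⟩
  obtain ⟨y, hy0, hy⟩ := Matrix.exists_vecMul_eq_zero_iff.2 hdet
  apply hy0
  funext i
  refine Fintype.linearIndependent_iff.1 hli y ?_ i
  funext j
  have := congrFun hy j
  simpa [Matrix.vecMul, dotProduct] using this

end Schmidt

end PartF1

section PartF2
open MvPolynomial

namespace Schmidt

noncomputable def l1 {σ R : Type*} [CommRing R] (s : RingSeminorm R) (P : MvPolynomial σ R) : ℝ :=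
  ∑ α ∈ P.support, s (coeff α P)

section l1
variable {σ R : Type*} [CommRing R] (s : RingSeminorm R)

lemma l1_eq_sum (P : MvPolynomial σ R) (S : Finset (σ →₀ ℕ)) (h : P.support ⊆ S) :
    l1 s P = ∑ α ∈ S, s (coeff α P) := by
  refine Finset.sum_subset h fun α _ hα => ?_
  rw [notMem_support_iff.1 hα, map_zero]

lemma l1_nonneg (P : MvPolynomial σ R) : 0 ≤ l1 s P := Finset.sum_nonneg fun _ _ => apply_nonneg s _

lemma l1_zero : l1 s (0 : MvPolynomial σ R) = 0 := by simp [l1]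

lemma coeff_le_l1 (P : MvPolynomial σ R) (α : σ →₀ ℕ) : s (coeff α P) ≤ l1 s P := by
  by_cases h : α ∈ P.support
  · exact Finset.single_le_sum (f := fun α => s (coeff α P)) (fun _ _ => apply_nonneg s _) h
  · rw [notMem_support_iff.1 h, map_zero]; exact l1_nonneg s P

lemma l1_add_le (P Q : MvPolynomial σ R) : l1 s (P + Q) ≤ l1 s P + l1 s Q := by
  classical
  rw [l1_eq_sum s (P + Q) (P.support ∪ Q.support) support_add,
    l1_eq_sum s P (P.support ∪ Q.support) Finset.subset_union_left,
    l1_eq_sum s Q (P.support ∪ Q.support) Finset.subset_union_right, ← Finset.sum_add_distrib]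
  refine Finset.sum_le_sum fun α _ => ?_
  rw [coeff_add]; exact map_add_le_add s _ _

lemma l1_neg (P : MvPolynomial σ R) : l1 s (-P) = l1 s P := by
  simp [l1, map_neg_eq_map]

lemma l1_sum_le {ι : Type*} (S : Finset ι) (f : ι → MvPolynomial σ R) :
    l1 s (∑ i ∈ S, f i) ≤ ∑ i ∈ S, l1 s (f i) := by
  classical
  induction S using Finset.induction_on with
  | empty => simp [l1_zero]
  | insert a S ha ih =>
    rw [Finset.sum_insert ha, Finset.sum_insert ha]
    exact (l1_add_le s _ _).trans (by linarith)

lemma l1_monomial (α : σ →₀ ℕ) (c : R) : l1 s (monomial α c) = s c := by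
  classical
  rw [l1_eq_sum s _ {α} (support_monomial_subset)]
  simp

lemma l1_C (c : R) : l1 s (C c : MvPolynomial σ R) = s c := l1_monomial s 0 c

lemma l1_X (i : σ) : l1 s (X i : MvPolynomial σ R) = s 1 := l1_monomial s _ 1

lemma l1_mul_le (P Q : MvPolynomial σ R) : l1 s (P * Q) ≤ l1 s P * l1 s Q := by
  have h : P * Q = ∑ α ∈ P.support, ∑ β ∈ Q.support, monomial (α + β) (coeff α P * coeff β Q) := by
    conv_lhs => rw [P.as_sum, Q.as_sum, Finset.sum_mul_sum]
    simp [monomial_mul]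
  rw [h]
  refine (l1_sum_le s _ _).trans ?_
  unfold l1
  rw [Finset.sum_mul_sum]
  refine Finset.sum_le_sum fun α _ => ?_
  refine (l1_sum_le s _ _).trans ?_
  refine Finset.sum_le_sum fun β _ => ?_
  rw [l1_monomial]
  exact map_mul_le_mul s _ _

lemma l1_prod_le (h1 : s 1 ≤ 1) {ι : Type*} (S : Finset ι) (f : ι → MvPolynomial σ R) :
    l1 s (∏ i ∈ S, f i) ≤ ∏ i ∈ S, l1 s (f i) := by
  classical
  induction S using Finset.induction_on with
  | empty => simpa using (l1_C (σ := σ) s 1).le.trans h1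
  | insert a S ha ih =>
    rw [Finset.prod_insert ha, Finset.prod_insert ha]
    exact (l1_mul_le s _ _).trans (mul_le_mul_of_nonneg_left ih (l1_nonneg s _))

lemma l1_pow_le (h1 : s 1 ≤ 1) (P : MvPolynomial σ R) (n : ℕ) : l1 s (P ^ n) ≤ l1 s P ^ n := by
  simpa using l1_prod_le s h1 (Finset.range n) (fun _ => P)

lemma l1_aeval_le {τ : Type*} (h1 : s 1 ≤ 1) (P : MvPolynomial σ R) (f : σ → MvPolynomial τ R) (B : ℝ)
    (hB : ∀ α ∈ P.support, ∏ i ∈ α.support, l1 s (f i) ^ α i ≤ B) :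
    l1 s (aeval f P) ≤ l1 s P * B := by
  rw [aeval_def, eval₂_eq]
  refine (l1_sum_le s _ _).trans ?_
  unfold l1
  rw [Finset.sum_mul]
  refine Finset.sum_le_sum fun α hα => ?_
  refine (l1_mul_le s _ _).trans ?_
  rw [algebraMap_eq, l1_C]
  refine mul_le_mul_of_nonneg_left (le_trans ?_ (hB α hα)) (apply_nonneg s _)
  refine (l1_prod_le s h1 _ _).trans ?_
  exact Finset.prod_le_prod (fun _ _ => l1_nonneg s _) fun i _ => l1_pow_le s h1 _ _

end l1

noncomputable def nZ : RingSeminorm ℤ := normRingSeminorm ℤ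

lemma nZ_apply (n : ℤ) : nZ n = |(n : ℝ)| := rfl

lemma nZ_one : nZ 1 ≤ 1 := by simp [nZ_apply]

lemma one_le_l1_of_ne_zero {σ : Type*} (P : MvPolynomial σ ℤ) (h : P ≠ 0) : 1 ≤ l1 nZ P := by
  obtain ⟨α, hα⟩ := ne_zero_iff.1 h
  refine le_trans ?_ (coeff_le_l1 nZ P α)
  rw [nZ_apply]
  exact_mod_cast Int.one_le_abs hα

noncomputable def wt {σ : Type*} [Fintype σ] (w : σ → ℝ) (α : σ →₀ ℕ) : ℝ := ∑ i, w i * α i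

lemma wt_add {σ : Type*} [Fintype σ] (w : σ → ℝ) (α β : σ →₀ ℕ) : wt w (α + β) = wt w α + wt w β := by
  simp [wt, mul_add, Finset.sum_add_distrib]

lemma wt_nonneg {σ : Type*} [Fintype σ] (w : σ → ℝ) (hw : ∀ i, 0 ≤ w i) (α : σ →₀ ℕ) : 0 ≤ wt w α :=
  Finset.sum_nonneg fun i _ => mul_nonneg (hw i) (Nat.cast_nonneg _)

def IndGe {σ R : Type*} [Fintype σ] [CommRing R] (w : σ → ℝ) (t : ℝ) (P : MvPolynomial σ R) : Prop :=
  ∀ α, coeff α P ≠ 0 → t ≤ wt w α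

section IndGe
variable {σ R : Type*} [Fintype σ] [CommRing R] {w : σ → ℝ}

lemma IndGe.mono {t t' : ℝ} {P : MvPolynomial σ R} (h : IndGe w t P) (ht : t' ≤ t) : IndGe w t' P :=
  fun α hα => ht.trans (h α hα)

lemma IndGe.of_nonneg (hw : ∀ i, 0 ≤ w i) (P : MvPolynomial σ R) : IndGe w 0 P :=
  fun α _ => wt_nonneg w hw α

lemma IndGe.zero (t : ℝ) : IndGe w t (0 : MvPolynomial σ R) := fun α hα => by simp at hα

lemma IndGe.sum {ι : Type*} {t : ℝ} (S : Finset ι) (f : ι → MvPolynomial σ R) (h : ∀ i ∈ S, IndGe w t (f i)) :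
    IndGe w t (∑ i ∈ S, f i) := by
  intro α hα
  rw [coeff_sum] at hα
  obtain ⟨i, hi, h'⟩ := Finset.exists_ne_zero_of_sum_ne_zero hα
  exact h i hi α h'

lemma IndGe.mul {t t' : ℝ} {P Q : MvPolynomial σ R} (h : IndGe w t P) (h' : IndGe w t' Q) :
    IndGe w (t + t') (P * Q) := by
  classical
  intro α hα
  rw [coeff_mul] at hα
  obtain ⟨i, hi, h2⟩ := Finset.exists_ne_zero_of_sum_ne_zero hα
  rw [← Finset.HasAntidiagonal.mem_antidiagonal.1 hi, wt_add]
  exact add_le_add (h _ (left_ne_zero_of_mul h2)) (h' _ (right_ne_zero_of_mul h2))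

lemma IndGe.smul {t : ℝ} {P : MvPolynomial σ R} (h : IndGe w t P) (c : R) : IndGe w t (c • P) := by
  intro α hα
  rw [coeff_smul, smul_eq_mul] at hα
  exact h α (right_ne_zero_of_mul hα)

lemma IndGe.prod {ι : Type*} {t : ι → ℝ} (S : Finset ι) (f : ι → MvPolynomial σ R)
    (h : ∀ i ∈ S, IndGe w (t i) (f i)) :
    IndGe w (∑ i ∈ S, t i) (∏ i ∈ S, f i) := by
  classical
  induction S using Finset.induction_on with
  | empty =>
    intro α hα
    simp only [Finset.prod_empty, coeff_one] at hα
    split_ifs at hα with h0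
    · subst h0; simp [wt]
    · simp at hα
  | insert a S ha ih =>
    rw [Finset.prod_insert ha, Finset.sum_insert ha]
    exact (h a (by simp)).mul (ih fun i hi => h i (by simp [hi]))

lemma IndGe.det {k : ℕ} {t : Fin k → ℝ} (M : Matrix (Fin k) (Fin k) (MvPolynomial σ R))
    (h : ∀ a b, IndGe w (t b) (M a b)) : IndGe w (∑ b, t b) M.det := by
  rw [Matrix.det_apply]
  refine IndGe.sum _ _ fun τ _ => ?_
  have : IndGe w (∑ b, t b) (∏ i, M (τ i) i) := IndGe.prod _ _ fun i _ => h _ _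
  rcases Int.units_eq_one_or (Equiv.Perm.sign τ) with h1 | h1
  · rw [h1]; simpa using this
  · rw [h1]
    have e : (-1 : ℤˣ) • (∏ i, M (τ i) i) = (-1 : R) • (∏ i, M (τ i) i) := by simp
    rw [e]
    exact this.smul _

end IndGe

noncomputable def hd {σ R : Type*} [Fintype σ] [CommRing R] (k : σ →₀ ℕ) (P : MvPolynomial σ R) : MvPolynomial σ R :=
  ∑ α ∈ P.support, monomial (α - k) (coeff α P * ((∏ i, (α i).choose (k i) : ℕ) : R))

section hd
variable {σ R : Type*} [Fintype σ] [CommRing R]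

lemma coeff_hd (k : σ →₀ ℕ) (P : MvPolynomial σ R) (β : σ →₀ ℕ) :
    coeff β (hd k P) = coeff (β + k) P * ((∏ i, ((β + k) i).choose (k i) : ℕ) : R) := by
  classical
  unfold hd
  rw [coeff_sum, Finset.sum_eq_single (β + k)]
  · rw [coeff_monomial, if_pos (by simp)]
  · intro α _ hα
    rw [coeff_monomial]
    split_ifs with h
    · by_cases hk : k ≤ α
      · exact absurd (by rw [← h, tsub_add_cancel_of_le hk]) hα
      · rw [Finsupp.le_def] at hk
        push Not at hk
        obtain ⟨i, hi⟩ := hk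
        rw [Finset.prod_eq_zero (Finset.mem_univ i) (Nat.choose_eq_zero_of_lt hi)]
        simp
    · rfl
  · intro h
    rw [notMem_support_iff.1 h]; simp

lemma degreeOf_hd_le (k : σ →₀ ℕ) (P : MvPolynomial σ R) (i : σ) : degreeOf i (hd k P) ≤ degreeOf i P := by
  rw [degreeOf_le_iff]
  intro β hβ
  rw [mem_support_iff, coeff_hd] at hβ
  have := degreeOf_le_iff.1 (le_refl (degreeOf i P)) _ (mem_support_iff.2 (left_ne_zero_of_mul hβ))
  simp at this; omega

lemma IndGe.hd {w : σ → ℝ} {t : ℝ} {P : MvPolynomial σ R} (h : IndGe w t P) (k : σ →₀ ℕ) :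
    IndGe w (t - wt w k) (hd k P) := by
  intro α hα
  rw [coeff_hd] at hα
  have := h _ (left_ne_zero_of_mul hα)
  rw [wt_add] at this; linarith

end hd

lemma l1_hd_le {σ : Type*} [Fintype σ] (k : σ →₀ ℕ) (P : MvPolynomial σ ℤ) (r : σ → ℕ)
    (hr : ∀ i, degreeOf i P ≤ r i) : l1 nZ (hd k P) ≤ 2 ^ (∑ i, r i) * l1 nZ P := by
  unfold hd
  refine (l1_sum_le _ _ _).trans ?_
  rw [l1, Finset.mul_sum]
  refine Finset.sum_le_sum fun α hα => ?_
  rw [l1_monomial, nZ_apply, nZ_apply]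
  push_cast
  rw [abs_mul, mul_comm]
  refine mul_le_mul_of_nonneg_right ?_ (abs_nonneg _)
  rw [abs_of_nonneg (Finset.prod_nonneg fun _ _ => Nat.cast_nonneg _)]
  have : (∏ i, (α i).choose (k i)) ≤ 2 ^ (∑ i, r i) := by
    rw [← Finset.prod_pow_eq_pow_sum]
    refine Finset.prod_le_prod' fun i _ => ?_
    exact (Nat.choose_le_two_pow _ _).trans (Nat.pow_le_pow_right (by norm_num)
      (degreeOf_le_iff.1 (hr i) α hα))
  exact_mod_cast this

lemma coeff_DL_fact {σ R : Type*} [Fintype σ] [CommRing R] (l : List σ) (P : MvPolynomial σ R) :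
    ∀ k : σ →₀ ℕ, coeff k (DL l P) * ((∏ i, (k i).factorial : ℕ) : R) =
      coeff (k + cnt l) P * ((∏ i, ((k + cnt l) i).factorial : ℕ) : R) := by
  classical
  induction l with
  | nil => intro k; simp [cnt]
  | cons s l ih =>
    intro k
    have h := ih (k + Finsupp.single s 1)
    have e : k + Finsupp.single s 1 + cnt l = k + cnt (s :: l) := by simp [cnt, add_assoc]
    rw [e] at h
    rw [← h, DL_cons, coeff_pderiv', mul_assoc]
    congr 1
    have : (∏ i, ((k + Finsupp.single s 1 : σ →₀ ℕ) i).factorial) = (k s + 1) * ∏ i, (k i).factorial := by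
      rw [← Finset.mul_prod_erase _ _ (Finset.mem_univ s), ← Finset.mul_prod_erase _ (fun i => (k i).factorial) (Finset.mem_univ s)]
      rw [← mul_assoc]
      congr 1
      · simp [Nat.factorial_succ]
      · refine Finset.prod_congr rfl fun i hi => ?_
        simp [(Finset.ne_of_mem_erase hi).symm]
    rw [this]; push_cast; ring

lemma DL_eq_hd {σ R : Type*} [Fintype σ] [Field R] [CharZero R] (l : List σ) (P : MvPolynomial σ R) :
    DL l P = ((∏ i, (cnt l i).factorial : ℕ) : R) • hd (cnt l) P := by
  ext k
  have h := coeff_DL_fact l P k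
  rw [coeff_smul, smul_eq_mul, coeff_hd]
  have h0 : ((∏ i, (k i).factorial : ℕ) : R) ≠ 0 := by
    rw [Nat.cast_ne_zero]; exact Finset.prod_ne_zero_iff.2 fun i _ => Nat.factorial_ne_zero _
  apply mul_right_cancel₀ h0
  rw [h, mul_comm _ (coeff _ P * _), mul_assoc, mul_assoc]
  congr 1
  rw [← Nat.cast_mul, ← Nat.cast_mul, ← Finset.prod_mul_distrib, ← Finset.prod_mul_distrib]
  congr 1
  refine Finset.prod_congr rfl fun i _ => ?_
  have := Nat.add_choose_mul_factorial_mul_factorial (k i) (cnt l i)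
  rw [Finsupp.add_apply, ← this]
  have e : (k i + cnt l i).choose (cnt l i) = (k i + cnt l i).choose (k i) := by
    rw [Nat.choose_symm_add]
  rw [e]; ring

lemma shift_hd {σ R : Type*} [Fintype σ] [Field R] [CharZero R] (ξ : σ → R) (k : σ →₀ ℕ) (P : MvPolynomial σ R) :
    shift ξ (hd k P) = hd k (shift ξ P) := by
  obtain ⟨l, rfl⟩ := exists_list_cnt k
  have h0 : ((∏ i, (cnt l i).factorial : ℕ) : R) ≠ 0 := by
    rw [Nat.cast_ne_zero]; exact Finset.prod_ne_zero_iff.2 fun i _ => Nat.factorial_ne_zero _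
  have := shift_DL ξ l P
  rw [DL_eq_hd, DL_eq_hd, map_smul] at this
  exact smul_right_injective _ h0 this

lemma map_hd {σ : Type*} [Fintype σ] (k : σ →₀ ℕ) (P : MvPolynomial σ ℤ) :
    map (Int.castRingHom ℚ) (hd k P) = hd k (map (Int.castRingHom ℚ) P) := by
  ext β
  simp [coeff_map, coeff_hd]

lemma cnt_sum {σ : Type*} [Fintype σ] (l : List σ) : ∑ i, cnt l i = l.length := by
  classical
  induction l with
  | nil => simp [cnt]
  | cons s l ih =>
    have : cnt (s :: l) = Finsupp.single s 1 + cnt l := by simp [cnt]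
    rw [this]
    simp [Finset.sum_add_distrib, ih, Finsupp.single_apply, add_comm]

end Schmidt

end PartF2

section PartF3
open MvPolynomial

namespace Schmidt

lemma shift_rename_succ {m : ℕ} {R : Type*} [CommRing R] (ξ : Fin (m+1) → R) (U : MvPolynomial (Fin m) R) :
    shift ξ (rename Fin.succ U) = rename Fin.succ (shift (fun i => ξ i.succ) U) := by
  have : ((shift ξ).comp (rename Fin.succ) : MvPolynomial (Fin m) R →ₐ[R] _) =
      (rename Fin.succ).comp (shift (fun i => ξ i.succ)) := by
    ext i; simp [shift]
  exact DFunLike.congr_fun this U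

lemma shift_aeval_X {m : ℕ} {R : Type*} [CommRing R] (ξ : Fin (m+1) → R) (V : Polynomial R) :
    shift ξ (Polynomial.aeval (X 0) V) = Polynomial.aeval (X 0 : MvPolynomial (Fin (m+1)) R) (Polynomial.taylor (ξ 0) V) := by
  have : ((shift ξ).comp (Polynomial.aeval (X 0)) : Polynomial R →ₐ[R] _) =
      (Polynomial.aeval (X 0 : MvPolynomial (Fin (m+1)) R)).comp (Polynomial.taylorAlgHom (ξ 0)) := by
    ext; simp [shift]
  exact DFunLike.congr_fun this V

lemma coeff_cons_mul {m : ℕ} {R : Type*} [CommRing R] (U : MvPolynomial (Fin m) R) (V : Polynomial R) (e : ℕ) (α : Fin m →₀ ℕ) :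
    coeff (α.cons e) (rename Fin.succ U * Polynomial.aeval (X 0) V) = coeff α U * V.coeff e := by
  rw [← finSuccEquiv_coeff_coeff, map_mul]
  have h1 : finSuccEquiv R m (rename Fin.succ U) = Polynomial.C U := by
    have : ((finSuccEquiv R m : _ →ₐ[R] _).comp (rename Fin.succ)) = (Algebra.ofId (MvPolynomial (Fin m) R) (Polynomial (MvPolynomial (Fin m) R))).restrictScalars R := by
      ext i; simp [finSuccEquiv_X_succ, Algebra.ofId_apply]
    exact DFunLike.congr_fun this U
  have h2 : finSuccEquiv R m (Polynomial.aeval (X 0) V) = V.map C := by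
    have : ((finSuccEquiv R m : _ →ₐ[R] _).comp (Polynomial.aeval (X 0 : MvPolynomial (Fin (m+1)) R))) = Polynomial.mapAlgHom (Algebra.ofId R (MvPolynomial (Fin m) R)) := by
      ext; simp [finSuccEquiv_X_zero]
    have := DFunLike.congr_fun this V
    simpa using this
  rw [h1, h2, Polynomial.coeff_C_mul, Polynomial.coeff_map, mul_comm U, coeff_C_mul, mul_comm]

lemma one_var_order (V : Polynomial ℤ) (hV : V ≠ 0) (p q : ℤ) (hpq : IsCoprime p q) (hq : q ≠ 0) (B : ℝ)
    (hB : ∀ i, |(V.coeff i : ℝ)| ≤ B) :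
    ∃ e : ℕ, (Polynomial.taylor ((p : ℚ) / q) (V.map (Int.castRingHom ℚ))).coeff e ≠ 0 ∧
      (max |(p:ℝ)| |(q:ℝ)|) ^ e ≤ B := by
  set VQ := V.map (Int.castRingHom ℚ) with hVQ
  set ξ : ℚ := (p : ℚ) / q with hξ
  have hVQ0 : VQ ≠ 0 := (Polynomial.map_ne_zero_iff (Int.cast_injective)).2 hV
  set F := Polynomial.taylor ξ VQ with hF
  have hF0 : F ≠ 0 := by
    rw [hF, Ne, Polynomial.taylor_eq_zero]; exact hVQ0
  refine ⟨F.natTrailingDegree, ?_, ?_⟩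
  · exact Polynomial.trailingCoeff_nonzero_iff_nonzero.2 hF0
  set e := F.natTrailingDegree
  have hX : Polynomial.X ^ e ∣ F := Polynomial.X_pow_dvd_iff.2 fun i hi => Polynomial.coeff_eq_zero_of_lt_natTrailingDegree hi
  have hd : (Polynomial.X - Polynomial.C ξ) ^ e ∣ VQ := by
    obtain ⟨G, hG⟩ := hX
    refine ⟨Polynomial.taylor (-ξ) G, ?_⟩
    have : Polynomial.taylor (-ξ) F = VQ := by
      rw [hF, Polynomial.taylor_taylor]; simp
    rw [← this, hG, Polynomial.taylor_mul, Polynomial.taylor_pow, Polynomial.taylor_X]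
    simp [sub_eq_add_neg]
  let lin : Polynomial ℤ := Polynomial.C q * Polynomial.X + Polynomial.C (-p)
  have hprim : lin.IsPrimitive := by
    rw [Polynomial.isPrimitive_iff_isUnit_of_C_dvd]
    intro r hr
    rw [Polynomial.C_dvd_iff_dvd_coeff] at hr
    have h0 := hr 0
    have h1 := hr 1
    have c0 : lin.coeff 0 = -p := by simp only [lin, Polynomial.coeff_add, Polynomial.coeff_C_mul, Polynomial.coeff_X_zero, Polynomial.coeff_C_zero]; ring
    have c1 : lin.coeff 1 = q := by simp only [lin, Polynomial.coeff_add, Polynomial.coeff_C_mul, Polynomial.coeff_X_one, Polynomial.coeff_C_succ]; ring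
    rw [c0, dvd_neg] at h0
    rw [c1] at h1
    exact hpq.isUnit_of_dvd' h0 h1
  have hdvd : lin ^ e ∣ V := by
    have hp : (lin ^ e).IsPrimitive := by
      have : ∀ n : ℕ, (lin ^ n).IsPrimitive := by
        intro n
        induction n with
        | zero => rw [pow_zero]; exact Polynomial.isPrimitive_one
        | succ n ih => rw [pow_succ]; exact Polynomial.IsPrimitive.mul ih hprim
      exact this e
    rw [Polynomial.IsPrimitive.Int.dvd_iff_map_cast_dvd_map_cast _ _ hp]
    have e2 : (lin ^ e).map (Int.castRingHom ℚ) = Polynomial.C ((q:ℚ) ^ e) * (Polynomial.X - Polynomial.C ξ) ^ e := by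
      have : (lin.map (Int.castRingHom ℚ)) = Polynomial.C (q : ℚ) * (Polynomial.X - Polynomial.C ξ) := by
        have hq' : (q : ℚ) ≠ 0 := by exact_mod_cast hq
        simp only [lin, Polynomial.map_add, Polynomial.map_mul, Polynomial.map_C, Polynomial.map_X, mul_sub]
        rw [← Polynomial.C_mul, hξ, mul_div_cancel₀ _ hq']
        simp [sub_eq_add_neg]
      rw [Polynomial.map_pow, this, mul_pow, Polynomial.C_pow]
    rw [e2]
    have hq' : (q : ℚ) ^ e ≠ 0 := pow_ne_zero _ (by exact_mod_cast hq)
    have u1 : IsUnit (Polynomial.C ((q:ℚ) ^ e)) := Polynomial.isUnit_C.2 (isUnit_iff_ne_zero.2 hq')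
    rw [u1.mul_left_dvd]
    exact hd
  obtain ⟨G, hG⟩ := hdvd
  have hG0 : G ≠ 0 := by rintro rfl; exact hV (by simpa using hG)
  have one_le : ∀ z : ℤ, z ≠ 0 → (1:ℝ) ≤ |(z:ℝ)| := fun z hz => by exact_mod_cast Int.one_le_abs hz
  have hlead : |(q:ℝ)| ^ e ≤ B := by
    have h1 : V.leadingCoeff = q ^ e * G.leadingCoeff := by
      rw [hG, Polynomial.leadingCoeff_mul, Polynomial.leadingCoeff_pow]
      rw [Polynomial.leadingCoeff_linear hq]
    have h2 := hB V.natDegree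
    change |((V.leadingCoeff : ℤ) : ℝ)| ≤ B at h2
    rw [h1] at h2; push_cast at h2; rw [abs_mul, abs_pow] at h2
    have := one_le _ (Polynomial.leadingCoeff_ne_zero.2 hG0)
    nlinarith [pow_nonneg (abs_nonneg (q:ℝ)) e]
  have htrail : |(p:ℝ)| ^ e ≤ B := by
    by_cases hp0 : p = 0
    · subst hp0
      rcases Nat.eq_zero_or_pos e with h | h
      · rw [h] at hlead ⊢; simpa using hlead
      · have : (0:ℝ) ≤ B := (abs_nonneg _).trans (hB 0)
        simp [zero_pow h.ne', this]
    have h1 : V.trailingCoeff = (-p) ^ e * G.trailingCoeff := by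
      have hl : lin.trailingCoeff = -p := by
        have hc0 : lin.coeff 0 = -p := by simp [lin]
        rw [Polynomial.trailingCoeff, Polynomial.natTrailingDegree_eq_zero_of_constantCoeff_ne_zero, hc0]
        simpa [Polynomial.constantCoeff_apply, hc0] using hp0
      have hpow : ∀ n : ℕ, (lin ^ n).trailingCoeff = (-p) ^ n := by
        intro n
        induction n with
        | zero => simp [Polynomial.trailingCoeff]
        | succ n ih => rw [pow_succ, Polynomial.trailingCoeff_mul, ih, hl, pow_succ]
      rw [hG, Polynomial.trailingCoeff_mul, hpow]
    have h2 := hB V.natTrailingDegree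
    change |((V.trailingCoeff : ℤ) : ℝ)| ≤ B at h2
    rw [h1] at h2; push_cast at h2; rw [abs_mul, abs_pow, abs_neg] at h2
    have := one_le _ (Polynomial.trailingCoeff_nonzero_iff_nonzero.2 hG0)
    nlinarith [pow_nonneg (abs_nonneg (p:ℝ)) e]
  rcases max_choice |(p:ℝ)| |(q:ℝ)| with h | h <;> rw [h] <;> assumption

end Schmidt

end PartF3

section PartF4
open MvPolynomial

namespace Schmidt

lemma rename_zero_eq {m : ℕ} {R : Type*} [CommRing R] (V : MvPolynomial (Fin 1) R) :
    rename (fun _ => (0 : Fin (m+1))) V = Polynomial.aeval (X 0 : MvPolynomial (Fin (m+1)) R)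
      (aeval (fun _ => (Polynomial.X : Polynomial R)) V) := by
  have : (rename (fun _ => (0 : Fin (m+1))) : MvPolynomial (Fin 1) R →ₐ[R] _) =
    (Polynomial.aeval (X 0 : MvPolynomial (Fin (m+1)) R)).comp (aeval (fun _ => (Polynomial.X : Polynomial R))) := by
    ext i; simp
  exact DFunLike.congr_fun this V

lemma coeff_aeval_X {R : Type*} [CommRing R] (V : MvPolynomial (Fin 1) R) (e : ℕ) :
    (aeval (fun _ => (Polynomial.X : Polynomial R)) V).coeff e = coeff (Finsupp.single 0 e) V := by
  classical
  induction V using MvPolynomial.induction_on' with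
  | add p q hp hq => simp [hp, hq]
  | monomial u a =>
    have hu : u = Finsupp.single 0 (u 0) := by ext; simp
    have : (u = Finsupp.single 0 e) ↔ e = u 0 := by
      constructor
      · intro h; rw [h]; simp
      · intro h; rw [h, ← hu]
    rw [aeval_monomial, coeff_monomial]
    simp only [this]
    rw [Finsupp.prod_fintype _ _ (by simp)]
    simp [Polynomial.coeff_X_pow]

lemma coeff_cons_rename {m : ℕ} {R : Type*} [CommRing R] (U : MvPolynomial (Fin m) R) (V : MvPolynomial (Fin 1) R)
    (e : ℕ) (α : Fin m →₀ ℕ) :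
    coeff (α.cons e) (rename Fin.succ U * rename (fun _ => (0 : Fin (m+1))) V) = coeff α U * coeff (Finsupp.single 0 e) V := by
  rw [rename_zero_eq, coeff_cons_mul, coeff_aeval_X]

lemma hd_rename_mul {m : ℕ} {R : Type*} [CommRing R] (U : MvPolynomial (Fin m) R) (V : MvPolynomial (Fin 1) R)
    (e : ℕ) (α : Fin m →₀ ℕ) :
    hd (α.cons e) (rename Fin.succ U * rename (fun _ => (0 : Fin (m+1))) V) =
      rename Fin.succ (hd α U) * rename (fun _ => (0 : Fin (m+1))) (hd (Finsupp.single 0 e) V) := by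
  ext β
  obtain ⟨f, γ, rfl⟩ : ∃ f γ, β = Finsupp.cons f γ := ⟨β 0, Finsupp.tail β, (Finsupp.cons_tail β).symm⟩
  have hadd : (Finsupp.cons f γ + Finsupp.cons e α : Fin (m+1) →₀ ℕ) = Finsupp.cons (f + e) (γ + α) := by
    ext i; refine Fin.cases ?_ (fun i => ?_) i <;> simp
  rw [coeff_hd, hadd, coeff_cons_rename, coeff_cons_rename, coeff_hd, coeff_hd, ← Finsupp.single_add, Fin.prod_univ_succ]
  simp
  ring

lemma hd_sum {σ R ι : Type*} [Fintype σ] [CommRing R] (k : σ →₀ ℕ) (S : Finset ι) (f : ι → MvPolynomial σ R) :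
    hd k (∑ i ∈ S, f i) = ∑ i ∈ S, hd k (f i) := by
  ext β
  simp [coeff_hd, coeff_sum, Finset.sum_mul]

lemma wronskian_hd {σ : Type*} [Fintype σ] {k : ℕ} (φ : Fin k → MvPolynomial σ ℚ)
    (hφ : LinearIndependent ℚ φ) :
    ∃ l : Fin k → (σ →₀ ℕ), (∀ a, ∑ i, l a i ≤ a) ∧
      (Matrix.of fun a j => hd (l a) (φ j)).det ≠ 0 := by
  obtain ⟨l, h1, h2⟩ := exists_wronskian φ hφ
  refine ⟨fun a => cnt (l a), fun a => by rw [cnt_sum]; exact h1 a, fun h0 => h2 ?_⟩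
  have : (Matrix.of fun a j => DL (l a) (φ j)) = Matrix.of fun a j =>
      (C (((∏ i, (cnt (l a) i).factorial : ℕ) : ℚ)) : MvPolynomial σ ℚ) * (Matrix.of fun a j => hd (cnt (l a)) (φ j)) a j := by
    ext1 a j
    simp only [Matrix.of_apply]
    rw [DL_eq_hd, smul_eq_C_mul]
  rw [this, Matrix.det_mul_column, h0, mul_zero]

lemma decomp {m : ℕ} (P : MvPolynomial (Fin (m+1)) ℚ) (hP : P ≠ 0) (r : ℕ) (hr : degreeOf 0 P ≤ r) :
    ∃ (k : ℕ) (φ : Fin k → MvPolynomial (Fin m) ℚ) (ψ : Fin k → MvPolynomial (Fin 1) ℚ), 1 ≤ k ∧ k ≤ r + 1 ∧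
      LinearIndependent ℚ φ ∧ LinearIndependent ℚ ψ ∧
      P = ∑ j, rename Fin.succ (φ j) * rename (fun _ => (0 : Fin (m+1))) (ψ j) := by
  classical
  set f := finSuccEquiv ℚ m P with hf
  let S := Submodule.span ℚ (Set.range fun b : Fin (r+1) => f.coeff b)
  have : Module.Finite ℚ S := Module.Finite.span_of_finite ℚ (Set.finite_range _)
  let bs := Module.finBasis ℚ S
  let k := Module.finrank ℚ S
  have hmem : ∀ b : Fin (r+1), f.coeff b ∈ S := fun b => Submodule.subset_span ⟨b, rfl⟩
  let c : Fin k → Fin (r+1) → ℚ := fun j b => bs.repr ⟨f.coeff b, hmem b⟩ j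
  let ψ : Fin k → MvPolynomial (Fin 1) ℚ := fun j => ∑ b : Fin (r+1), monomial (Finsupp.single 0 (b:ℕ)) (c j b)
  have hψc : ∀ j (e : ℕ), coeff (Finsupp.single 0 e) (ψ j) = if h : e < r + 1 then c j ⟨e, h⟩ else 0 := by
    intro j e
    simp only [ψ, coeff_sum, coeff_monomial]
    have : ∀ b : Fin (r+1), ((Finsupp.single (0 : Fin 1) (b:ℕ) = Finsupp.single 0 e) ↔ (b:ℕ) = e) := fun b =>
      (Finsupp.single_injective _).eq_iff
    simp only [this]
    split_ifs with h
    · rw [Finset.sum_eq_single ⟨e, h⟩]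
      · simp
      · intro b _ hb; rw [if_neg]; intro hh; exact hb (Fin.ext hh)
      · simp
    · refine Finset.sum_eq_zero fun b _ => if_neg fun (hh : (b:ℕ) = e) => h (hh ▸ b.2)
  have hdeg : ∀ e, ¬ e < r + 1 → f.coeff e = 0 := by
    intro e he
    apply Polynomial.coeff_eq_zero_of_natDegree_lt
    rw [hf, natDegree_finSuccEquiv]; omega
  have hsum : P = ∑ j, rename Fin.succ ((bs j : S) : MvPolynomial (Fin m) ℚ) * rename (fun _ => (0 : Fin (m+1))) (ψ j) := by
    ext β
    obtain ⟨e, γ, rfl⟩ : ∃ f γ, β = Finsupp.cons f γ := ⟨β 0, Finsupp.tail β, (Finsupp.cons_tail β).symm⟩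
    rw [← finSuccEquiv_coeff_coeff, coeff_sum, ← hf]
    simp only [coeff_cons_rename, hψc]
    split_ifs with h
    · have h1 := congrArg S.subtype (bs.sum_repr ⟨f.coeff e, hmem ⟨e, h⟩⟩)
      rw [map_sum] at h1
      simp only [map_smul, Submodule.subtype_apply] at h1
      rw [← h1, coeff_sum]
      refine Finset.sum_congr rfl fun j _ => ?_
      rw [coeff_smul, smul_eq_mul, mul_comm]
    · simp [hdeg e h]
  refine ⟨k, fun j => bs j, ψ, ?_, ?_, ?_, ?_, hsum⟩
  · by_contra hk
    apply hP
    rw [hsum]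
    have : IsEmpty (Fin k) := ⟨fun x => by have := x.2; omega⟩
    exact Fintype.sum_empty _
  · have := finrank_range_le_card (R := ℚ) (fun b : Fin (r+1) => f.coeff b)
    rw [Fintype.card_fin] at this
    exact this
  · exact bs.linearIndependent.map' S.subtype (Submodule.ker_subtype S)
  · rw [Fintype.linearIndependent_iff]
    intro a ha
    let g : S →ₗ[ℚ] ℚ := ∑ j, a j • bs.coord j
    have hg : g = 0 := by
      have hz : ∀ b : Fin (r+1), g ⟨f.coeff b, hmem b⟩ = 0 := by
        intro b
        have := congrArg (coeff (Finsupp.single 0 (b:ℕ))) ha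
        simp only [coeff_sum, coeff_smul, hψc, b.2, dif_pos] at this
        simpa [g, c] using this
      have : ∀ x (hx : x ∈ S), g ⟨x, hx⟩ = 0 := by
        intro x hx
        induction hx using Submodule.span_induction with
        | mem x hx => obtain ⟨b, rfl⟩ := hx; exact hz b
        | zero => exact map_zero g
        | add x y hx hy h1 h2 => 
          have := map_add g ⟨x, hx⟩ ⟨y, hy⟩
          rw [h1, h2, add_zero] at this; exact this
        | smul t x hx h =>
          have := map_smul g t ⟨x, hx⟩
          rw [h, smul_zero] at this; exact this
      ext x; exact this x.1 x.2
    intro j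
    have := LinearMap.congr_fun hg (bs j)
    simpa [g, Finsupp.single_apply] using this

lemma wronskian_factor {m : ℕ} (P : MvPolynomial (Fin (m+1)) ℚ) (hP : P ≠ 0) (r : ℕ) (hr : degreeOf 0 P ≤ r) :
    ∃ (k : ℕ) (α : Fin k → (Fin m →₀ ℕ)) (e : Fin k → ℕ) (U : MvPolynomial (Fin m) ℚ) (V : Polynomial ℚ),
      1 ≤ k ∧ k ≤ r + 1 ∧ (∀ a, ∑ i, α a i ≤ a) ∧ (∀ b, e b ≤ b) ∧ U ≠ 0 ∧ V ≠ 0 ∧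
      (Matrix.of fun a b => hd ((α a).cons (e b)) P).det = rename Fin.succ U * Polynomial.aeval (X 0) V := by
  obtain ⟨k, φ, ψ, hk1, hk2, hφ, hψ, hs⟩ := decomp P hP r hr
  obtain ⟨α, hα, hA⟩ := wronskian_hd φ hφ
  obtain ⟨e, he, hB⟩ := wronskian_hd ψ hψ
  set A := Matrix.of fun a j => hd (α a) (φ j) with hAd
  set B := Matrix.of fun a j => hd (e a) (ψ j) with hBd
  refine ⟨k, α, fun b => e b 0, A.det, aeval (fun _ => (Polynomial.X : Polynomial ℚ)) B.det, hk1, hk2, hα, ?_, hA, ?_, ?_⟩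
  · intro b; have := he b; simpa using this
  · intro h0
    have h1 := rename_zero_eq (m := 0) B.det
    rw [h0, map_zero] at h1
    exact hB (rename_injective _ (fun a b _ => Subsingleton.elim a b) (by rw [h1, map_zero]))
  · rw [← rename_zero_eq]
    have h1 : rename Fin.succ A.det = (A.map (rename Fin.succ : MvPolynomial (Fin m) ℚ →ₐ[ℚ] MvPolynomial (Fin (m+1)) ℚ)).det :=
      AlgHom.map_det _ A
    have h2 : rename (fun _ => (0 : Fin (m+1))) B.det = (B.map (rename (fun _ => (0 : Fin (m+1))) : MvPolynomial (Fin 1) ℚ →ₐ[ℚ] MvPolynomial (Fin (m+1)) ℚ)).det :=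
      AlgHom.map_det _ B
    rw [h1, h2, ← Matrix.det_transpose (B.map _), ← Matrix.det_mul]
    congr 1
    ext1 a b
    simp only [Matrix.of_apply, Matrix.mul_apply, Matrix.map_apply, Matrix.transpose_apply, A, B]
    conv_lhs => rw [hs]
    rw [hd_sum]
    refine Finset.sum_congr rfl fun j _ => ?_
    rw [hd_rename_mul]
    congr 3
    ext; simp

lemma int_factor {m : ℕ} (W : MvPolynomial (Fin (m+1)) ℤ) (U : MvPolynomial (Fin m) ℚ) (V : Polynomial ℚ)
    (hU : U ≠ 0) (hV : V ≠ 0) (h : map (Int.castRingHom ℚ) W = rename Fin.succ U * Polynomial.aeval (X 0) V) :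
    ∃ (U1 : MvPolynomial (Fin m) ℤ) (V1 : Polynomial ℤ) (c : ℚ), U1 ≠ 0 ∧ V1 ≠ 0 ∧ l1 nZ U1 ≤ l1 nZ W ∧
      (∀ e, |(V1.coeff e : ℝ)| ≤ l1 nZ W) ∧ (∀ i, degreeOf i U1 ≤ degreeOf i.succ W) ∧
      c • map (Int.castRingHom ℚ) W = rename Fin.succ (map (Int.castRingHom ℚ) U1) *
        Polynomial.aeval (X 0) (V1.map (Int.castRingHom ℚ)) := by
  classical
  obtain ⟨α0, hα0⟩ := ne_zero_iff.1 hU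
  obtain ⟨e0, he0⟩ : ∃ e, V.coeff e ≠ 0 := by
    by_contra hh; push Not at hh; exact hV (Polynomial.ext (by simpa using hh))
  have hc : ∀ e α, ((coeff (Finsupp.cons e α) W : ℤ) : ℚ) = coeff α U * V.coeff e := by
    intro e α
    rw [← coeff_cons_mul, ← h, coeff_map]; rfl
  let U1 := (finSuccEquiv ℤ m W).coeff e0
  have hU1 : ∀ α, coeff α U1 = coeff (Finsupp.cons e0 α) W := fun α => finSuccEquiv_coeff_coeff _ _ _
  let V1 : Polynomial ℤ := ∑ e ∈ Finset.range (degreeOf 0 W + 1), Polynomial.monomial e (coeff (Finsupp.cons e α0) W)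
  have hV1 : ∀ e, V1.coeff e = coeff (Finsupp.cons e α0) W := by
    intro e
    simp only [V1, Polynomial.finsetSum_coeff, Polynomial.coeff_monomial]
    rw [Finset.sum_ite_eq' ]
    split_ifs with hh
    · rfl
    · symm
      by_contra h0
      have := monomial_le_degreeOf 0 (mem_support_iff.2 h0)
      simp at this hh
      omega
  refine ⟨U1, V1, coeff α0 U * V.coeff e0, ?_, ?_, ?_, ?_, ?_, ?_⟩
  · intro h0
    have := hU1 α0
    rw [h0, coeff_zero] at this
    have h2 := hc e0 α0
    rw [← this] at h2
    exact mul_ne_zero hα0 he0 (by simpa using h2.symm)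
  · intro h0
    have := hV1 e0
    rw [h0, Polynomial.coeff_zero] at this
    have h2 := hc e0 α0
    rw [← this] at h2
    exact mul_ne_zero hα0 he0 (by simpa using h2.symm)
  · have hinj : Function.Injective (fun α : Fin m →₀ ℕ => (Finsupp.cons e0 α : Fin (m+1) →₀ ℕ)) :=
      Finsupp.cons_right_injective e0
    have hsub : U1.support.image (fun α : Fin m →₀ ℕ => (Finsupp.cons e0 α : Fin (m+1) →₀ ℕ)) ⊆ W.support := by
      intro β hβ
      obtain ⟨α, hα, rfl⟩ := Finset.mem_image.1 hβ
      rw [mem_support_iff, hU1] at hα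
      exact mem_support_iff.2 hα
    unfold l1
    calc ∑ α ∈ U1.support, nZ (coeff α U1) = ∑ β ∈ U1.support.image (fun α : Fin m →₀ ℕ => (Finsupp.cons e0 α : Fin (m+1) →₀ ℕ)), nZ (coeff β W) := by
          rw [Finset.sum_image hinj.injOn]; simp [hU1]
      _ ≤ _ := Finset.sum_le_sum_of_subset_of_nonneg hsub fun _ _ _ => apply_nonneg nZ _
  · intro e
    rw [hV1]; exact coeff_le_l1 nZ W _
  · intro i
    exact degreeOf_coeff_finSuccEquiv W i e0
  · ext β
    obtain ⟨e, γ, rfl⟩ : ∃ f γ, β = Finsupp.cons f γ := ⟨β 0, Finsupp.tail β, (Finsupp.cons_tail β).symm⟩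
    rw [coeff_cons_mul, coeff_smul, coeff_map, coeff_map, Polynomial.coeff_map, hU1, hV1]
    simp only [eq_intCast, hc, smul_eq_mul]
    ring

end Schmidt

end PartF4

section PartF5
open MvPolynomial

namespace Schmidt

lemma degreeOf_det_le {σ : Type*} {k : ℕ} (M : Matrix (Fin k) (Fin k) (MvPolynomial σ ℤ)) (i : σ) (r : ℕ)
    (h : ∀ a b, degreeOf i (M a b) ≤ r) : degreeOf i M.det ≤ k * r := by
  classical
  rw [degreeOf_le_iff]
  intro β hβ
  rw [mem_support_iff, Matrix.det_apply, coeff_sum] at hβ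
  obtain ⟨τ, _, hτ⟩ := Finset.exists_ne_zero_of_sum_ne_zero hβ
  have h1 : coeff β (∏ b, M (τ b) b) ≠ 0 := by
    intro h0; apply hτ
    rw [Units.smul_def, coeff_smul, h0, smul_zero]
  have h2 := monomial_le_degreeOf i (mem_support_iff.2 h1)
  refine h2.trans ((degreeOf_prod_le i Finset.univ _).trans ?_)
  refine (Finset.sum_le_sum fun b _ => h (τ b) b).trans ?_
  simp

lemma l1_det_le {σ : Type*} {k : ℕ} (M : Matrix (Fin k) (Fin k) (MvPolynomial σ ℤ)) (B : ℝ)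
    (h : ∀ a b, l1 nZ (M a b) ≤ B) : l1 nZ M.det ≤ k.factorial * B ^ k := by
  rw [Matrix.det_apply]
  refine (l1_sum_le _ _ _).trans ?_
  have : ∀ τ : Equiv.Perm (Fin k), l1 nZ (Equiv.Perm.sign τ • ∏ b, M (τ b) b) ≤ B ^ k := by
    intro τ
    have h1 : l1 nZ (Equiv.Perm.sign τ • ∏ b, M (τ b) b) = l1 nZ (∏ b, M (τ b) b) := by
      rcases Int.units_eq_one_or (Equiv.Perm.sign τ) with h | h <;> rw [h]
      · rw [one_smul]
      · rw [Units.neg_smul, one_smul, l1_neg]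
    rw [h1]
    refine (l1_prod_le nZ nZ_one _ _).trans ?_
    refine (Finset.prod_le_prod (fun b _ => l1_nonneg _ _) (fun b _ => h (τ b) b)).trans ?_
    simp
  refine (Finset.sum_le_sum fun τ _ => this τ).trans ?_
  simp [Fintype.card_perm]

lemma sum_max_ge (k r : ℕ) (hk : 1 ≤ k) (hkr : k ≤ r + 1) (hr : 1 ≤ r) (ε : ℝ) (h0 : 0 < ε) (h1 : ε ≤ 1) :
    k * ε ^ 2 / 8 ≤ ∑ b : Fin k, max 0 (ε - (b : ℕ) / (r:ℝ)) := by
  rw [Fin.sum_univ_eq_sum_range (fun b : ℕ => max 0 (ε - (b : ℝ) / (r:ℝ))) k]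
  set x : ℝ := (k - 1) * ε / 2 with hx
  have hk' : (1:ℝ) ≤ k := by exact_mod_cast hk
  have hr' : (1:ℝ) ≤ r := by exact_mod_cast hr
  have hkr' : (k:ℝ) ≤ r + 1 := by exact_mod_cast hkr
  have hx0 : 0 ≤ x := by rw [hx]; have : 0 ≤ (k - 1 : ℝ) := by linarith
                         positivity
  set J := ⌊x⌋₊ + 1 with hJ
  have hfl : (⌊x⌋₊ : ℝ) ≤ x := Nat.floor_le hx0
  have hJk : J ≤ k := by
    have : (J : ℝ) < k + 1 := by
      rw [hJ]; push_cast
      have : x ≤ (k-1)/2 := by rw [hx]; nlinarith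
      nlinarith
    exact_mod_cast Nat.lt_succ_iff.1 (by exact_mod_cast this)
  have hterm : ∀ b ∈ Finset.range J, ε / 2 ≤ max 0 (ε - (b : ℝ) / (r:ℝ)) := by
    intro b hb
    have hb' : b ≤ ⌊x⌋₊ := by have := Finset.mem_range.1 hb; omega
    have : (b : ℝ) ≤ x := le_trans (by exact_mod_cast hb') hfl
    refine le_max_of_le_right ?_
    have : (b:ℝ) / r ≤ ε / 2 := by
      rw [div_le_iff₀ (by linarith)]
      nlinarith
    linarith
  calc (k:ℝ) * ε ^ 2 / 8 ≤ J * (ε / 2) := by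
        have h2 : x < J := by rw [hJ]; push_cast; exact Nat.lt_floor_add_one x
        have h3 : (1:ℝ) ≤ J := by rw [hJ]; push_cast; linarith [Nat.cast_nonneg (α := ℝ) ⌊x⌋₊]
        have : k * ε / 4 ≤ J := by
          rcases Nat.lt_or_ge k 2 with h | h
          · have : k = 1 := by omega
            rw [this]; push_cast; linarith
          · have : (2:ℝ) ≤ k := by exact_mod_cast h
            nlinarith
        nlinarith
    _ = ∑ b ∈ Finset.range J, ε / 2 := by simp
    _ ≤ ∑ b ∈ Finset.range J, max 0 (ε - (b : ℝ) / (r:ℝ)) := Finset.sum_le_sum hterm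
    _ ≤ _ := Finset.sum_le_sum_of_subset_of_nonneg (Finset.range_mono hJk) fun _ _ _ => le_max_left _ _

lemma log_l1_det (k r S : ℕ) (L : ℝ) (hL : 1 ≤ L) (hk1 : 1 ≤ k) (hk : k ≤ r + 1) (hS : r ≤ S) (x : ℝ) (hx : 0 < x)
    (h : x ≤ k.factorial * (2 ^ S * L) ^ k) : Real.log x ≤ k * (2 * S + Real.log L) := by
  have h1 : (k.factorial : ℝ) ≤ (2 ^ S) ^ k := by
    have a1 : k.factorial ≤ k ^ k := Nat.factorial_le_pow k
    have a2 : k ≤ 2 ^ S := by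
      have : r + 1 ≤ 2 ^ r := Nat.lt_two_pow_self
      exact hk.trans (this.trans (Nat.pow_le_pow_right (by norm_num) hS))
    exact_mod_cast a1.trans (Nat.pow_le_pow_left a2 k)
  have h2 : x ≤ (2 ^ S * (2 ^ S * L)) ^ k := by
    rw [mul_pow (2 ^ S : ℝ)]
    refine h.trans ?_
    gcongr
  have h3 := Real.log_le_log hx h2
  rw [Real.log_pow, Real.log_mul (by positivity) (by positivity), Real.log_mul (by positivity) (by positivity), Real.log_pow] at h3
  have hl : Real.log 2 ≤ 1 := by linarith [Real.log_two_lt_d9]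
  refine h3.trans ?_
  have : (S:ℝ) * Real.log 2 ≤ S := by nlinarith [Nat.cast_nonneg (α := ℝ) S]
  exact mul_le_mul_of_nonneg_left (by linarith) (by positivity)

theorem roth_lemma (m : ℕ) : ∀ ε : ℝ, 0 < ε → ∃ ω : ℝ, 0 < ω ∧ ω ≤ 1 ∧
    ∀ (r : Fin m → ℕ) (p q : Fin m → ℤ), (∀ i, 1 ≤ r i) → (∀ i, IsCoprime (p i) (q i)) → (∀ i, q i ≠ 0) →
      (∀ i j, i < j → (r i : ℝ) ≤ ω * r j) →
      ∀ P : MvPolynomial (Fin m) ℤ, P ≠ 0 → (∀ i, degreeOf i P ≤ r i) →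
      (∀ i, Real.log (l1 nZ P) + ∑ j, (r j : ℝ) ≤ ω * r i * Real.log (max |(p i : ℝ)| |(q i : ℝ)|)) →
      ∃ α, coeff α (shift (fun i => (p i : ℚ) / q i) (map (Int.castRingHom ℚ) P)) ≠ 0 ∧
        ∑ i, (α i : ℝ) / r i ≤ ε := by
  induction m with
  | zero =>
    intro ε hε
    refine ⟨1, one_pos, le_rfl, fun r p q _ _ _ _ P hP _ _ => ?_⟩
    have : shift (fun i => (p i : ℚ) / q i) (map (Int.castRingHom ℚ) P) ≠ 0 := by
      rw [Ne, map_eq_zero_iff _ (shift_injective _), map_eq_zero_iff _ (map_injective _ Int.cast_injective)]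
      exact hP
    obtain ⟨α, hα⟩ := ne_zero_iff.1 this
    exact ⟨α, hα, by simp [hε.le]⟩
  | succ m ih =>
    intro ε hε
    set ε0 := min ε 1 with hε0
    have hε0p : 0 < ε0 := lt_min hε one_pos
    have hε01 : ε0 ≤ 1 := min_le_right _ _
    obtain ⟨ω1, hω1, hω11, hω⟩ := ih (ε0 ^ 2 / 32) (by positivity)
    refine ⟨min (ω1 / 3) (ε0 ^ 2 / 64), lt_min (by positivity) (by positivity),
      (min_le_left _ _).trans (by linarith), fun r p q hr hpq hq hrr P hP hdeg hlog => ?_⟩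
    set ω := min (ω1 / 3) (ε0 ^ 2 / 64) with hωd
    have hω0 : 0 < ω := lt_min (by positivity) (by positivity)
    have hωa : ω ≤ ω1 / 3 := min_le_left _ _
    have hωb : ω ≤ ε0 ^ 2 / 64 := min_le_right _ _
    have hPQ : map (Int.castRingHom ℚ) P ≠ 0 := by
      rw [Ne, map_eq_zero_iff _ (map_injective _ Int.cast_injective)]; exact hP
    have hdegQ : degreeOf 0 (map (Int.castRingHom ℚ) P) ≤ r 0 := by
      rw [degreeOf_le_iff]
      intro β hβ
      refine (monomial_le_degreeOf 0 (support_map_subset _ _ hβ)).trans (hdeg 0)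
    obtain ⟨k, α, e, U, V, hk1, hkr, hα, he, hU, hV, hdet⟩ := wronskian_factor _ hPQ (r 0) hdegQ
    let M : Matrix (Fin k) (Fin k) (MvPolynomial (Fin (m+1)) ℤ) := Matrix.of fun a b => hd ((α a).cons (e b)) P
    have hMap : map (Int.castRingHom ℚ) M.det = (Matrix.of fun a b => hd ((α a).cons (e b)) (map (Int.castRingHom ℚ) P)).det := by
      rw [RingHom.map_det]
      congr 1
      ext1 a b
      simp [M, map_hd]
    set W := M.det with hW
    rw [hdet] at hMap
    obtain ⟨U1, V1, c, hU1, hV1, hl1, hV1c, hdU, hc⟩ := int_factor W U V hU hV hMap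
    have hL1 : 1 ≤ l1 nZ P := one_le_l1_of_ne_zero P hP
    have hlL : 0 ≤ Real.log (l1 nZ P) := Real.log_nonneg hL1
    have hk1' : (1:ℝ) ≤ k := by exact_mod_cast hk1
    have hl1W : l1 nZ W ≤ k.factorial * (2 ^ (∑ i, r i) * l1 nZ P) ^ k :=
      l1_det_le M _ fun a b => l1_hd_le _ P r hdeg
    have hl1U : 1 ≤ l1 nZ U1 := one_le_l1_of_ne_zero U1 hU1
    have hW1 : 1 ≤ l1 nZ W := hl1U.trans hl1
    set S : ℝ := ∑ j, (r j : ℝ) with hS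
    have hScast : ((∑ i, r i : ℕ) : ℝ) = S := by push_cast; rfl
    have hrS : r 0 ≤ ∑ i, r i := Finset.single_le_sum (fun _ _ => Nat.zero_le _) (Finset.mem_univ 0)
    have hlogW : Real.log (l1 nZ W) ≤ k * (2 * S + Real.log (l1 nZ P)) := by
      have := log_l1_det k (r 0) (∑ i, r i) (l1 nZ P) hL1 hk1 hkr hrS (l1 nZ W) (by linarith) hl1W
      rwa [hScast] at this
    have hr1 : ∀ i, (1:ℝ) ≤ r i := fun i => by exact_mod_cast hr i
    have hS1 : 1 ≤ S := by
      have : (r 0 : ℝ) ≤ S := by rw [← hScast]; exact_mod_cast hrS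
      linarith [hr1 0]
    have hH : ∀ i, 0 < Real.log (max |(p i : ℝ)| |(q i : ℝ)|) := by
      intro i
      by_contra hn
      push Not at hn
      have := hlog i
      have : ω * r i * Real.log (max |(p i : ℝ)| |(q i : ℝ)|) ≤ 0 :=
        mul_nonpos_of_nonneg_of_nonpos (by have := hr1 i; positivity) hn
      linarith
    have hdegW : ∀ i : Fin m, degreeOf i.succ W ≤ k * r i.succ := fun i =>
      degreeOf_det_le M _ _ fun a b => (degreeOf_hd_le _ _ _).trans (hdeg _)
    have hT : 0 ≤ S + Real.log (l1 nZ P) := by linarith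
    obtain ⟨γ, hγ, hγw⟩ := hω (fun i => k * r i.succ) (fun i => p i.succ) (fun i => q i.succ)
      (fun i => Nat.mul_pos hk1 (hr _)) (fun i => hpq _) (fun i => hq _)
      (fun i j hij => by
        have := hrr i.succ j.succ (Fin.succ_lt_succ_iff.2 hij)
        push_cast
        have h2 : (r i.succ : ℝ) ≤ ω1 * r j.succ := this.trans (by
          have := hr1 j.succ; gcongr; linarith)
        nlinarith) U1 hU1
      (fun i => (hdU i).trans (hdegW i))
      (fun i => by
        have h1 : Real.log (l1 nZ U1) ≤ k * (2 * S + Real.log (l1 nZ P)) :=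
          (Real.log_le_log (by linarith) hl1).trans hlogW
        have h2 : ∑ j : Fin m, ((k * r j.succ : ℕ) : ℝ) ≤ k * S := by
          rw [hS, Fin.sum_univ_succ]
          push_cast
          rw [← Finset.mul_sum]
          gcongr
          linarith [hr1 0]
        have h3 := hlog i.succ
        have h4 : k * (2 * S + Real.log (l1 nZ P)) + k * S ≤ 3 * k * (ω * r i.succ * Real.log (max |(p i.succ : ℝ)| |(q i.succ : ℝ)|)) := by
          nlinarith
        have h5 : 3 * k * (ω * r i.succ * Real.log (max |(p i.succ : ℝ)| |(q i.succ : ℝ)|)) ≤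
            ω1 * ((k * r i.succ : ℕ):ℝ) * Real.log (max |(p i.succ : ℝ)| |(q i.succ : ℝ)|) := by
          push_cast
          have h6 : 3 * ω ≤ ω1 := by linarith
          have h7 : 0 ≤ (k:ℝ) * r i.succ * Real.log (max |(p i.succ : ℝ)| |(q i.succ : ℝ)|) := by
            have := (hH i.succ).le; positivity
          nlinarith
        linarith)
    obtain ⟨f, hf, hfB⟩ := one_var_order V1 hV1 (p 0) (q 0) (hpq 0) (hq 0) _ hV1c
    have hfle : (f:ℝ) ≤ 2 * k * ω * r 0 := by
      have h0 : 0 < max |(p 0 : ℝ)| |(q 0 : ℝ)| := lt_max_of_lt_right (by simpa using hq 0)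
      have h1 := Real.log_le_log (pow_pos h0 f) hfB
      rw [Real.log_pow] at h1
      have h2 := hlog 0
      have h3 : f * Real.log (max |(p 0 : ℝ)| |(q 0 : ℝ)|) ≤ (2 * k * ω * r 0) * Real.log (max |(p 0 : ℝ)| |(q 0 : ℝ)|) := by
        nlinarith
      exact le_of_mul_le_mul_right h3 (hH 0)
    set ξ : Fin (m+1) → ℚ := fun i => (p i : ℚ) / q i with hξ
    have hne : coeff (γ.cons f) (shift ξ (map (Int.castRingHom ℚ) W)) ≠ 0 := by
      intro h0
      have h1 := congrArg (fun F => coeff (γ.cons f) (shift ξ F)) hc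
      simp only [map_smul, map_mul, coeff_smul, h0, smul_zero] at h1
      rw [shift_rename_succ, shift_aeval_X, coeff_cons_mul] at h1
      exact mul_ne_zero hγ hf h1.symm
    by_contra hcon
    push Not at hcon
    let w : Fin (m+1) → ℝ := fun i => 1 / r i
    have hw : ∀ i, 0 ≤ w i := fun i => by positivity
    have hwt : ∀ β : Fin (m+1) →₀ ℕ, wt w β = ∑ i, (β i : ℝ) / r i := fun β => by
      simp only [wt, w]; refine Finset.sum_congr rfl fun i _ => by ring
    have hind : IndGe w ε0 (shift ξ (map (Int.castRingHom ℚ) P)) := by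
      intro β hβ
      rw [hwt]
      exact (min_le_left _ _).trans (hcon β hβ).le
    have hshiftW : shift ξ (map (Int.castRingHom ℚ) W) =
        (Matrix.of fun a b => hd ((α a).cons (e b)) (shift ξ (map (Int.castRingHom ℚ) P))).det := by
      rw [hMap, ← hdet, AlgHom.map_det]
      congr 1
      ext1 a b
      simp [shift_hd]
    have hr0 := hr1 0
    have hind2 : IndGe w (∑ b : Fin k, max 0 (ε0 - (b : ℕ) / (r 0 : ℝ) - ω)) (shift ξ (map (Int.castRingHom ℚ) W)) := by
      rw [hshiftW]
      refine IndGe.det (t := fun b : Fin k => max 0 (ε0 - (b : ℕ) / (r 0 : ℝ) - ω)) _ fun a b => ?_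
      simp only [Matrix.of_apply]
      have h1 := hind.hd ((α a).cons (e b))
      rcases le_total (ε0 - (b : ℕ) / (r 0 : ℝ) - ω) 0 with h | h
      · rw [max_eq_left h]; exact IndGe.of_nonneg hw _
      · rw [max_eq_right h]
        refine h1.mono ?_
        rw [hwt, Fin.sum_univ_succ]
        simp only [Finsupp.cons_zero, Finsupp.cons_succ]
        have h2 : (e b : ℝ) / r 0 ≤ (b:ℕ) / r 0 := by
          have : (e b : ℝ) ≤ (b:ℕ) := by exact_mod_cast he b
          gcongr
        have h3 : ∑ i : Fin m, (α a i : ℝ) / r i.succ ≤ ω := by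
          have h4 : ∀ i : Fin m, (α a i : ℝ) / r i.succ ≤ α a i * (ω / r 0) := by
            intro i
            have := hrr 0 i.succ (Fin.succ_pos i)
            have h5 := hr1 i.succ
            rw [div_eq_mul_inv]
            gcongr
            rw [inv_le_iff_one_le_mul₀ (by linarith), div_mul_eq_mul_div, le_div_iff₀ (by linarith)]
            linarith
          refine (Finset.sum_le_sum fun i _ => h4 i).trans ?_
          rw [← Finset.sum_mul]
          have h6 : (∑ i, (α a i : ℝ)) ≤ r 0 := by
            have := hα a
            have h7 := a.2
            have : ∑ i, α a i ≤ r 0 := by omega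
            exact_mod_cast this
          calc (∑ i, (α a i : ℝ)) * (ω / r 0) ≤ r 0 * (ω / r 0) := by gcongr
            _ = ω := by field_simp
        linarith
    have hfin := hind2 _ hne
    rw [hwt, Fin.sum_univ_succ] at hfin
    simp only [Finsupp.cons_zero, Finsupp.cons_succ] at hfin
    have hA : (f:ℝ) / r 0 ≤ 2 * k * ω := by
      rw [div_le_iff₀ (by linarith)]; linarith
    have hB : ∑ i : Fin m, (γ i : ℝ) / r i.succ ≤ k * (ε0 ^ 2 / 32) := by
      have : ∑ i : Fin m, (γ i : ℝ) / r i.succ = k * ∑ i : Fin m, (γ i : ℝ) / ((k * r i.succ : ℕ) : ℝ) := by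
        rw [Finset.mul_sum]
        refine Finset.sum_congr rfl fun i _ => ?_
        have := hr1 i.succ
        push_cast
        field_simp
      rw [this]
      gcongr
    have hC : (k:ℝ) * ε0 ^ 2 / 8 - k * ω ≤ ∑ b : Fin k, max 0 (ε0 - (b : ℕ) / (r 0 : ℝ) - ω) := by
      have h1 := sum_max_ge k (r 0) hk1 hkr (hr 0) ε0 hε0p hε01
      have h2 : ∑ b : Fin k, max 0 (ε0 - (b : ℕ) / (r 0 : ℝ)) - k * ω ≤ ∑ b : Fin k, max 0 (ε0 - (b : ℕ) / (r 0 : ℝ) - ω) := by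
        have : (k:ℝ) * ω = ∑ b : Fin k, ω := by simp
        rw [this, ← Finset.sum_sub_distrib]
        refine Finset.sum_le_sum fun b _ => ?_
        rcases le_total 0 (ε0 - (b : ℕ) / (r 0 : ℝ)) with h | h
        · rw [max_eq_right h]; exact le_max_right _ _
        · rw [max_eq_left h]; exact le_max_of_le_left (by linarith)
      linarith
    have hpos : 0 < k * ε0 ^ 2 := by positivity
    have hkω : k * ω ≤ k * (ε0 ^ 2 / 64) := by gcongr
    clear_value ε0 ω S
    linarith

end Schmidt

end PartF5

section PartE1
open MvPolynomial

namespace Schmidt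

lemma exists_low_mult {A : Type*} [CommRing A] [IsDomain A] (f : Polynomial A) (hf : f ≠ 0) (G : Finset A)
    (hG : G.Nonempty) : ∃ v ∈ G, ∃ j : ℕ, j * G.card ≤ f.natDegree ∧ (Polynomial.taylor v f).coeff j ≠ 0 := by
  classical
  obtain ⟨v, hv, hmin⟩ := G.exists_min_image (fun v => f.rootMultiplicity v) hG
  refine ⟨v, hv, f.rootMultiplicity v, ?_, ?_⟩
  · calc f.rootMultiplicity v * G.card = ∑ u ∈ G, f.rootMultiplicity v := by simp [mul_comm]
      _ ≤ ∑ u ∈ G, f.rootMultiplicity u := Finset.sum_le_sum hmin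
      _ = ∑ u ∈ G, f.roots.count u := by simp
      _ ≤ ∑ u ∈ G ∪ f.roots.toFinset, f.roots.count u :=
          Finset.sum_le_sum_of_subset Finset.subset_union_left
      _ = f.roots.card := Multiset.sum_count_eq_card (fun a ha => Finset.mem_union_right _ (by simpa using ha))
      _ ≤ _ := f.card_roots'
  · rw [Polynomial.rootMultiplicity_eq_natTrailingDegree]
    have : f.comp (Polynomial.X + Polynomial.C v) = Polynomial.taylor v f := (Polynomial.taylor_apply v f).symm
    rw [this]
    refine Polynomial.trailingCoeff_nonzero_iff_nonzero.2 ?_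
    rw [Ne, Polynomial.taylor_eq_zero]; exact hf

lemma finSuccEquiv_shift {n : ℕ} {R : Type*} [CommRing R] (v : Fin (n+1) → R) (P : MvPolynomial (Fin (n+1)) R) :
    finSuccEquiv R n (shift v P) =
      (Polynomial.taylor (C (v 0)) (finSuccEquiv R n P)).map ((shift (fun i => v i.succ) : MvPolynomial (Fin n) R →ₐ[R] _) : MvPolynomial (Fin n) R →+* _) := by
  have : (((finSuccEquiv R n).toAlgHom).comp (shift v) : MvPolynomial (Fin (n+1)) R →ₐ[R] _) =
     ((Polynomial.mapAlgHom (shift (fun i => v i.succ) : MvPolynomial (Fin n) R →ₐ[R] _)).comp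
      ((Polynomial.taylorAlgHom (C (v 0) : MvPolynomial (Fin n) R)).restrictScalars R)).comp ((finSuccEquiv R n).toAlgHom) := by
    apply MvPolynomial.algHom_ext
    intro i
    refine Fin.cases ?_ (fun i => ?_) i
    · simp [shift, finSuccEquiv_X_zero, finSuccEquiv_apply]
    · simp [shift, finSuccEquiv_X_succ, finSuccEquiv_apply]
  exact DFunLike.congr_fun this P

lemma degreeOf_taylor_coeff {n : ℕ} {R : Type*} [CommRing R] (v : R) (f : Polynomial (MvPolynomial (Fin n) R)) (i : Fin n) (d : ℕ)
    (h : ∀ k, degreeOf i (f.coeff k) ≤ d) (j : ℕ) : degreeOf i ((Polynomial.taylor (C v) f).coeff j) ≤ d := by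
  classical
  rw [Polynomial.taylor_coeff, Polynomial.eval_eq_sum_range]
  refine (degreeOf_sum_le _ _ _).trans (Finset.sup_le fun k _ => ?_)
  rw [Polynomial.hasseDeriv_coeff, ← C_pow, mul_comm, ← mul_assoc]
  have : (C (v ^ k) : MvPolynomial (Fin n) R) * (((k+j).choose j : ℕ) : MvPolynomial (Fin n) R) = C (v ^ k * ((k+j).choose j : ℕ)) := by
    simp
  rw [this]
  exact (degreeOf_C_mul_le _ _ _).trans (h _)

lemma grid_fin {R : Type*} [CommRing R] [IsDomain R] (B : ℕ) (hB : 1 ≤ B) (n : ℕ) :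
    ∀ (P : MvPolynomial (Fin n) R), P ≠ 0 → ∀ (r : Fin n → ℕ), (∀ i, degreeOf i P ≤ r i) →
    ∀ (G : Fin n → Finset R), (∀ i, (G i).card = B) → ∃ v : Fin n → R, ∃ j : Fin n →₀ ℕ,
      (∀ i, v i ∈ G i) ∧ (∀ i, j i * B ≤ r i) ∧ coeff j (shift v P) ≠ 0 := by
  classical
  induction n with
  | zero =>
    intro P hP r hr G hG
    have h : shift (fun i : Fin 0 => i.elim0) P ≠ 0 := by
      rw [Ne, map_eq_zero_iff _ (shift_injective _)]; exact hP
    obtain ⟨j, hj⟩ := ne_zero_iff.1 h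
    exact ⟨_, j, fun i => i.elim0, fun i => i.elim0, hj⟩
  | succ n ih =>
    intro P hP r hr G hG
    set f := finSuccEquiv R n P with hf
    have hf0 : f ≠ 0 := by rw [hf, Ne, EmbeddingLike.map_eq_zero_iff]; exact hP
    have hcard : ((G 0).image (C : R → MvPolynomial (Fin n) R)).card = B := by
      rw [Finset.card_image_of_injective _ (C_injective _ _), hG]
    obtain ⟨v0, hv0, j0, hj0, hne⟩ := exists_low_mult f hf0 ((G 0).image (C : R → MvPolynomial (Fin n) R))
      (Finset.card_pos.1 (by omega))
    obtain ⟨u0, hu0, rfl⟩ := Finset.mem_image.1 hv0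
    rw [hcard, hf, natDegree_finSuccEquiv] at hj0
    obtain ⟨v, j, hv, hj, hc⟩ := ih _ hne (fun i => r i.succ)
      (fun i => degreeOf_taylor_coeff u0 f i _ (fun k => (degreeOf_coeff_finSuccEquiv P i k).trans (hr _)) j0)
      (fun i => G i.succ) (fun i => hG _)
    refine ⟨Fin.cons u0 v, j.cons j0, fun i => ?_, fun i => ?_, ?_⟩
    · refine Fin.cases ?_ (fun i => ?_) i
      · simpa using hu0
      · simpa using hv i
    · refine Fin.cases ?_ (fun i => ?_) i
      · simpa using hj0.trans (hr 0)
      · simpa using hj i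
    · rw [← finSuccEquiv_coeff_coeff, finSuccEquiv_shift, Polynomial.coeff_map]
      simpa using hc

lemma grid {σ R : Type*} [Fintype σ] [CommRing R] [IsDomain R] (B : ℕ) (hB : 1 ≤ B)
    (P : MvPolynomial σ R) (hP : P ≠ 0) (r : σ → ℕ) (hr : ∀ i, degreeOf i P ≤ r i)
    (G : σ → Finset R) (hG : ∀ i, (G i).card = B) : ∃ v : σ → R, ∃ j : σ →₀ ℕ,
      (∀ i, v i ∈ G i) ∧ (∀ i, j i * B ≤ r i) ∧ coeff j (shift v P) ≠ 0 := by
  let e := Fintype.equivFin σ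
  obtain ⟨v, j, hv, hj, hc⟩ := grid_fin B hB _ (rename e P)
    (by rw [Ne, map_eq_zero_iff _ (rename_injective e e.injective)]; exact hP) (fun i => r (e.symm i))
    (fun i => by
      have := degreeOf_rename_of_injective (p := P) e.injective (e.symm i)
      rw [e.apply_symm_apply] at this
      rw [this]; exact hr _) (fun i => G (e.symm i)) (fun i => hG _)
  have hs : shift v (rename e P) = rename e (shift (fun i => v (e i)) P) := by
    have : ((shift v).comp (rename e) : MvPolynomial σ R →ₐ[R] _) =
      (rename e).comp (shift (fun i => v (e i))) := by
      ext i; simp [shift]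
    exact DFunLike.congr_fun this P
  refine ⟨fun i => v (e i), j.mapDomain e.symm, fun i => ?_, fun i => ?_, ?_⟩
  · simpa using hv (e i)
  · rw [← Finsupp.equivMapDomain_eq_mapDomain]
    simpa using hj (e i)
  · rw [hs] at hc
    have hj' : j = (j.mapDomain e.symm).mapDomain e := by
      rw [← Finsupp.mapDomain_comp]; simp
    rw [hj', coeff_rename_mapDomain _ e.injective] at hc
    exact hc

lemma coeff_shift_eq {σ R : Type*} [Fintype σ] [Field R] [CharZero R] (v : σ → R) (j : σ →₀ ℕ) (P : MvPolynomial σ R) :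
    coeff j (shift v P) = eval v (hd j P) := by
  rw [← shift_eval_zero, shift_hd, constantCoeff_eq, coeff_hd]
  simp

lemma IndGe.C' {τ R : Type*} [Fintype τ] [CommRing R] {w : τ → ℝ} (c : R) : IndGe w 0 (C c : MvPolynomial τ R) := by
  classical
  intro α hα
  rw [coeff_C] at hα
  have : (0 : τ →₀ ℕ) = α := by by_contra h; simp [h] at hα
  rw [← this]; simp [wt]

lemma IndGe.add {τ R : Type*} [Fintype τ] [CommRing R] {w : τ → ℝ} {t : ℝ} {P Q : MvPolynomial τ R}
    (h : IndGe w t P) (h' : IndGe w t Q) : IndGe w t (P + Q) := by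
  intro α hα
  rw [coeff_add] at hα
  by_cases h0 : coeff α P = 0
  · exact h' α (by simpa [h0] using hα)
  · exact h α h0

lemma IndGe.X' {τ R : Type*} [Fintype τ] [CommRing R] {w : τ → ℝ} (i : τ) : IndGe w (w i) (X i : MvPolynomial τ R) := by
  classical
  intro α hα
  rw [coeff_X] at hα
  have : Finsupp.single i 1 = α := by by_contra h; simp [h] at hα
  rw [← this]; simp [wt, Finsupp.single_apply]

lemma map_aeval' {σ τ R S : Type*} [CommRing R] [CommRing S] (g : R →+* S) (f : σ → MvPolynomial τ R) (P : MvPolynomial σ R) :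
    map g (aeval f P) = aeval (fun s => map g (f s)) (map g P) := by
  induction P using MvPolynomial.induction_on with
  | C a => simp
  | add p q hp hq => rw [map_add, map_add, map_add, map_add, hp, hq]
  | mul_X p i hp => rw [map_mul, map_mul, map_mul, map_mul, hp, aeval_X, map_X, aeval_X]

lemma map_shift {σ R S : Type*} [CommRing R] [CommRing S] (g : R →+* S) (f : σ → R) (P : MvPolynomial σ R) :
    map g (shift f P) = shift (fun s => g (f s)) (map g P) := by
  rw [shift, map_aeval']; simp [shift]

lemma IndGe.aeval' {σ τ R : Type*} [Fintype σ] [Fintype τ] [CommRing R] {w : σ → ℝ} {w' : τ → ℝ} {t : ℝ}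
    {F : MvPolynomial σ R} (h : IndGe w t F) (f : σ → MvPolynomial τ R) (hf : ∀ s, IndGe w' (w s) (f s)) :
    IndGe w' t (aeval f F) := by
  rw [aeval_def, eval₂_eq]
  refine IndGe.sum _ _ fun α hα => ?_
  have h1 : IndGe w' (∑ i ∈ α.support, w i * α i) (∏ i ∈ α.support, f i ^ α i) := by
    refine IndGe.prod _ _ fun i _ => ?_
    have := IndGe.prod (w := w') (t := fun _ => w i) (Finset.range (α i)) (fun _ => f i) (fun _ _ => hf i)
    simpa [mul_comm] using this
  have h2 := IndGe.mul (IndGe.C' (w := w') (coeff α F)) h1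
  refine h2.mono ?_
  rw [zero_add]
  refine (h α (mem_support_iff.1 hα)).trans (le_of_eq ?_)
  rw [wt]
  symm
  refine Finset.sum_subset (Finset.subset_univ _) fun i _ hi => ?_
  rw [Finsupp.notMem_support_iff.1 hi]; simp

lemma exists_large_height {ι : Type*} [Fintype ι] (n : ι → ℤ) (a : ℤ) (ha : a ≠ 0)
    (hprim : ∀ d : ℤ, (∀ i, d ∣ n i) → IsUnit d) (X : ℝ) (hX : 1 ≤ X)
    (hbig : ∃ i, X ^ (Fintype.card ι + 1) ≤ |(n i : ℝ)|) :
    ∃ i, ∃ p q : ℤ, IsCoprime p q ∧ q ≠ 0 ∧ n i * p = - a * q ∧ X ≤ max |(p:ℝ)| |(q:ℝ)| := by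
  classical
  by_contra hcon
  push Not at hcon
  have key : ∀ i, ∃ d : ℤ, 1 ≤ |(d:ℝ)| ∧ |(d:ℝ)| ≤ X ∧ a ∣ d * n i ∧ |(n i : ℝ)| < X * |(a:ℝ)| := by
    intro i
    by_cases hni : n i = 0
    · refine ⟨1, by simp, by simpa using hX, by simp [hni], ?_⟩
      rw [hni]; simp; positivity
    · obtain ⟨g, p, q, hg, hcop, hp, hq⟩ : ∃ g p q : ℤ, g ≠ 0 ∧ IsCoprime p q ∧ -a = p * g ∧ n i = q * g := by
        obtain ⟨g, hg⟩ : ∃ g, g = Int.gcd (-a) (n i) := ⟨_, rfl⟩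
        have hpos : 0 < Int.gcd (-a) (n i) := Int.gcd_pos_of_ne_zero_right _ hni
        obtain ⟨g', p, q, hg', h1, h2, h3⟩ := Int.exists_gcd_one' hpos
        exact ⟨g', p, q, by omega, Int.isCoprime_iff_gcd_eq_one.2 h1, h2, h3⟩
      have hq0 : q ≠ 0 := by rintro rfl; simp at hq; exact hni hq
      have hp0 : p ≠ 0 := by rintro rfl; simp at hp; exact ha hp
      have h := hcon i p q hcop hq0 (by rw [hq, hp]; ring)
      have h1 := (le_max_left _ _).trans h.le
      have h2 := (le_max_right _ _).trans h.le
      refine ⟨p, by exact_mod_cast Int.one_le_abs hp0, h1, ?_, ?_⟩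
      · rw [← neg_dvd, hp, hq, ← mul_assoc, mul_comm (p * q) g, mul_comm p g]
        exact ⟨q, by ring⟩
      · have e1 : |(n i : ℝ)| = |(q:ℝ)| * |(g:ℝ)| := by rw [hq]; push_cast; exact abs_mul _ _
        have e2 : |(a : ℝ)| = |(p:ℝ)| * |(g:ℝ)| := by
          rw [← abs_neg, ← abs_mul]; congr 1; exact_mod_cast hp
        rw [e1, e2]
        have : (1:ℝ) ≤ |(p:ℝ)| := by exact_mod_cast Int.one_le_abs hp0
        have hg0 := abs_nonneg (g:ℝ)
        have : |(g:ℝ)| ≤ |(p:ℝ)| * |(g:ℝ)| := by nlinarith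
        have hq2 : |(q:ℝ)| < X := (le_max_right _ _).trans_lt h
        have hgp : 0 < |(g:ℝ)| := abs_pos.2 (by exact_mod_cast hg)
        calc |(q:ℝ)| * |(g:ℝ)| < X * |(g:ℝ)| := by gcongr
          _ ≤ _ := by gcongr
  choose d hd1 hd2 hd3 hd4 using key
  have hadvd : a ∣ ∏ i, d i := by
    have h1 : ∀ i, a ∣ (∏ i, d i) * n i := fun i => by
      rw [← Finset.prod_erase_mul _ _ (Finset.mem_univ i), mul_assoc]
      exact (hd3 i).mul_left _
    set D := ∏ i, d i
    have hg : (Int.gcd a D : ℤ) ≠ 0 := by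
      have := Int.gcd_pos_of_ne_zero_left D ha; omega
    obtain ⟨g', p, q, hg', h1', h2, h3⟩ := Int.exists_gcd_one' (Int.gcd_pos_of_ne_zero_left D ha)
    have hu : IsUnit p := by
      apply hprim
      intro i
      have := h1 i
      rw [h2, h3, mul_assoc, mul_comm q, mul_comm p, mul_assoc] at this
      have h4 := Int.dvd_of_mul_dvd_mul_left (by omega) this
      rw [mul_comm] at h4
      exact (Int.isCoprime_iff_gcd_eq_one.2 h1').dvd_of_dvd_mul_left h4
    rw [h2, h3]
    exact mul_dvd_mul_right (hu.dvd) _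
  have hDne : (∏ i, d i) ≠ 0 := by
    rw [Finset.prod_ne_zero_iff]; intro i _ h0
    have := hd1 i; rw [h0] at this; simp at this; linarith
  have ha' : |(a:ℝ)| ≤ X ^ Fintype.card ι := by
    have h1 : |a| ≤ |∏ i, d i| := Int.le_of_dvd (abs_pos.2 hDne) ((abs_dvd_abs _ _).2 hadvd)
    have h2 : |(a:ℝ)| ≤ |((∏ i, d i : ℤ) : ℝ)| := by exact_mod_cast h1
    refine h2.trans ?_
    push_cast
    rw [Finset.abs_prod]
    refine (Finset.prod_le_prod (fun _ _ => abs_nonneg _) (fun i _ => hd2 i)).trans ?_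
    simp
  obtain ⟨i, hi⟩ := hbig
  have h1 := hd4 i
  have h2 : X * |(a:ℝ)| ≤ X ^ (Fintype.card ι + 1) := by rw [pow_succ, mul_comm]; gcongr
  linarith

end Schmidt

end PartE1

section PartE2
open MvPolynomial

namespace Schmidt

lemma grid_dot_ne {ι : Type*} [Fintype ι] (n v : ι → ℤ) (s : ι) (B N : ℕ) (hN : Fintype.card ι = N)
    (hs : ∀ i, |n i| ≤ |n s|) (hn : n s ≠ 0) (hv : ∀ i, i ≠ s → |v i| ≤ B) (hvs : N * B + 1 ≤ v s) :
    ∑ i, n i * v i ≠ 0 := by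
  classical
  intro h0
  rw [← Finset.add_sum_erase _ _ (Finset.mem_univ s)] at h0
  have h1 : |∑ i ∈ Finset.univ.erase s, n i * v i| ≤ N * (|n s| * B) := by
    refine (Finset.abs_sum_le_sum_abs _ _).trans ?_
    refine (Finset.sum_le_sum (g := fun _ => |n s| * B) fun i hi => ?_).trans ?_
    · rw [abs_mul]
      exact mul_le_mul (hs i) (hv i (Finset.ne_of_mem_erase hi)) (abs_nonneg _) (abs_nonneg _)
    · rw [Finset.sum_const, nsmul_eq_mul]
      have : (Finset.univ.erase s).card ≤ N := by rw [← hN]; exact Finset.card_le_univ _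
      have : ((Finset.univ.erase s).card : ℤ) ≤ N := by exact_mod_cast this
      gcongr
  have h2 : |n s * v s| = |∑ i ∈ Finset.univ.erase s, n i * v i| := by
    rw [← abs_neg (∑ i ∈ Finset.univ.erase s, n i * v i)]; congr 1; linarith
  rw [← h2, abs_mul] at h1
  have h3 : v s ≤ |v s| := le_abs_self _
  have h4 : 0 < |n s| := abs_pos.2 hn
  nlinarith

theorem roth_general (m : ℕ) (ι : Type*) [Fintype ι] (ε : ℝ) (hε : 0 < ε) :
    ∃ ω : ℝ, 0 < ω ∧ ω ≤ 1 ∧ ∀ (r : Fin m → ℕ) (n : Fin m → ι → ℤ) (s0 : Fin m → ι),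
      (∀ h, 1 ≤ r h) → (∀ h, ∀ d : ℤ, (∀ i, d ∣ n h i) → IsUnit d) → (∀ h i, |n h i| ≤ |n h (s0 h)|) →
      (∀ h k, h < k → (r h : ℝ) ≤ ω * r k) →
      ∀ P : MvPolynomial (Fin m × ι) ℤ, P ≠ 0 → (∀ α, coeff α P ≠ 0 → ∀ h, ∑ i, α (h, i) ≤ r h) →
      (∀ h, Real.log (l1 nZ P) + ∑ j, (r j : ℝ) ≤ ω * r h * Real.log |(n h (s0 h) : ℝ)|) →
      ∃ y : Fin m × ι → ℚ, (∀ h, ∑ i, (n h i : ℚ) * y (h, i) = 0) ∧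
        ∃ α, coeff α (shift y (map (Int.castRingHom ℚ) P)) ≠ 0 ∧ ∑ s, (α s : ℝ) / r s.1 ≤ ε := by
  classical
  obtain ⟨ω1, hω1, hω11, hroth⟩ := roth_lemma m (ε / 3) (by positivity)
  set N := Fintype.card ι with hN
  obtain ⟨B, hB1, hB⟩ : ∃ B : ℕ, 1 ≤ B ∧ (m * N : ℝ) / B ≤ ε / 3 := by
    refine ⟨⌈3 * (m * N) / ε⌉₊ + 1, by omega, ?_⟩
    have := Nat.le_ceil (3 * (m * N) / ε : ℝ)
    rw [div_le_iff₀ (by positivity)]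
    rw [div_le_iff₀ hε] at this
    push_cast
    nlinarith
  set D : ℝ := (N + 1) * B + 1 with hD
  have hD1 : 1 ≤ D := by rw [hD]; have : (0:ℝ) ≤ (N + 1) * B := by positivity
                         linarith
  have hlD : 0 ≤ Real.log D := Real.log_nonneg hD1
  set K : ℝ := N + Real.log D + 1 with hK
  have hK1 : 1 ≤ K := by rw [hK]; have : (0:ℝ) ≤ N := by positivity
                         linarith
  have hKN : 1 ≤ K * (N + 1) := by
    have : (0:ℝ) ≤ N := by positivity
    nlinarith
  refine ⟨ω1 / (K * (N + 1)), by positivity, (div_le_self hω1.le hKN).trans hω11, ?_⟩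
  intro r n s0 hr hprim hs0 hrr P hP hdeg hlog
  set ω := ω1 / (K * (N + 1)) with hω
  have hω0 : 0 < ω := by positivity
  have hωle : ω ≤ ω1 := div_le_self hω1.le hKN
  have hns : ∀ h, n h (s0 h) ≠ 0 := by
    intro h h0
    have : IsUnit (0 : ℤ) := hprim h 0 (fun i => by
      have := hs0 h i; rw [h0, abs_zero] at this
      rw [abs_nonpos_iff.1 this])
    simp at this
  have hdegs : ∀ s : Fin m × ι, degreeOf s P ≤ r s.1 := by
    intro s
    rw [degreeOf_le_iff]
    intro α hα
    refine le_trans ?_ (hdeg α (mem_support_iff.1 hα) s.1)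
    exact Finset.single_le_sum (f := fun i => α (s.1, i)) (fun _ _ => Nat.zero_le _) (Finset.mem_univ s.2)
  obtain ⟨v, j, hv, hj, hne⟩ := grid B hB1 P hP (fun s => r s.1) hdegs
    (fun s => if s.2 = s0 s.1 then Finset.Icc (N * B + 1 : ℤ) (N * B + B) else Finset.Icc (1 : ℤ) B)
    (fun s => by split_ifs <;> simp)
  have hvb : ∀ s, |(v s : ℝ)| ≤ (N + 1) * B := by
    intro s
    have := hv s
    have hz : |v s| ≤ (N + 1) * B := by
      rw [abs_le]
      have hNB : (0:ℤ) ≤ N * B := by positivity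
      split_ifs at this <;> rw [Finset.mem_Icc] at this <;> constructor <;> nlinarith
    exact_mod_cast hz
  have hdot : ∀ h, ∑ i, n h i * v (h, i) ≠ 0 := by
    intro h
    refine grid_dot_ne (n h) (fun i => v (h, i)) (s0 h) B N rfl (hs0 h) (hns h) (fun i hi => ?_) ?_
    · have := hv (h, i)
      simp only [hi, if_false, Finset.mem_Icc] at this
      rw [abs_le]; constructor <;> linarith
    · have := hv (h, s0 h)
      simp only [if_true, Finset.mem_Icc] at this
      exact this.1
  have hheight : ∀ h, ∃ i, ∃ p q : ℤ, IsCoprime p q ∧ q ≠ 0 ∧ n h i * p = - (∑ i, n h i * v (h, i)) * q ∧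
      Real.log |(n h (s0 h) : ℝ)| ≤ (N + 1) * Real.log (max |(p:ℝ)| |(q:ℝ)|) := by
    intro h
    have h1 : (1:ℝ) ≤ |(n h (s0 h) : ℝ)| := by exact_mod_cast Int.one_le_abs (hns h)
    set X : ℝ := |(n h (s0 h) : ℝ)| ^ ((1:ℝ) / (N + 1)) with hX
    have hX1 : 1 ≤ X := Real.one_le_rpow h1 (by positivity)
    have hXp : X ^ (N + 1) = |(n h (s0 h) : ℝ)| := by
      rw [hX, ← Real.rpow_natCast, ← Real.rpow_mul (by linarith)]
      push_cast
      rw [one_div_mul_cancel (by positivity), Real.rpow_one]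
    obtain ⟨i, p, q, h2, h3, h4, h5⟩ := exists_large_height (n h) _ (hdot h) (hprim h) X hX1 ⟨s0 h, hXp.le⟩
    refine ⟨i, p, q, h2, h3, h4, ?_⟩
    rw [← hXp, Real.log_pow]
    push_cast
    have := Real.log_le_log (by linarith) h5
    gcongr
  choose s p q hcop hq hpq hlogH using hheight
  set R : MvPolynomial (Fin m) ℤ := aeval (fun x : Fin m × ι => C (v x) + if x.2 = s x.1 then X x.1 else 0) (hd j P) with hR
  have hevalne : eval v (hd j P) ≠ 0 := by
    intro h0
    apply hne
    have h1 := coeff_shift_eq (fun s => (v s : ℚ)) j (map (Int.castRingHom ℚ) P)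
    rw [← map_hd, eval_map] at h1
    have h2 : eval₂ (Int.castRingHom ℚ) (fun s => (v s : ℚ)) (hd j P) = ((eval v (hd j P) : ℤ) : ℚ) := by
      have := eval₂_comp_right (Int.castRingHom ℚ) (RingHom.id ℤ) v (hd j P)
      simp only [eval₂_id, map_id] at this
      symm
      exact this
    rw [h2, h0] at h1
    have h3 := map_shift (Int.castRingHom ℚ) v P
    have h4 := congrArg (coeff j) h3
    rw [coeff_map] at h4
    simp only [eq_intCast] at h4
    rw [h1] at h4
    exact_mod_cast h4
  have hR0 : R ≠ 0 := by
    intro h0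
    apply hevalne
    have h1 := congrArg (eval (0 : Fin m → ℤ)) h0
    have h2 : (((aeval (0 : Fin m → ℤ)).comp (aeval (fun x : Fin m × ι => (C (v x) + if x.2 = s x.1 then X x.1 else 0 : MvPolynomial (Fin m) ℤ)))) : MvPolynomial (Fin m × ι) ℤ →ₐ[ℤ] ℤ) = aeval v := by
      ext x
      simp only [AlgHom.comp_apply, aeval_X, map_add]
      split_ifs <;> simp
    have h3 := DFunLike.congr_fun h2 (hd j P)
    rw [AlgHom.comp_apply, ← hR, h0, map_zero] at h3
    rw [← coe_aeval_eq_eval]; exact h3.symm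
  have hdeg2 : ∀ α, coeff α (hd j P) ≠ 0 → ∀ h, ∑ i, α (h, i) ≤ r h := by
    intro α hα h
    rw [coeff_hd] at hα
    refine le_trans ?_ (hdeg _ (left_ne_zero_of_mul hα) h)
    refine Finset.sum_le_sum fun i _ => ?_
    simp
  have hRdeg : ∀ h, degreeOf h R ≤ r h := by
    intro h
    have hI : IndGe (fun x : Fin m × ι => if x.1 = h then (-1:ℝ) else 0) (-(r h : ℝ)) (hd j P) := by
      intro α hα
      have := hdeg2 α hα h
      have h2 : wt (fun x : Fin m × ι => if x.1 = h then (-1:ℝ) else 0) α = -((∑ i, α (h, i) : ℕ) : ℝ) := by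
        rw [wt, Fintype.sum_prod_type]
        rw [Finset.sum_eq_single h]
        · simp
        · intro b _ hb; simp [hb]
        · simp
      rw [h2]
      have : ((∑ i, α (h, i) : ℕ) : ℝ) ≤ r h := by exact_mod_cast this
      linarith
    have hI2 := IndGe.aeval' (w' := fun k : Fin m => if k = h then (-1:ℝ) else 0) hI
      (fun x : Fin m × ι => (C (v x) + if x.2 = s x.1 then X x.1 else 0 : MvPolynomial (Fin m) ℤ)) (fun x => by
        refine IndGe.add ?_ ?_
        · refine (IndGe.C' _).mono ?_
          split_ifs <;> norm_num
        · by_cases h1 : x.2 = s x.1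
          · rw [if_pos h1]
            exact IndGe.X' (R := ℤ) (w := fun k : Fin m => if k = h then (-1:ℝ) else 0) x.1
          · rw [if_neg h1]; exact IndGe.zero _)
    rw [degreeOf_le_iff]
    intro β hβ
    have := hI2 β (mem_support_iff.1 hβ)
    rw [wt] at this
    simp at this
    exact this
  have hSr : ((∑ h, r h : ℕ) : ℝ) = ∑ h, (r h : ℝ) := by push_cast; rfl
  have hl1R : l1 nZ R ≤ (2 ^ (∑ x : Fin m × ι, r x.1) * l1 nZ P) * D ^ (∑ h, r h) := by
    refine (l1_aeval_le nZ nZ_one (hd j P) _ (D ^ (∑ h, r h)) ?_).trans ?_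
    · intro α hα
      have hle : ∀ x : Fin m × ι, l1 nZ (C (v x) + if x.2 = s x.1 then X x.1 else 0 : MvPolynomial (Fin m) ℤ) ≤ D := by
        intro x
        refine (l1_add_le _ _ _).trans ?_
        rw [l1_C, hD, nZ_apply]
        refine add_le_add (hvb x) ?_
        split_ifs
        · rw [l1_X]; exact nZ_one
        · rw [l1_zero]; exact zero_le_one
      refine (Finset.prod_le_prod (fun x _ => pow_nonneg (l1_nonneg _ _) _) (fun x _ => pow_le_pow_left₀ (l1_nonneg _ _) (hle x) _)).trans ?_
      rw [Finset.prod_pow_eq_pow_sum]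
      refine pow_le_pow_right₀ hD1 ?_
      calc ∑ x ∈ α.support, α x ≤ ∑ x, α x := Finset.sum_le_sum_of_subset (Finset.subset_univ _)
        _ = ∑ h, ∑ i, α (h, i) := Fintype.sum_prod_type _
        _ ≤ _ := Finset.sum_le_sum fun h _ => hdeg2 α (mem_support_iff.1 hα) h
    · gcongr
      exact l1_hd_le j P (fun x => r x.1) hdegs
  have hl1P : 1 ≤ l1 nZ P := one_le_l1_of_ne_zero P hP
  have hl1R1 : 1 ≤ l1 nZ R := one_le_l1_of_ne_zero R hR0
  set S : ℝ := ∑ h, (r h : ℝ) with hS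
  have hS0 : 0 ≤ S := by positivity
  have hlogR : Real.log (l1 nZ R) ≤ S * (N + Real.log D) + Real.log (l1 nZ P) := by
    have h1 := Real.log_le_log (by linarith) hl1R
    rw [Real.log_mul (by positivity) (by positivity), Real.log_mul (by positivity) (by positivity), Real.log_pow, Real.log_pow, hSr] at h1
    have h2 : ((∑ x : Fin m × ι, r x.1 : ℕ) : ℝ) = N * S := by
      push_cast
      rw [Fintype.sum_prod_type, hS, Finset.mul_sum]
      simp [hN]
    rw [h2] at h1
    have h3 : Real.log 2 ≤ 1 := by linarith [Real.log_two_lt_d9]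
    have h4 : N * S * Real.log 2 ≤ N * S := by
      have : 0 ≤ N * S := by positivity
      nlinarith
    nlinarith
  have hlP0 : 0 ≤ Real.log (l1 nZ P) := Real.log_nonneg hl1P
  obtain ⟨γ, hγ, hγw⟩ := hroth r p q hr hcop hq (fun h k hk => (hrr h k hk).trans (by gcongr)) R hR0 hRdeg
    (fun h => by
      have h1 : Real.log (l1 nZ R) + S ≤ K * (Real.log (l1 nZ P) + S) := by
        rw [hK]
        have : 0 ≤ (N + Real.log D) * Real.log (l1 nZ P) := by positivity
        nlinarith
      have h2 := hlog h
      have h3 := hlogH h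
      have h4 : K * (ω * r h * Real.log |(n h (s0 h) : ℝ)|) ≤ K * (ω * r h * ((N + 1) * Real.log (max |(p h:ℝ)| |(q h:ℝ)|))) := by
        gcongr
      have h5 : K * (ω * r h * ((N + 1) * Real.log (max |(p h:ℝ)| |(q h:ℝ)|))) = ω1 * r h * Real.log (max |(p h:ℝ)| |(q h:ℝ)|) := by
        rw [hω]; field_simp
      have h6 : K * (Real.log (l1 nZ P) + S) ≤ K * (ω * r h * Real.log |(n h (s0 h) : ℝ)|) := by gcongr
      linarith)
  set ξ : Fin m → ℚ := fun h => (p h : ℚ) / q h with hξ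
  set y : Fin m × ι → ℚ := fun x => v x + if x.2 = s x.1 then ξ x.1 else 0 with hy
  refine ⟨y, ?_, ?_⟩
  · intro h
    have h1 : ∑ i, (n h i : ℚ) * y (h, i) = ∑ i, (n h i : ℚ) * v (h, i) + n h (s h) * ξ h := by
      simp [hy, mul_add, Finset.sum_add_distrib]
    rw [h1, hξ]
    have hq' : (q h : ℚ) ≠ 0 := by exact_mod_cast hq h
    have h2 : (n h (s h) : ℚ) * p h = - (∑ i, (n h i : ℚ) * v (h, i)) * q h := by exact_mod_cast hpq h
    field_simp
    linarith
  · by_contra hcon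
    push Not at hcon
    have hr1 : ∀ h, (1:ℝ) ≤ r h := fun h => by exact_mod_cast hr h
    have hind : IndGe (fun x : Fin m × ι => 1 / (r x.1 : ℝ)) ε (shift y (map (Int.castRingHom ℚ) P)) := by
      intro α hα
      refine (hcon α hα).le.trans (le_of_eq ?_)
      rw [wt]; refine Finset.sum_congr rfl fun x _ => by ring
    have hind2 := hind.hd j
    rw [← shift_hd, ← map_hd] at hind2
    have hind3 := IndGe.aeval' (w' := fun h : Fin m => 1 / (r h : ℝ)) hind2
      (fun x : Fin m × ι => (if x.2 = s x.1 then X x.1 else 0 : MvPolynomial (Fin m) ℚ)) (fun x => by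
        split_ifs
        · exact IndGe.X' (w := fun h : Fin m => 1 / (r h : ℝ)) x.1
        · exact IndGe.zero _)
    have hcomp : aeval (fun x : Fin m × ι => (if x.2 = s x.1 then X x.1 else 0 : MvPolynomial (Fin m) ℚ))
        (shift y (map (Int.castRingHom ℚ) (hd j P))) = shift ξ (map (Int.castRingHom ℚ) R) := by
      rw [hR, map_aeval']
      have : ((aeval (fun x : Fin m × ι => (if x.2 = s x.1 then X x.1 else 0 : MvPolynomial (Fin m) ℚ))).comp (shift y)) =
        (shift ξ).comp (aeval (fun x : Fin m × ι => map (Int.castRingHom ℚ) (C (v x) + if x.2 = s x.1 then X x.1 else 0))) := by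
        ext1 x
        simp only [AlgHom.comp_apply, shift, aeval_X, hy, map_add]
        split_ifs with h1
        · simp [h1]; ring
        · simp
      exact DFunLike.congr_fun this _
    rw [hcomp] at hind3
    have hfin := hind3 γ hγ
    have h1 : wt (fun h : Fin m => 1 / (r h : ℝ)) γ = ∑ i, (γ i : ℝ) / r i := by
      rw [wt]; refine Finset.sum_congr rfl fun x _ => by ring
    have h2 : wt (fun x : Fin m × ι => 1 / (r x.1 : ℝ)) j ≤ ε / 3 := by
      refine le_trans ?_ hB
      have hBpos : (0:ℝ) < B := by exact_mod_cast hB1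
      calc wt (fun x : Fin m × ι => 1 / (r x.1 : ℝ)) j ≤ ∑ x : Fin m × ι, 1 / (B:ℝ) := by
            rw [wt]
            refine Finset.sum_le_sum fun x _ => ?_
            have h3 := hr1 x.1
            have h4 : (j x : ℝ) * B ≤ r x.1 := by exact_mod_cast hj x
            rw [div_mul_eq_mul_div, one_mul, div_le_div_iff₀ (by linarith) hBpos]
            linarith
        _ = _ := by simp [hN]; ring
    rw [h1] at hfin
    linarith

end Schmidt

end PartE2

section PartD1
open MvPolynomial NumberField

namespace Schmidt

lemma second_moment {m : ℕ} {β : Type*} (A : Fin m → Finset β) (f : Fin m → β → ℝ)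
    (h0 : ∀ h, ∑ b ∈ A h, f h b = 0) (h1 : ∀ h, ∀ b ∈ A h, |f h b| ≤ 1) :
    ∑ J ∈ Fintype.piFinset A, (∑ h, f h (J h)) ^ 2 ≤ m * (Fintype.piFinset A).card := by
  classical
  have hoff : ∀ h h' : Fin m, h ≠ h' → ∑ J ∈ Fintype.piFinset A, f h (J h) * f h' (J h') = 0 := by
    intro h h' hh
    have := Finset.prod_univ_sum A (fun k b => (if k = h then f h b else 1) * (if k = h' then f h' b else 1))
    simp only [Finset.prod_mul_distrib, Finset.prod_ite_eq', Finset.mem_univ, if_true] at this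
    rw [← this]
    refine Finset.prod_eq_zero (Finset.mem_univ h) ?_
    simp [hh, h0]
  have hexp : ∀ J ∈ Fintype.piFinset A, (∑ h, f h (J h)) ^ 2 = ∑ h, ∑ h', f h (J h) * f h' (J h') := by
    intro J _
    rw [sq, Finset.sum_mul_sum]
  rw [Finset.sum_congr rfl hexp, Finset.sum_comm]
  have : ∀ h ∈ Finset.univ, ∑ J ∈ Fintype.piFinset A, ∑ h' : Fin m, f h (J h) * f h' (J h') ≤ (Fintype.piFinset A).card := by
    intro h _
    rw [Finset.sum_comm, Finset.sum_eq_single h]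
    · rw [Finset.card_eq_sum_ones, Nat.cast_sum]
      refine Finset.sum_le_sum fun J hJ => ?_
      have := h1 h (J h) (Fintype.mem_piFinset.1 hJ h)
      rw [← sq, ← sq_abs]
      push_cast
      nlinarith [abs_nonneg (f h (J h))]
    · intro b _ hb; exact hoff h b hb.symm
    · simp
  refine (Finset.sum_le_sum this).trans ?_
  simp

lemma mean_piAntidiag {ι : Type*} [Fintype ι] [DecidableEq ι] (r : ℕ) (i : ι) :
    (Fintype.card ι : ℝ) * ∑ j ∈ Finset.piAntidiag (Finset.univ : Finset ι) r, (j i : ℝ) = r * (Finset.piAntidiag (Finset.univ : Finset ι) r).card := by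
  have hsym : ∀ i', ∑ j ∈ Finset.piAntidiag (Finset.univ : Finset ι) r, (j i' : ℝ) =
      ∑ j ∈ Finset.piAntidiag (Finset.univ : Finset ι) r, (j i : ℝ) := by
    intro i'
    refine Finset.sum_bij (fun j _ => j ∘ Equiv.swap i i') ?_ ?_ ?_ ?_
    · intro j hj
      simp only [Finset.mem_piAntidiag] at hj ⊢
      refine ⟨?_, by simp⟩
      rw [← hj.1]
      exact Equiv.sum_comp (Equiv.swap i i') j
    · intro a _ b _ hab
      funext x
      have := congrFun hab (Equiv.swap i i' x)
      simpa using this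
    · intro b hb
      refine ⟨b ∘ Equiv.swap i i', ?_, by funext x; simp⟩
      simp only [Finset.mem_piAntidiag] at hb ⊢
      refine ⟨?_, by simp⟩
      rw [← hb.1]
      exact Equiv.sum_comp (Equiv.swap i i') b
    · intro j _; simp
  have h2 : ∑ i', ∑ j ∈ Finset.piAntidiag (Finset.univ : Finset ι) r, (j i' : ℝ) = r * (Finset.piAntidiag (Finset.univ : Finset ι) r).card := by
    rw [Finset.sum_comm]
    rw [Finset.sum_congr rfl (g := fun _ => (r : ℝ))]
    · simp [mul_comm]
    · intro j hj
      have := (Finset.mem_piAntidiag.1 hj).1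
      exact_mod_cast this
  rw [← h2, Finset.sum_congr rfl (fun i' _ => hsym i')]
  simp

def adm {m : ℕ} (ι : Type*) [Fintype ι] [DecidableEq ι] (r : Fin m → ℕ) : Finset (Fin m → ι → ℕ) :=
  Fintype.piFinset fun h => Finset.piAntidiag (Finset.univ : Finset ι) (r h)

lemma mem_adm {m : ℕ} {ι : Type*} [Fintype ι] [DecidableEq ι] {r : Fin m → ℕ} {J : Fin m → ι → ℕ} :
    J ∈ adm ι r ↔ ∀ h, ∑ i, J h i = r h := by
  simp [adm, Fintype.mem_piFinset, Finset.mem_piAntidiag]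

lemma card_adm_le {m : ℕ} (ι : Type*) [Fintype ι] [DecidableEq ι] (r : Fin m → ℕ) :
    (adm ι r).card ≤ (2 ^ Fintype.card ι) ^ (∑ h, r h) := by
  rw [adm, Fintype.card_piFinset, ← Finset.prod_pow_eq_pow_sum]
  refine Finset.prod_le_prod' fun h _ => ?_
  have : Finset.piAntidiag (Finset.univ : Finset ι) (r h) ⊆ Fintype.piFinset fun _ => Finset.range (r h + 1) := by
    intro j hj
    rw [Fintype.mem_piFinset]
    intro i
    rw [Finset.mem_range, Nat.lt_succ_iff, ← (Finset.mem_piAntidiag.1 hj).1]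
    exact Finset.single_le_sum (f := j) (fun _ _ => Nat.zero_le _) (Finset.mem_univ i)
  refine (Finset.card_le_card this).trans ?_
  rw [Fintype.card_piFinset]
  simp only [Finset.card_range, Finset.prod_const, Finset.card_univ]
  rw [← pow_mul, mul_comm, pow_mul]
  exact Nat.pow_le_pow_left (Nat.lt_two_pow_self) _

lemma adm_pos {m : ℕ} (ι : Type*) [Fintype ι] [DecidableEq ι] [Nonempty ι] (r : Fin m → ℕ) : 0 < (adm ι r).card := by
  refine Finset.card_pos.2 ⟨fun h i => if i = Classical.arbitrary ι then r h else 0, ?_⟩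
  rw [mem_adm]; intro h; simp

def Unbal {m : ℕ} {ι : Type*} [Fintype ι] (r : Fin m → ℕ) (ε : ℝ) (J : Fin m → ι → ℕ) : Prop :=
  ∃ i, m * ε < |∑ h, ((J h i : ℝ) / r h) - m / Fintype.card ι|

open Classical in
lemma card_unbal {m : ℕ} (ι : Type*) [Fintype ι] [Nonempty ι] (r : Fin m → ℕ) (hr : ∀ h, 1 ≤ r h)
    (ε : ℝ) (hε : 0 < ε) :
    ((adm ι r).filter (Unbal r ε)).card * (m * ε ^ 2) ≤ Fintype.card ι * (adm ι r).card := by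
  have hN : (0:ℝ) < Fintype.card ι := by exact_mod_cast Fintype.card_pos
  rcases Nat.eq_zero_or_pos m with hm | hm
  · subst hm; simp; positivity
  have hm' : (0:ℝ) < m := by exact_mod_cast hm
  have key : ∀ i : ι, (((adm ι r).filter fun J => m * ε < |∑ h, ((J h i : ℝ) / r h) - m / Fintype.card ι|).card : ℝ) * (m * ε ^ 2) ≤
      (adm ι r).card := by
    intro i
    have h2 := second_moment (fun h => Finset.piAntidiag (Finset.univ : Finset ι) (r h))
      (fun h j => (j i : ℝ) / r h - 1 / Fintype.card ι) (by
        intro h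
        have := mean_piAntidiag (r h) i
        have hr' : (0:ℝ) < r h := by exact_mod_cast hr h
        rw [Finset.sum_sub_distrib, ← Finset.sum_div]
        simp only [Finset.sum_const, nsmul_eq_mul]
        field_simp
        linarith) (by
        intro h j hj
        have hr' : (0:ℝ) < r h := by exact_mod_cast hr h
        have h3 : (j i : ℝ) ≤ r h := by
          rw [← (Finset.mem_piAntidiag.1 hj).1]
          exact_mod_cast Finset.single_le_sum (f := j) (fun _ _ => Nat.zero_le _) (Finset.mem_univ i)
        have h4 : (j i : ℝ) / r h ≤ 1 := (div_le_one hr').2 h3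
        have h5 : 0 ≤ (j i : ℝ) / r h := by positivity
        have h6 : 1 / (Fintype.card ι : ℝ) ≤ 1 := (div_le_one hN).2 (by exact_mod_cast Fintype.card_pos)
        have h7 : 0 ≤ 1 / (Fintype.card ι : ℝ) := by positivity
        rw [abs_le]; constructor <;> linarith)
    change ∑ J ∈ adm ι r, _ ≤ (m:ℝ) * (adm ι r).card at h2
    have h3 : (((adm ι r).filter fun J => m * ε < |∑ h, ((J h i : ℝ) / r h) - m / Fintype.card ι|).card : ℝ) * (m * ε) ^ 2 ≤ m * (adm ι r).card := by
      refine le_trans ?_ h2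
      refine le_trans ?_ (Finset.sum_le_sum_of_subset_of_nonneg (Finset.filter_subset (fun J => m * ε < |∑ h, ((J h i : ℝ) / r h) - m / Fintype.card ι|) _) fun _ _ _ => sq_nonneg _)
      rw [← nsmul_eq_mul]
      refine Finset.card_nsmul_le_sum _ _ _ fun J hJ => ?_
      have := (Finset.mem_filter.1 hJ).2
      rw [Finset.sum_sub_distrib]
      simp only [Finset.sum_const, Finset.card_univ, Fintype.card_fin, nsmul_eq_mul, mul_one_div]
      rw [← sq_abs (_ - _)]
      exact pow_le_pow_left₀ (by positivity) this.le 2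
    have h4 : (((adm ι r).filter fun J => m * ε < |∑ h, ((J h i : ℝ) / r h) - m / Fintype.card ι|).card : ℝ) * (m * ε) ^ 2 =
      m * ((((adm ι r).filter fun J => m * ε < |∑ h, ((J h i : ℝ) / r h) - m / Fintype.card ι|).card : ℝ) * (m * ε ^ 2)) := by ring
    rw [h4] at h3
    exact le_of_mul_le_mul_left h3 hm'
  have hsub : (adm ι r).filter (Unbal r ε) ⊆ Finset.univ.biUnion fun i : ι => (adm ι r).filter fun J => m * ε < |∑ h, ((J h i : ℝ) / r h) - m / Fintype.card ι| := by
    intro J hJ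
    rw [Finset.mem_filter] at hJ
    obtain ⟨i, hi⟩ := hJ.2
    simp only [Finset.mem_biUnion, Finset.mem_filter, Finset.mem_univ, true_and]
    exact ⟨i, hJ.1, hi⟩
  have h1 : (((adm ι r).filter (Unbal r ε)).card : ℝ) ≤ ∑ i : ι, (((adm ι r).filter fun J => m * ε < |∑ h, ((J h i : ℝ) / r h) - m / Fintype.card ι|).card : ℝ) := by
    exact_mod_cast (Finset.card_le_card hsub).trans Finset.card_biUnion_le
  refine (mul_le_mul_of_nonneg_right h1 (by positivity)).trans ?_
  rw [Finset.sum_mul]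
  refine (Finset.sum_le_sum fun i _ => key i).trans ?_
  simp

lemma siegel_simple {α β : Type*} [Fintype α] [Fintype β] [DecidableEq β] (A : Matrix α β ℤ) (h : 2 * Fintype.card α ≤ Fintype.card β)
    (hb : 0 < Fintype.card β) (B : ℝ) (hB : 1 ≤ B) (hA : ∀ a b, |(A a b : ℝ)| ≤ B) :
    ∃ t : β → ℤ, t ≠ 0 ∧ (∀ a, ∑ b, A a b * t b = 0) ∧ ∀ b, |(t b : ℝ)| ≤ Fintype.card β * B := by
  classical
  have hb1 : (1:ℝ) ≤ Fintype.card β := by exact_mod_cast hb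
  rcases Nat.eq_zero_or_pos (Fintype.card α) with h0 | h0
  · have := Fintype.card_eq_zero_iff.1 h0
    obtain ⟨b0⟩ := Fintype.card_pos_iff.1 hb
    refine ⟨fun _ => 1, fun hh => by simpa using congrFun hh b0, fun a => isEmptyElim a, fun b => ?_⟩
    simp; nlinarith
  · let _inst : SeminormedAddCommGroup (Matrix α β ℤ) := Matrix.seminormedAddCommGroup
    obtain ⟨t, ht, hAt, hn⟩ := Int.Matrix.exists_ne_zero_int_vec_norm_le A (by omega) h0
    refine ⟨t, ht, fun a => congrFun hAt a, fun b => ?_⟩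
    have h1 : |(t b : ℝ)| ≤ ‖t‖ := by
      have := norm_le_pi_norm t b
      rwa [Int.norm_eq_abs] at this
    have hAn : ‖A‖ ≤ B := by
      refine (Matrix.norm_le_iff (by linarith)).2 ?_
      intro a b; rw [Int.norm_eq_abs]; exact hA a b
    refine (h1.trans hn).trans ?_
    have hbase : (1:ℝ) ≤ Fintype.card β * max 1 ‖A‖ := by
      nlinarith [le_max_left 1 ‖A‖]
    have h' : 2 * (Fintype.card α : ℝ) ≤ Fintype.card β := by exact_mod_cast h
    have h0' : (0:ℝ) < Fintype.card α := by exact_mod_cast h0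
    refine (Real.rpow_le_rpow_of_exponent_le hbase (y := _) (z := 1) ?_).trans ?_
    · rw [div_le_one (by linarith)]; linarith
    · rw [Real.rpow_one]
      exact mul_le_mul_of_nonneg_left (max_le hB hAn) (by linarith)

end Schmidt

end PartD1

section PartD2
open MvPolynomial NumberField

namespace Schmidt

noncomputable def nK (K : Type*) [Field K] [NumberField K] : RingSeminorm (𝓞 K) where
  toFun x := house (x : K)
  map_zero' := by simp [house]
  add_le' x y := by push_cast; exact house_add_le _ _
  neg' x := by simp [house]
  mul_le' x y := by push_cast; exact house_mul_le _ _

lemma nK_apply {K : Type*} [Field K] [NumberField K] (x : 𝓞 K) : nK K x = house (x : K) := rfl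

lemma nK_one (K : Type*) [Field K] [NumberField K] : nK K 1 ≤ 1 := by
  rw [nK_apply]
  have := house_intCast (K := K) 1
  simp at this
  simp [this]

lemma nK_int {K : Type*} [Field K] [NumberField K] (n : ℤ) : nK K (n : 𝓞 K) = |(n:ℝ)| := by
  rw [nK_apply]
  have := house_intCast (K := K) n
  simpa using this

lemma repr_le_house (K : Type*) [Field K] [NumberField K] : ∃ c : ℝ, 1 ≤ c ∧ ∀ (α : 𝓞 K) (i : K →+* ℂ),
    |(((RingOfIntegers.basis K).reindex (equivReindex K).symm).repr α i : ℝ)| ≤ c * nK K α := by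
  classical
  obtain ⟨c, hc⟩ : ∃ c : ℝ, ∀ (α : 𝓞 K) (i : K →+* ℂ), ‖(((integralBasis K).reindex (equivReindex K).symm).repr α i : ℂ)‖ ≤
      c * house (algebraMap (𝓞 K) K α) := ⟨_, house.basis_repr_norm_le_const_mul_house K⟩
  refine ⟨max 1 c, le_max_left _ _, fun α i => ?_⟩
  have := hc α i
  simp only [Module.Basis.repr_reindex, Finsupp.mapDomain_equiv_apply,
        integralBasis_repr_apply, eq_intCast, Rat.cast_intCast,
          Complex.norm_intCast] at this ⊢
  refine le_trans (mod_cast this) ?_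
  rw [nK_apply]
  exact mul_le_mul_of_nonneg_right (le_max_right _ _) (house_nonneg _)

noncomputable def fs {m : ℕ} {ι : Type*} [Fintype ι] (J : Fin m → ι → ℕ) : Fin m × ι →₀ ℕ :=
  Finsupp.equivFunOnFinite.symm fun x => J x.1 x.2

lemma fs_apply {m : ℕ} {ι : Type*} [Fintype ι] (J : Fin m → ι → ℕ) (x : Fin m × ι) : fs J x = J x.1 x.2 := rfl

lemma fs_curry {m : ℕ} {ι : Type*} [Fintype ι] (α : Fin m × ι →₀ ℕ) : fs (fun h i => α (h, i)) = α := by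
  ext x; rfl

lemma fs_inj {m : ℕ} {ι : Type*} [Fintype ι] {J J' : Fin m → ι → ℕ} (h : fs J = fs J') : J = J' := by
  funext a b; exact DFunLike.congr_fun h (a, b)

noncomputable def lsub {m : ℕ} {ι R : Type*} [Fintype ι] [CommRing R] (M : ι → ι → R) (x : Fin m × ι) : MvPolynomial (Fin m × ι) R :=
  ∑ j, C (M x.2 j) * X (x.1, j)

lemma wt_block {m : ℕ} {ι : Type*} [Fintype ι] (h : Fin m) (c : ℝ) (α : Fin m × ι →₀ ℕ) :
    wt (fun x : Fin m × ι => if x.1 = h then c else 0) α = c * ((∑ i, α (h, i) : ℕ) : ℝ) := by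
  rw [wt, Fintype.sum_prod_type]
  rw [Finset.sum_eq_single h]
  · simp [Finset.mul_sum]
  · intro b _ hb; simp [hb]
  · simp

def MH {m : ℕ} {ι R : Type*} [Fintype ι] [CommRing R] (r : Fin m → ℕ) (P : MvPolynomial (Fin m × ι) R) : Prop :=
  ∀ α, coeff α P ≠ 0 → ∀ h, ∑ i, α (h, i) = r h

lemma MH.lsub {m : ℕ} {ι R : Type*} [Fintype ι] [CommRing R] {r : Fin m → ℕ} {P : MvPolynomial (Fin m × ι) R}
    (hP : MH r P) (M : ι → ι → R) : MH r (aeval (lsub (m := m) M) P) := by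
  intro α hα h
  have key : ∀ c : ℝ, c * r h ≤ c * ((∑ i, α (h, i) : ℕ) : ℝ) := by
    intro c
    have h1 : IndGe (fun x : Fin m × ι => if x.1 = h then c else 0) (c * r h) P := by
      intro β hβ
      rw [wt_block, hP β hβ h]
    have h2 := h1.aeval' (w' := fun x : Fin m × ι => if x.1 = h then c else 0) (Schmidt.lsub (m := m) M) (fun x => by
      refine IndGe.sum _ _ fun j _ => ?_
      have := IndGe.mul (IndGe.C' (w := fun x : Fin m × ι => if x.1 = h then c else 0) (M x.2 j)) (IndGe.X' (x.1, j))
      simpa using this)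
    have h3 := h2 α hα
    rwa [wt_block] at h3
  have h1 := key 1
  have h2 := key (-1)
  have : ((∑ i, α (h, i) : ℕ) : ℝ) = r h := by linarith
  exact_mod_cast this

lemma MH.support_prod {m : ℕ} {ι : Type*} [Fintype ι] (α : Fin m × ι →₀ ℕ) (r : Fin m → ℕ) (B : Fin m → ℝ)
    (h : ∀ h, ∑ i, α (h, i) = r h) : ∏ x : Fin m × ι, B x.1 ^ α x = ∏ h, B h ^ r h := by
  rw [Fintype.prod_prod_type]
  refine Finset.prod_congr rfl fun k _ => ?_
  rw [← h k, ← Finset.prod_pow_eq_pow_sum]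

theorem aux_poly (K : Type*) [Field K] [NumberField K] (ι : Type*) [Fintype ι] [Nonempty ι] (M : ι → ι → 𝓞 K) :
    ∃ Cst : ℝ, 1 ≤ Cst ∧ ∀ (ε : ℝ), 0 < ε → ∀ m : ℕ, 2 * Fintype.card ι * Module.finrank ℚ K ≤ m * ε ^ 2 →
      ∀ r : Fin m → ℕ, (∀ h, 1 ≤ r h) → ∃ P : MvPolynomial (Fin m × ι) ℤ, P ≠ 0 ∧ MH r P ∧
        l1 nZ P ≤ Cst ^ (∑ h, r h) ∧
        ∀ J, coeff (fs J) (aeval (lsub M) (map (algebraMap ℤ (𝓞 K)) P)) ≠ 0 → ¬ Unbal r ε J := by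
  classical
  obtain ⟨c, hc1, hc⟩ := repr_le_house K
  set b := (RingOfIntegers.basis K).reindex (equivReindex K).symm with hb
  set B : ℝ := 1 + ∑ i, ∑ j, nK K (M i j) with hB
  have hB1 : 1 ≤ B := by
    rw [hB]
    have : 0 ≤ ∑ i, ∑ j, nK K (M i j) := Finset.sum_nonneg fun _ _ => Finset.sum_nonneg fun _ _ => apply_nonneg _ _
    linarith
  set N := Fintype.card ι with hN
  have hNpos : 0 < N := Fintype.card_pos
  refine ⟨(2 ^ N) * (2 ^ N) * (c * B), ?_, ?_⟩
  · have : (1:ℝ) ≤ 2 ^ N := one_le_pow₀ (by norm_num)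
    have h2 : (1:ℝ) ≤ 2 ^ N * 2 ^ N := by nlinarith
    have h3 : 1 ≤ c * B := by nlinarith
    nlinarith
  intro ε hε m hm r hr
  have hmpos : 0 < m := by
    rcases Nat.eq_zero_or_pos m with h | h
    · subst h
      have h1 : (0:ℝ) < Module.finrank ℚ K := by exact_mod_cast Module.finrank_pos
      have h2 : (0:ℝ) < N := by exact_mod_cast hNpos
      simp at hm
      have : (0:ℝ) < N * Module.finrank ℚ K := by positivity
      nlinarith
    · exact h
  set S := ∑ h, r h with hS
  have hS1 : 1 ≤ S := (hr ⟨0, hmpos⟩).trans (Finset.single_le_sum (f := r) (fun _ _ => Nat.zero_le _) (Finset.mem_univ _))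
  set bad := (adm ι r).filter (Unbal r ε) with hbad
  have hcard := card_unbal ι r hr ε hε
  have hcb : 2 * (bad.card * Module.finrank ℚ K) ≤ (adm ι r).card := by
    have hD : (0:ℝ) < Module.finrank ℚ K := by exact_mod_cast Module.finrank_pos
    have hNr : (0:ℝ) < N := by exact_mod_cast hNpos
    have h1 : (bad.card : ℝ) * (2 * N * Module.finrank ℚ K) ≤ N * (adm ι r).card :=
      (mul_le_mul_of_nonneg_left hm (by positivity)).trans hcard
    have h2 : (N:ℝ) * (2 * (bad.card * Module.finrank ℚ K)) ≤ N * (adm ι r).card := by linarith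
    exact_mod_cast le_of_mul_le_mul_left h2 hNr
  set mon : (Fin m → ι → ℕ) → MvPolynomial (Fin m × ι) (𝓞 K) := fun J => aeval (lsub M) (monomial (fs J) (1 : 𝓞 K)) with hmon
  have hmonMH : ∀ J ∈ adm ι r, MH r (monomial (fs J) (1 : 𝓞 K)) := by
    intro J hJ α hα h
    rw [coeff_monomial] at hα
    have : fs J = α := by by_contra hh; simp [hh] at hα
    rw [← this]; exact mem_adm.1 hJ h
  have hlsub : ∀ x : Fin m × ι, l1 (nK K) (lsub (m := m) M x) ≤ B := by
    intro x
    refine (l1_sum_le _ _ _).trans ?_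
    have : ∀ j ∈ Finset.univ, l1 (nK K) (C (M x.2 j) * X (x.1, j) : MvPolynomial (Fin m × ι) (𝓞 K)) ≤ nK K (M x.2 j) := by
      intro j _
      refine (l1_mul_le _ _ _).trans ?_
      rw [l1_C, l1_X]
      exact mul_le_of_le_one_right (apply_nonneg _ _) (nK_one K)
    refine (Finset.sum_le_sum this).trans ?_
    have h2 := Finset.single_le_sum (f := fun i => ∑ j, nK K (M i j)) (fun _ _ => Finset.sum_nonneg fun _ _ => apply_nonneg _ _) (Finset.mem_univ x.2)
    rw [hB]; linarith
  have hmonl1 : ∀ J ∈ adm ι r, l1 (nK K) (mon J) ≤ B ^ S := by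
    intro J hJ
    refine (l1_aeval_le _ (nK_one K) _ _ (B ^ S) ?_).trans ?_
    · intro α hα
      rw [← hS.symm, ← Finset.prod_pow_eq_pow_sum, ← MH.support_prod α r (fun _ => B) (hmonMH J hJ α (mem_support_iff.1 hα))]
      rw [← Finset.prod_subset (Finset.subset_univ α.support) (fun x _ hx => by simp [Finsupp.notMem_support_iff.1 hx])]
      exact Finset.prod_le_prod (fun _ _ => pow_nonneg (l1_nonneg _ _) _) fun x _ => pow_le_pow_left₀ (l1_nonneg _ _) (hlsub x) _
    · rw [l1_monomial]
      exact mul_le_of_le_one_left (by positivity) (nK_one K)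
  obtain ⟨t, ht0, htA, htn⟩ := siegel_simple (α := bad × (K →+* ℂ)) (β := adm ι r)
    (fun a J => b.repr (coeff (fs a.1.1) (mon J.1)) a.2) (by
      rw [Fintype.card_prod, Fintype.card_coe, Fintype.card_coe, Embeddings.card]
      exact hcb) (by rw [Fintype.card_coe]; exact adm_pos ι r) (c * B ^ S) (by
      nlinarith [one_le_pow₀ (n := S) hB1]) (by
      intro a J
      refine (hc _ _).trans ?_
      exact mul_le_mul_of_nonneg_left ((coeff_le_l1 _ _ _).trans (hmonl1 J.1 J.2)) (by linarith))
  set P : MvPolynomial (Fin m × ι) ℤ := ∑ J : adm ι r, monomial (fs J.1) (t J) with hP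
  have hcoeff : ∀ J : adm ι r, coeff (fs J.1) P = t J := by
    intro J
    rw [hP, coeff_sum, Finset.sum_eq_single J]
    · simp
    · intro J' _ hJ'
      rw [coeff_monomial, if_neg]
      intro h; exact hJ' (Subtype.ext (fs_inj h))
    · simp
  have hcoeff0 : ∀ α, coeff α P ≠ 0 → ∀ h, ∑ i, α (h, i) = r h := by
    intro α hα h
    rw [hP, coeff_sum] at hα
    obtain ⟨J, _, hJ⟩ := Finset.exists_ne_zero_of_sum_ne_zero hα
    rw [coeff_monomial] at hJ
    have : fs J.1 = α := by by_contra hh; simp [hh] at hJ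
    rw [← this]; exact mem_adm.1 J.2 h
  refine ⟨P, ?_, hcoeff0, ?_, ?_⟩
  · intro h
    apply ht0
    funext J
    rw [← hcoeff J, h]; simp
  · rw [hP]
    refine (l1_sum_le _ _ _).trans ?_
    have : ∀ J ∈ (Finset.univ : Finset (adm ι r)), l1 nZ (monomial (fs J.1) (t J)) ≤ Fintype.card (adm ι r) * (c * B ^ S) := by
      intro J _
      rw [l1_monomial, nZ_apply]; exact htn J
    refine (Finset.sum_le_sum this).trans ?_
    rw [Finset.sum_const, nsmul_eq_mul, Finset.card_univ, Fintype.card_coe]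
    have h1 : ((adm ι r).card : ℝ) ≤ (2 ^ N) ^ S := by exact_mod_cast card_adm_le ι r
    have h2 : c ≤ c ^ S := le_self_pow₀ hc1 (by omega)
    rw [mul_pow, mul_pow, mul_pow, mul_assoc]
    gcongr
  · intro J hJ hun
    apply hJ
    by_cases hJadm : J ∈ adm ι r
    · have hexp : aeval (lsub M) (map (algebraMap ℤ (𝓞 K)) P) = ∑ J' : adm ι r, C (algebraMap ℤ (𝓞 K) (t J')) * mon J'.1 := by
        rw [hP, map_sum, map_sum]
        refine Finset.sum_congr rfl fun J' _ => ?_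
        rw [map_monomial, hmon]
        simp only
        rw [show monomial (fs J'.1) (algebraMap ℤ (𝓞 K) (t J')) = C (algebraMap ℤ (𝓞 K) (t J')) * monomial (fs J'.1) (1 : 𝓞 K) by
          rw [C_mul_monomial, mul_one], map_mul, algHom_C]
        rfl
      rw [hexp, coeff_sum]
      apply b.repr.injective
      ext e
      have := htA (⟨J, by rw [hbad, Finset.mem_filter]; exact ⟨hJadm, hun⟩⟩, e)
      rw [map_sum, map_zero, Finsupp.finsetSum_apply, Finsupp.zero_apply, ← this]
      refine Finset.sum_congr rfl fun J' _ => ?_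
      rw [coeff_C_mul]
      have h3 : (algebraMap ℤ (𝓞 K) (t J')) * coeff (fs J) (mon J'.1) = t J' • coeff (fs J) (mon J'.1) := by
        rw [Algebra.smul_def]
      rw [h3, map_smul, Finsupp.smul_apply, smul_eq_mul, mul_comm]
    · by_contra hne
      apply hJadm
      rw [mem_adm]
      have hMHP : MH r (map (algebraMap ℤ (𝓞 K)) P) := by
        intro α hα
        apply hcoeff0
        intro h
        rw [coeff_map, h] at hα; simp at hα
      exact hMHP.lsub M (fs J) hne

end Schmidt

end PartD2

section PartD3
open MvPolynomial NumberField

namespace Schmidt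

noncomputable def nR : RingSeminorm ℝ := normRingSeminorm ℝ

lemma nR_apply (x : ℝ) : nR x = |x| := rfl

lemma nR_one : nR 1 ≤ 1 := by simp [nR_apply]

lemma l1_map_le {τ R S : Type*} [CommRing R] [CommRing S] (s : RingSeminorm R) (s' : RingSeminorm S) (g : R →+* S)
    (h : ∀ x, s' (g x) ≤ s x) (P : MvPolynomial τ R) : l1 s' (map g P) ≤ l1 s P := by
  rw [l1_eq_sum s' (map g P) P.support (support_map_subset _ _), l1]
  refine Finset.sum_le_sum fun α _ => ?_
  rw [coeff_map]; exact h _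

lemma aeval_diag {τ R : Type*} [Fintype τ] [CommRing R] (c : τ → R) (P : MvPolynomial τ R) (γ : τ →₀ ℕ) :
    coeff γ (aeval (fun s => C (c s) * X s : τ → MvPolynomial τ R) P) = coeff γ P * ∏ s, c s ^ γ s := by
  classical
  rw [aeval_def, eval₂_eq', coeff_sum]
  rw [Finset.sum_eq_single γ]
  · simp only [mul_pow, Finset.prod_mul_distrib]
    rw [algebraMap_eq, coeff_C_mul]
    simp only [← map_pow, ← map_prod]
    rw [coeff_C_mul]
    congr 1
    have : ∏ x, (X x : MvPolynomial τ R) ^ γ x = monomial γ 1 := by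
      rw [monomial_eq, Finsupp.prod_fintype _ _ (by simp)]; simp
    rw [this]; simp
  · intro β _ hβ
    simp only [mul_pow, Finset.prod_mul_distrib]
    rw [algebraMap_eq, coeff_C_mul]
    simp only [← map_pow, ← map_prod]
    rw [coeff_C_mul]
    have : ∏ x, (X x : MvPolynomial τ R) ^ β x = monomial β 1 := by
      rw [monomial_eq, Finsupp.prod_fintype _ _ (by simp)]; simp
    rw [this]; simp [hβ]
  · intro h
    rw [notMem_support_iff.1 h]; simp

lemma MH.aeval_smul {m : ℕ} {ι R τ : Type*} [Fintype ι] [CommRing R] {r : Fin m → ℕ} {P : MvPolynomial (Fin m × ι) R}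
    (hP : MH r P) (d : R) (f : Fin m × ι → MvPolynomial τ R) :
    aeval (fun x => C d * f x) P = C (d ^ ∑ h, r h) * aeval f P := by
  rw [aeval_def, eval₂_eq', aeval_def, eval₂_eq', Finset.mul_sum]
  refine Finset.sum_congr rfl fun α hα => ?_
  simp only [mul_pow, Finset.prod_mul_distrib]
  have : ∏ x : Fin m × ι, (C d : MvPolynomial τ R) ^ α x = C (d ^ ∑ h, r h) := by
    rw [Finset.prod_pow_eq_pow_sum, map_pow]
    congr 1
    rw [Fintype.sum_prod_type]
    exact Finset.sum_congr rfl fun h _ => hP α (mem_support_iff.1 hα) h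
  rw [this]; ring

lemma aeval_aeval' {σ τ υ R : Type*} [CommRing R] (f : σ → MvPolynomial τ R) (g : τ → MvPolynomial υ R) (P : MvPolynomial σ R) :
    aeval g (aeval f P) = aeval (fun s => aeval g (f s)) P := by
  have : (aeval g).comp (aeval f) = aeval (R := R) (fun s => aeval g (f s)) := by
    refine MvPolynomial.algHom_ext fun i => ?_
    rw [AlgHom.comp_apply, aeval_X, aeval_X]
  exact DFunLike.congr_fun this P

noncomputable def Gpol {m : ℕ} {ι κ : Type*} [Fintype ι] [Fintype κ] (z : Fin m → κ → ι → ℤ)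
    (P : MvPolynomial (Fin m × ι) ℤ) : MvPolynomial ((Fin m × κ) ⊕ (Fin m × ι)) ℤ :=
  aeval (fun x => ∑ j, C (z x.1 j x.2) * X (Sum.inl (x.1, j)) + X (Sum.inr x)) P

lemma shift_eq_Gpol {m : ℕ} {ι κ : Type*} [Fintype ι] [Fintype κ] (z : Fin m → κ → ι → ℤ)
    (P : MvPolynomial (Fin m × ι) ℤ) (t : Fin m → κ → ℚ) (y : Fin m × ι → ℚ)
    (hy : ∀ x, y x = ∑ j, t x.1 j * z x.1 j x.2) :
    shift y (map (Int.castRingHom ℚ) P) =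
      aeval (fun s => Sum.elim (fun p => C (t p.1 p.2)) (fun x => X x) s : (Fin m × κ) ⊕ (Fin m × ι) → MvPolynomial (Fin m × ι) ℚ)
        (map (Int.castRingHom ℚ) (Gpol z P)) := by
  rw [Gpol, map_aeval', aeval_aeval', shift]
  congr 2
  funext x
  rw [hy x]
  simp only [map_add, map_sum, map_mul, map_C, map_X, aeval_X, Sum.elim_inl, Sum.elim_inr, algHom_C, algebraMap_eq]
  rw [add_comm]
  congr 1
  refine Finset.sum_congr rfl fun j _ => ?_
  rw [mul_comm]; simp

lemma index_of_Gpol {m : ℕ} {ι κ : Type*} [Fintype ι] [Fintype κ] (z : Fin m → κ → ι → ℤ)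
    (P : MvPolynomial (Fin m × ι) ℤ) (r : Fin m → ℕ) (T : ℝ)
    (hG : IndGe (Sum.elim (fun _ => 0) (fun x => 1 / (r x.1 : ℝ)) : (Fin m × κ) ⊕ (Fin m × ι) → ℝ) T (Gpol z P))
    (y : Fin m × ι → ℚ) (hy : ∀ h, ∃ t : κ → ℚ, ∀ i, y (h, i) = ∑ j, t j * z h j i) :
    IndGe (fun x : Fin m × ι => 1 / (r x.1 : ℝ)) T (shift y (map (Int.castRingHom ℚ) P)) := by
  choose t ht using hy
  rw [shift_eq_Gpol z P t y (fun x => ht x.1 x.2)]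
  have hG' : IndGe (Sum.elim (fun _ => 0) (fun x => 1 / (r x.1 : ℝ)) : (Fin m × κ) ⊕ (Fin m × ι) → ℝ) T (map (Int.castRingHom ℚ) (Gpol z P)) := by
    intro α hα
    apply hG
    intro h
    rw [coeff_map, h] at hα; simp at hα
  refine hG'.aeval' _ fun s => ?_
  rcases s with p | x
  · exact IndGe.C' _
  · exact IndGe.X' (R := ℚ) (w := fun x : Fin m × ι => 1 / (r x.1 : ℝ)) x

theorem Gpol_coeff_bound {K : Type*} [Field K] [NumberField K] (σ : K →+* ℝ) {ι κ : Type*} [Fintype ι] [DecidableEq ι] [Fintype κ]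
    (L : ι → ι → K) (M : ι → ι → 𝓞 K) (d : ℕ) (hd : 1 ≤ d)
    (hML : ∀ i k, ∑ j, (M i j : K) * L j k = if i = k then (d : K) else 0) (a : ι → ℝ) (A : ℝ) (hA : ∀ i, -A ≤ a i) :
    ∃ C1 : ℝ, 1 ≤ C1 ∧ ∀ (m : ℕ) (r : Fin m → ℕ) (P : MvPolynomial (Fin m × ι) ℤ), MH r P →
      ∀ (Q : Fin m → ℝ), (∀ h, 1 ≤ Q h) → ∀ z : Fin m → κ → ι → ℤ,
      (∀ h i j, |∑ k, σ (L i k) * z h j k| ≤ Q h ^ a i) →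
      ∀ E : ℝ, (∀ J, (∀ h, ∑ i, J h i = r h) → coeff (fs J) (aeval (lsub M) (map (algebraMap ℤ (𝓞 K)) P)) ≠ 0 →
        ∑ h, ∑ i, a i * J h i * Real.log (Q h) ≤ E) →
      ∀ γ, coeff γ (Gpol z P) ≠ 0 →
        0 ≤ Real.log (l1 nZ P) + (∑ h, (r h : ℝ)) * C1 + E + A * ∑ h, ∑ i, γ (Sum.inr (h, i)) * Real.log (Q h) := by
  set C0 : ℝ := Fintype.card κ + ∑ i, ∑ k, |σ (L i k)| + 1 with hC0
  have hsum0 : 0 ≤ ∑ i, ∑ k, |σ (L i k)| := Finset.sum_nonneg fun _ _ => Finset.sum_nonneg fun _ _ => abs_nonneg _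
  have hC01 : 1 ≤ C0 := by
    rw [hC0]
    have : (0:ℝ) ≤ Fintype.card κ := by positivity
    linarith
  set B : ℝ := 1 + ∑ i, ∑ j, nK K (M i j) with hB
  have hB1 : 1 ≤ B := by
    rw [hB]
    have : 0 ≤ ∑ i, ∑ j, nK K (M i j) := Finset.sum_nonneg fun _ _ => Finset.sum_nonneg fun _ _ => apply_nonneg _ _
    linarith
  refine ⟨Real.log C0 + Real.log B + 1, by linarith [Real.log_nonneg hC01, Real.log_nonneg hB1], ?_⟩
  intro m r P hP Q hQ z hz E hE γ hγ
  have hQpos : ∀ h, 0 < Q h := fun h => by linarith [hQ h]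
  set S := ∑ h, r h with hS
  have hSr : (∑ h, (r h : ℝ)) = S := by rw [hS]; push_cast; rfl
  set lam : Fin m → ℝ := fun h => Q h ^ (-A) with hlam
  have hlampos : ∀ h, 0 < lam h := fun h => Real.rpow_pos_of_pos (hQpos h) _
  let f : Fin m × ι → MvPolynomial ((Fin m × κ) ⊕ (Fin m × ι)) ℝ := fun x =>
    ∑ j, C (z x.1 j x.2 : ℝ) * X (Sum.inl (x.1, j)) + C (lam x.1) * X (Sum.inr x)
  let el : Fin m × ι → MvPolynomial ((Fin m × κ) ⊕ (Fin m × ι)) ℝ := fun x => ∑ k, C (σ (L x.2 k)) * f (x.1, k)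
  let s' : 𝓞 K →+* ℝ := σ.comp (algebraMap (𝓞 K) K)
  set Ps := aeval (lsub M) (map (algebraMap ℤ (𝓞 K)) P) with hPs
  have hmapint : map (Int.castRingHom ℝ) P = map s' (map (algebraMap ℤ (𝓞 K)) P) := by
    have h1 : Int.castRingHom ℝ = s'.comp (algebraMap ℤ (𝓞 K)) := RingHom.ext_int _ _
    rw [map_map, h1]
  have hGs : aeval (fun s => C (Sum.elim (fun _ => 1) (fun x => lam x.1) s : ℝ) * X s : (Fin m × κ) ⊕ (Fin m × ι) → MvPolynomial ((Fin m × κ) ⊕ (Fin m × ι)) ℝ)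
      (map (Int.castRingHom ℝ) (Gpol z P)) = aeval f (map (Int.castRingHom ℝ) P) := by
    rw [Gpol, map_aeval', aeval_aeval']
    congr 2
    funext x
    simp only [map_add, map_sum, map_mul, map_C, map_X, aeval_X, Sum.elim_inl, Sum.elim_inr, algHom_C, algebraMap_eq, f]
    simp
  have hMHR : MH r (map (Int.castRingHom ℝ) P) := by
    intro α hα
    apply hP
    intro h
    rw [coeff_map, h] at hα; simp at hα
  have hMHK : MH r (map (algebraMap ℤ (𝓞 K)) P) := by
    intro α hα
    apply hP
    intro h
    rw [coeff_map, h] at hα; simp at hα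
  have hid : aeval el (map s' Ps) = C ((d:ℝ) ^ S) * aeval f (map (Int.castRingHom ℝ) P) := by
    rw [← hMHR.aeval_smul (d : ℝ) f, hPs, map_aeval', aeval_aeval', ← hmapint]
    congr 2
    funext x
    simp only [lsub, map_sum, map_mul, map_C, map_X, aeval_X, algHom_C, algebraMap_eq, el, Finset.mul_sum]
    rw [Finset.sum_comm]
    have : ∀ k ∈ Finset.univ, ∑ j, C (s' (M x.2 j)) * (C (σ (L j k)) * f (x.1, k)) = if x.2 = k then C (d : ℝ) * f (x.1, k) else 0 := by
      intro k _
      simp only [← mul_assoc, ← C_mul]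
      rw [← Finset.sum_mul, ← map_sum]
      have h1 : ∑ j, s' (M x.2 j) * σ (L j k) = σ (if x.2 = k then (d : K) else 0) := by
        rw [← hML, map_sum]; simp [s']
      rw [h1]
      split_ifs <;> simp
    rw [Finset.sum_congr rfl this]
    simp
  have hell1 : ∀ x : Fin m × ι, l1 nR (el x) ≤ C0 * Q x.1 ^ a x.2 := by
    rintro ⟨h, i⟩
    have hel : el (h, i) = ∑ j, C (∑ k, σ (L i k) * z h j k) * X (Sum.inl (h, j)) + ∑ k, C (σ (L i k) * lam h) * X (Sum.inr (h, k)) := by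
      simp only [el, f, mul_add, Finset.sum_add_distrib, Finset.mul_sum]
      congr 1
      · rw [Finset.sum_comm]
        refine Finset.sum_congr rfl fun j _ => ?_
        rw [map_sum, Finset.sum_mul]
        refine Finset.sum_congr rfl fun k _ => ?_
        rw [C_mul]; ring
      · refine Finset.sum_congr rfl fun k _ => ?_
        rw [C_mul]; ring
    rw [hel]
    refine (l1_add_le _ _ _).trans ?_
    have hterm : ∀ (c : ℝ) (s : (Fin m × κ) ⊕ (Fin m × ι)), l1 nR (C c * X s : MvPolynomial ((Fin m × κ) ⊕ (Fin m × ι)) ℝ) ≤ |c| := by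
      intro c s
      refine (l1_mul_le _ _ _).trans ?_
      rw [l1_C, l1_X]
      exact mul_le_of_le_one_right (apply_nonneg _ _) nR_one
    have h1 : l1 nR (∑ j, C (∑ k, σ (L i k) * z h j k) * X (Sum.inl (h, j)) : MvPolynomial ((Fin m × κ) ⊕ (Fin m × ι)) ℝ) ≤ Fintype.card κ * Q h ^ a i := by
      refine (l1_sum_le _ _ _).trans ?_
      refine (Finset.sum_le_sum fun j _ => (hterm _ _).trans (hz h i j)).trans ?_
      simp
    have h2 : l1 nR (∑ k, C (σ (L i k) * lam h) * X (Sum.inr (h, k)) : MvPolynomial ((Fin m × κ) ⊕ (Fin m × ι)) ℝ) ≤ (∑ i, ∑ k, |σ (L i k)|) * Q h ^ a i := by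
      refine (l1_sum_le _ _ _).trans ?_
      refine (Finset.sum_le_sum fun j _ => hterm _ _).trans ?_
      have hl : lam h ≤ Q h ^ a i := Real.rpow_le_rpow_of_exponent_le (hQ h) (hA i)
      simp only [abs_mul, abs_of_pos (hlampos h)]
      rw [← Finset.sum_mul]
      have := Finset.single_le_sum (f := fun i => ∑ k, |σ (L i k)|) (fun _ _ => Finset.sum_nonneg fun _ _ => abs_nonneg _) (Finset.mem_univ i)
      exact mul_le_mul this hl (hlampos h).le hsum0
    refine (add_le_add h1 h2).trans ?_
    simp only
    have := (Real.rpow_pos_of_pos (hQpos h) (a i)).le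
    rw [hC0]; nlinarith
  have hbound : l1 nR (aeval el (map s' Ps)) ≤ l1 nR (map s' Ps) * (C0 ^ S * Real.exp E) := by
    refine l1_aeval_le _ nR_one _ _ _ ?_
    intro α hα
    have hα' : coeff α Ps ≠ 0 := by
      intro h
      rw [mem_support_iff, coeff_map, h] at hα; simp at hα
    have hαMH : ∀ h, ∑ i, α (h, i) = r h := by
      have := hMHK.lsub M
      exact this α hα'
    have hE' := hE (fun h i => α (h, i)) hαMH (by rw [fs_curry]; exact hα')
    refine (Finset.prod_le_prod (fun _ _ => pow_nonneg (l1_nonneg _ _) _) fun x _ => pow_le_pow_left₀ (l1_nonneg _ _) (hell1 x) _).trans ?_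
    rw [Finset.prod_subset (Finset.subset_univ α.support) (fun x _ hx => by simp [Finsupp.notMem_support_iff.1 hx])]
    simp only [mul_pow, Finset.prod_mul_distrib]
    rw [MH.support_prod α r (fun _ => C0) hαMH, Finset.prod_pow_eq_pow_sum]
    refine mul_le_mul_of_nonneg_left ?_ (by positivity)
    refine le_trans (le_of_eq ?_) (Real.exp_le_exp.2 hE')
    rw [Real.exp_sum, Fintype.prod_prod_type]
    refine Finset.prod_congr rfl fun h _ => ?_
    rw [Real.exp_sum]
    refine Finset.prod_congr rfl fun i _ => ?_
    rw [← Real.rpow_natCast, ← Real.rpow_mul (hQpos h).le, Real.rpow_def_of_pos (hQpos h), mul_comm]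
  have hPsl1 : l1 nR (map s' Ps) ≤ l1 nZ P * B ^ S := by
    refine (l1_map_le (nK K) nR s' (fun x => ?_) _).trans ?_
    · rw [nR_apply, nK_apply]
      have := norm_embedding_le_house (x : K) (Complex.ofRealHom.comp σ)
      simpa [s'] using this
    · refine (l1_aeval_le _ (nK_one K) _ _ (B ^ S) ?_).trans ?_
      · intro α hα
        rw [hS, ← Finset.prod_pow_eq_pow_sum, ← MH.support_prod α r (fun _ => B) (hMHK α (mem_support_iff.1 hα))]
        rw [← Finset.prod_subset (Finset.subset_univ α.support) (fun x _ hx => by simp [Finsupp.notMem_support_iff.1 hx])]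
        refine Finset.prod_le_prod (fun _ _ => pow_nonneg (l1_nonneg _ _) _) fun x _ => pow_le_pow_left₀ (l1_nonneg _ _) ?_ _
        refine (l1_sum_le _ _ _).trans ?_
        have : ∀ j ∈ Finset.univ, l1 (nK K) (C (M x.2 j) * X (x.1, j) : MvPolynomial (Fin m × ι) (𝓞 K)) ≤ nK K (M x.2 j) := by
          intro j _
          refine (l1_mul_le _ _ _).trans ?_
          rw [l1_C, l1_X]
          exact mul_le_of_le_one_right (apply_nonneg _ _) (nK_one K)
        refine (Finset.sum_le_sum this).trans ?_
        have h2 := Finset.single_le_sum (f := fun i => ∑ j, nK K (M i j)) (fun _ _ => Finset.sum_nonneg fun _ _ => apply_nonneg _ _) (Finset.mem_univ x.2)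
        rw [hB]; linarith
      · refine mul_le_mul_of_nonneg_right ?_ (by positivity)
        refine l1_map_le nZ (nK K) _ (fun x => ?_) _
        rw [nZ_apply]
        exact (nK_int (K := K) x).le
  have hcoef := coeff_le_l1 nR (aeval el (map s' Ps)) γ
  rw [hid, coeff_C_mul, ← hGs, aeval_diag, hGs, ← hid, coeff_map, nR_apply] at hcoef
  have hg1 : (1:ℝ) ≤ |((coeff γ (Gpol z P) : ℤ) : ℝ)| := by exact_mod_cast Int.one_le_abs hγ
  have hdS : (1:ℝ) ≤ (d:ℝ) ^ S := one_le_pow₀ (by exact_mod_cast hd)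
  have hprod : ∏ s : (Fin m × κ) ⊕ (Fin m × ι), (Sum.elim (fun _ => 1) (fun x => lam x.1) s : ℝ) ^ γ s = Real.exp (-(A * ∑ h, ∑ i, γ (Sum.inr (h, i)) * Real.log (Q h))) := by
    rw [Fintype.prod_sum_type]
    simp only [Sum.elim_inl, Sum.elim_inr, one_pow, Finset.prod_const_one, one_mul]
    rw [← neg_mul, Finset.mul_sum, Real.exp_sum, Fintype.prod_prod_type]
    refine Finset.prod_congr rfl fun h _ => ?_
    rw [Finset.mul_sum, Real.exp_sum]
    refine Finset.prod_congr rfl fun i _ => ?_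
    rw [hlam]
    simp only
    rw [← Real.rpow_natCast, ← Real.rpow_mul (hQpos h).le, Real.rpow_def_of_pos (hQpos h)]
    congr 1; ring
  rw [hprod, abs_mul, abs_mul, abs_of_pos (Real.exp_pos _), abs_of_pos (by positivity : (0:ℝ) < (d:ℝ) ^ S)] at hcoef
  have hP0 : P ≠ 0 := by
    rintro rfl
    apply hγ
    rw [Gpol, map_zero, coeff_zero]
  have hlP := one_le_l1_of_ne_zero P hP0
  have h5 : Real.exp (-(A * ∑ h, ∑ i, γ (Sum.inr (h, i)) * Real.log (Q h))) ≤ l1 nZ P * B ^ S * (C0 ^ S * Real.exp E) := by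
    refine le_trans ?_ ((hcoef.trans hbound).trans (mul_le_mul_of_nonneg_right hPsl1 (by positivity)))
    have : (1:ℝ) ≤ (d:ℝ) ^ S * |((Int.castRingHom ℝ) (coeff γ (Gpol z P)))| := by
      simp only [eq_intCast]
      nlinarith
    rw [← mul_assoc]
    exact le_mul_of_one_le_left (Real.exp_pos _).le this
  have h6 := Real.log_le_log (Real.exp_pos _) h5
  rw [Real.log_exp, Real.log_mul (by positivity) (by positivity), Real.log_mul (by positivity) (by positivity),
    Real.log_mul (by positivity) (by positivity), Real.log_exp, Real.log_pow, Real.log_pow] at h6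
  rw [hSr]
  have : (0:ℝ) ≤ S := by positivity
  nlinarith

end Schmidt

end PartD3

section PartD4
open MvPolynomial NumberField Filter

namespace Schmidt

lemma exists_integral_inv {K : Type*} [Field K] [NumberField K] {ι : Type*} [Fintype ι] [DecidableEq ι]
    (L : ι → ι → K) (hdet : (Matrix.of L).det ≠ 0) :
    ∃ (M : ι → ι → 𝓞 K) (d : ℕ), 1 ≤ d ∧ ∀ i k, ∑ j, (M i j : K) * L j k = if i = k then (d : K) else 0 := by
  classical
  have hIn : ∀ x : K, ∃ d : ℕ, 1 ≤ d ∧ ∀ e : ℕ, d ∣ e → IsIntegral ℤ ((e : K) * x) := by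
    intro x
    obtain ⟨y, hy0, hy⟩ := IsAlgebraic.exists_integral_multiple (show IsAlgebraic ℤ x from
      (IsFractionRing.isAlgebraic_iff ℤ ℚ K).2 (Algebra.IsAlgebraic.isAlgebraic x))
    refine ⟨y.natAbs, Int.natAbs_pos.2 hy0, fun e he => ?_⟩
    obtain ⟨c, hc⟩ := Int.natAbs_dvd.1 (Int.natCast_dvd_natCast.2 he)
    have : ((e : K) * x) = (c : K) * (y • x) := by
      have h1 : (e : K) = ((e : ℤ) : K) := by simp
      rw [h1, hc, zsmul_eq_mul]; push_cast; ring
    rw [this]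
    exact (isIntegral_algebraMap (R := ℤ) (x := c)).mul hy
  choose g hg1 hg using hIn
  set Mi := (Matrix.of L)⁻¹ with hMi
  set d := ∏ i, ∏ j, g (Mi i j) with hd
  have hdvd : ∀ i j, g (Mi i j) ∣ d := fun i j =>
    (Finset.dvd_prod_of_mem (fun j => g (Mi i j)) (Finset.mem_univ j)).trans
      (Finset.dvd_prod_of_mem (fun i => ∏ j, g (Mi i j)) (Finset.mem_univ i))
  refine ⟨fun i j => ⟨(d : K) * Mi i j, hg _ _ (hdvd i j)⟩, d, ?_, ?_⟩
  · exact Finset.one_le_prod' fun i _ => Finset.one_le_prod' fun j _ => hg1 _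
  · intro i k
    have h1 : Mi * Matrix.of L = 1 := Matrix.nonsing_inv_mul _ (isUnit_iff_ne_zero.2 hdet)
    have h2 := congrFun (congrFun h1 i) k
    rw [Matrix.mul_apply, Matrix.one_apply] at h2
    simp only [Matrix.of_apply] at h2
    have : ∑ j, ((d : K) * Mi i j) * L j k = (d : K) * ∑ j, Mi i j * L j k := by
      rw [Finset.mul_sum]; exact Finset.sum_congr rfl fun j _ => by ring
    change ∑ j, ((d : K) * Mi i j) * L j k = _
    rw [this, h2]; simp

lemma exists_fast_seq {p : ℝ → Prop} (hp : ∃ᶠ Q in atTop, p Q) (l c : ℝ) (hl : 1 ≤ l) (hc : 1 ≤ c) (m : ℕ) :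
    ∃ Q : Fin m → ℝ, (∀ h, p (Q h)) ∧ (∀ h, 1 ≤ Q h) ∧ (∀ h, l ≤ Real.log (Q h)) ∧ ∀ h k, h < k → c * Real.log (Q k) ≤ Real.log (Q h) := by
  rw [frequently_atTop] at hp
  choose g hg1 hg2 using hp
  let q : ℕ → ℝ := fun n => Nat.rec (g (Real.exp l)) (fun _ x => g (Real.exp (c * Real.log x))) n
  have hq0 : q 0 = g (Real.exp l) := rfl
  have hqs : ∀ n, q (n + 1) = g (Real.exp (c * Real.log (q n))) := fun n => rfl
  have hstep : ∀ n, c * Real.log (q n) ≤ Real.log (q (n + 1)) := by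
    intro n
    rw [hqs, Real.le_log_iff_exp_le]
    · exact hg1 _
    · exact lt_of_lt_of_le (Real.exp_pos _) (hg1 _)
  have hl' : ∀ n, l ≤ Real.log (q n) := by
    intro n
    induction n with
    | zero =>
      rw [hq0, Real.le_log_iff_exp_le]
      · exact hg1 _
      · exact lt_of_lt_of_le (Real.exp_pos _) (hg1 _)
    | succ n ih => refine le_trans ?_ (hstep n); nlinarith
  have hmono : ∀ n k, c * Real.log (q n) ≤ Real.log (q (n + 1 + k)) := by
    intro n k
    induction k with
    | zero => exact hstep n
    | succ k ih =>
      refine ih.trans ?_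
      have := hstep (n + 1 + k)
      have h2 := hl' (n + 1 + k)
      rw [← add_assoc]
      nlinarith
  have hpq : ∀ n, p (q n) := by
    intro n
    cases n with
    | zero => exact hg2 _
    | succ n => exact hg2 _
  have hpos : ∀ n, 1 ≤ q n := by
    intro n
    have h0 : 0 < q n := by
      cases n with
      | zero => exact lt_of_lt_of_le (Real.exp_pos _) (hg1 _)
      | succ n => exact lt_of_lt_of_le (Real.exp_pos _) (hg1 _)
    by_contra h
    push Not at h
    have := Real.log_neg h0 h
    linarith [hl' n]
  refine ⟨fun h => q (m - 1 - h), fun h => hpq _, fun h => hpos _, fun h => hl' _, fun h k hk => ?_⟩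
  have h1 : (h : ℕ) < k := hk
  have h2 := k.2
  obtain ⟨e, he⟩ : ∃ e, m - 1 - (h : ℕ) = (m - 1 - k) + 1 + e := ⟨k - h - 1, by omega⟩
  simp only
  rw [he]
  exact hmono _ _

theorem no_large_normals {K : Type*} [Field K] [NumberField K] (σ : K →+* ℝ) {ι κ : Type*} [Fintype ι] [DecidableEq ι] [Nonempty ι]
    [Fintype κ] (L : ι → ι → K) (hdet : (Matrix.of L).det ≠ 0) (a : ι → ℝ) (ha : ∑ i, a i < 0) (η : ℝ) (hη : 0 < η) :
    ¬ ∃ᶠ Q : ℝ in atTop, ∃ z : κ → ι → ℤ, (∀ i j, |∑ k, σ (L i k) * z j k| ≤ Q ^ a i) ∧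
      ∃ (n : ι → ℤ) (s0 : ι), (∀ d : ℤ, (∀ i, d ∣ n i) → IsUnit d) ∧ (∀ i, |n i| ≤ |n s0|) ∧ Q ^ η ≤ |(n s0 : ℝ)| ∧
        ∀ y : ι → ℚ, ∑ i, (n i : ℚ) * y i = 0 → ∃ t : κ → ℚ, ∀ i, y i = ∑ j, t j * z j i := by
  intro hfreq
  obtain ⟨M, d, hd, hML⟩ := exists_integral_inv L hdet
  obtain ⟨Cst, hCst1, haux⟩ := aux_poly K ι M
  set N := Fintype.card ι with hN
  have hNpos : (0:ℝ) < N := by exact_mod_cast Fintype.card_pos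
  set A : ℝ := 1 + ∑ i, |a i| with hA
  have hAi : ∀ i, |a i| ≤ ∑ i, |a i| := fun i => Finset.single_le_sum (f := fun i => |a i|) (fun _ _ => abs_nonneg _) (Finset.mem_univ i)
  have hA1 : 1 ≤ A := by
    have : 0 ≤ ∑ i, |a i| := Finset.sum_nonneg fun _ _ => abs_nonneg _
    rw [hA]; linarith
  obtain ⟨C1, hC11, hGb⟩ := Gpol_coeff_bound (κ := κ) σ L M d hd hML a A (fun i => by
    have := neg_abs_le (a i); have := hAi i; rw [hA]; linarith)
  set δ := -∑ i, a i with hδ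
  have hδpos : 0 < δ := by rw [hδ]; linarith
  set ε := min 1 (δ / (8 * A * N)) with hε
  have hεpos : 0 < ε := lt_min one_pos (by positivity)
  have hε1 : ε ≤ 1 := min_le_left _ _
  have hε2 : 2 * A * ε ≤ δ / (4 * N) := by
    have : ε ≤ δ / (8 * A * N) := min_le_right _ _
    calc 2 * A * ε ≤ 2 * A * (δ / (8 * A * N)) := by gcongr
      _ = δ / (4 * N) := by field_simp; ring
  obtain ⟨m, hm1, hm⟩ : ∃ m : ℕ, 1 ≤ m ∧ 2 * (N:ℝ) * Module.finrank ℚ K ≤ m * ε ^ 2 := by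
    refine ⟨⌈2 * (N:ℝ) * Module.finrank ℚ K / ε ^ 2⌉₊ + 1, by omega, ?_⟩
    have := Nat.le_ceil (2 * (N:ℝ) * Module.finrank ℚ K / ε ^ 2)
    rw [div_le_iff₀ (by positivity)] at this
    push_cast
    nlinarith [sq_nonneg ε]
  have hmpos : (0:ℝ) < m := by exact_mod_cast hm1
  set T : ℝ := m * δ / (4 * A * N) with hT
  have hTpos : 0 < T := by positivity
  obtain ⟨ω, hω, hω1, hroth⟩ := roth_general m ι (T / 2) (by positivity)
  have hlC : 0 ≤ Real.log Cst := Real.log_nonneg hCst1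
  set l : ℝ := 1 + 8 * N * (Real.log Cst + C1) / δ + 2 * m * (Real.log Cst + 1) / (ω * η) with hl
  have hlA : 8 * N * (Real.log Cst + C1) / δ ≤ l := by
    have : 0 ≤ 2 * m * (Real.log Cst + 1) / (ω * η) := by positivity
    rw [hl]; linarith
  have hlB : 2 * m * (Real.log Cst + 1) / (ω * η) ≤ l := by
    have : 0 ≤ 8 * N * (Real.log Cst + C1) / δ := by positivity
    rw [hl]; linarith
  have hl1 : 1 ≤ l := by
    have : 0 ≤ 2 * m * (Real.log Cst + 1) / (ω * η) := by positivity
    have : 0 ≤ 8 * N * (Real.log Cst + C1) / δ := by positivity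
    rw [hl]; linarith
  obtain ⟨Q, hQp, hQ1, hQl, hQfast⟩ := exists_fast_seq hfreq l (2 / ω) hl1 (by rw [le_div_iff₀ hω]; linarith) m
  choose z hz n s0 hprim hs0 hnbig hspan using hQp
  have hlogpos : ∀ h, 0 < Real.log (Q h) := fun h => by linarith [hQl h]
  have hQpos : ∀ h, 0 < Q h := fun h => by linarith [hQ1 h]
  set R : ℝ := ∑ h, Real.log (Q h) / ε + 1 with hR
  have hRh : ∀ h, Real.log (Q h) ≤ ε * R := by
    intro h
    have := Finset.single_le_sum (f := fun h => Real.log (Q h) / ε) (fun h _ => (div_pos (hlogpos h) hεpos).le) (Finset.mem_univ h)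
    have h2 : Real.log (Q h) / ε ≤ R := by rw [hR]; linarith
    rw [div_le_iff₀ hεpos] at h2; linarith
  have hRpos : 0 < R := by
    have : 0 ≤ ∑ h, Real.log (Q h) / ε := Finset.sum_nonneg fun h _ => (div_pos (hlogpos h) hεpos).le
    rw [hR]; linarith
  set r : Fin m → ℕ := fun h => ⌈R / Real.log (Q h)⌉₊ with hr
  have hr1 : ∀ h, 1 ≤ r h := fun h => Nat.one_le_iff_ne_zero.2 (Nat.pos_iff_ne_zero.1 (Nat.ceil_pos.2 (div_pos hRpos (hlogpos h))))
  have hrpos : ∀ h, (0:ℝ) < r h := fun h => by exact_mod_cast hr1 h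
  have hrlow : ∀ h, R ≤ r h * Real.log (Q h) := by
    intro h
    have := Nat.le_ceil (R / Real.log (Q h))
    rwa [div_le_iff₀ (hlogpos h)] at this
  have hrup : ∀ h, r h * Real.log (Q h) ≤ R * (1 + ε) := by
    intro h
    have := (Nat.ceil_lt_add_one (div_pos hRpos (hlogpos h)).le).le
    have h2 := mul_le_mul_of_nonneg_right this (hlogpos h).le
    rw [add_mul, div_mul_cancel₀ _ (hlogpos h).ne'] at h2
    have := hRh h
    change r h * Real.log (Q h) ≤ _ at h2
    linarith
  have hrup2 : ∀ h, r h * Real.log (Q h) ≤ 2 * R := fun h => (hrup h).trans (by nlinarith)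
  have hS : l * ∑ h, (r h : ℝ) ≤ 2 * m * R := by
    rw [Finset.mul_sum]
    refine (Finset.sum_le_sum (g := fun _ => 2 * R) fun h _ => ?_).trans ?_
    · refine le_trans ?_ (hrup2 h)
      rw [mul_comm]
      exact mul_le_mul_of_nonneg_left (hQl h) (hrpos h).le
    · simp; linarith
  have hS0 : 0 ≤ ∑ h, (r h : ℝ) := Finset.sum_nonneg fun h _ => (hrpos h).le
  obtain ⟨P, hP0, hPMH, hPl1, hPbal⟩ := haux ε hεpos m hm r hr1
  have hlogP : Real.log (l1 nZ P) ≤ (∑ h, (r h : ℝ)) * Real.log Cst := by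
    refine (Real.log_le_log (by linarith [one_le_l1_of_ne_zero P hP0]) hPl1).trans ?_
    rw [Real.log_pow]; push_cast; exact le_rfl
  obtain ⟨y, hy, α, hα, hαT⟩ := hroth r n s0 hr1 hprim hs0 (by
      intro h k hk
      have h1 := hQfast h k hk
      have h2 := hrup2 h
      have h3 := hrlow k
      have hk0 := hlogpos k
      rw [div_mul_eq_mul_div, div_le_iff₀ hω] at h1
      have h4 : (r h : ℝ) * (2 * Real.log (Q k)) ≤ (2 * R) * ω := by
        calc (r h : ℝ) * (2 * Real.log (Q k)) ≤ r h * (Real.log (Q h) * ω) := mul_le_mul_of_nonneg_left h1 (hrpos h).le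
          _ = (r h * Real.log (Q h)) * ω := by ring
          _ ≤ _ := mul_le_mul_of_nonneg_right h2 hω.le
      have h5 : (r h : ℝ) * Real.log (Q k) ≤ (ω * r k) * Real.log (Q k) := by nlinarith
      exact le_of_mul_le_mul_right h5 hk0) P hP0 (fun α hα h => (hPMH α hα h).le) (by
      intro h
      have h1 : (∑ h, (r h : ℝ)) * (Real.log Cst + 1) ≤ ω * η * R := by
        rw [div_le_iff₀ (by positivity)] at hlB
        have h2 : (∑ h, (r h : ℝ)) * (2 * m * (Real.log Cst + 1)) ≤ (∑ h, (r h : ℝ)) * (l * (ω * η)) :=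
          mul_le_mul_of_nonneg_left hlB hS0
        have h3 : (l * ∑ h, (r h : ℝ)) * (ω * η) ≤ 2 * m * R * (ω * η) := mul_le_mul_of_nonneg_right hS (by positivity)
        have h4 : (2 * m) * ((∑ h, (r h : ℝ)) * (Real.log Cst + 1)) ≤ (2 * m) * (ω * η * R) := by linarith
        exact le_of_mul_le_mul_left h4 (by positivity)
      have h2 : η * Real.log (Q h) ≤ Real.log |(n h (s0 h) : ℝ)| := by
        rw [← Real.log_rpow (hQpos h)]
        exact Real.log_le_log (Real.rpow_pos_of_pos (hQpos h) _) (hnbig h)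
      have h3 : ω * r h * (η * Real.log (Q h)) ≤ ω * r h * Real.log |(n h (s0 h) : ℝ)| :=
        mul_le_mul_of_nonneg_left h2 (mul_pos hω (hrpos h)).le
      have h4 : ω * η * R ≤ ω * η * (r h * Real.log (Q h)) := mul_le_mul_of_nonneg_left (hrlow h) (by positivity)
      linarith)
  have hG : IndGe (Sum.elim (fun _ => 0) (fun x => 1 / (r x.1 : ℝ)) : (Fin m × κ) ⊕ (Fin m × ι) → ℝ) T (Gpol z P) := by
    intro γ hγ
    have hb := hGb m r P hPMH Q hQ1 z (fun h i j => hz h i j) (-(3 / 4 * (δ * R * m / N))) (by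
      intro J hJ hJc
      have hbal := hPbal J hJc
      rw [Unbal] at hbal
      push Not at hbal
      have hi : ∀ i, |∑ h, (J h i : ℝ) * Real.log (Q h) - R * (m / N)| ≤ 2 * m * ε * R := by
        intro i
        have e1 : ∑ h, (J h i : ℝ) * Real.log (Q h) = R * ∑ h, (J h i : ℝ) / r h + ∑ h, (J h i : ℝ) / r h * (r h * Real.log (Q h) - R) := by
          rw [Finset.mul_sum, ← Finset.sum_add_distrib]
          refine Finset.sum_congr rfl fun h _ => ?_
          have := (hrpos h).ne'
          field_simp; ring
        have hx1 : ∀ h, (J h i : ℝ) / r h ≤ 1 := by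
          intro h
          rw [div_le_one (hrpos h), ← hJ h]
          exact_mod_cast Finset.single_le_sum (f := J h) (fun _ _ => Nat.zero_le _) (Finset.mem_univ i)
        have hx0 : ∀ h, 0 ≤ (J h i : ℝ) / r h := fun h => by positivity
        have e2 : 0 ≤ ∑ h, (J h i : ℝ) / r h * (r h * Real.log (Q h) - R) :=
          Finset.sum_nonneg fun h _ => mul_nonneg (hx0 h) (by linarith [hrlow h])
        have e3 : ∑ h, (J h i : ℝ) / r h * (r h * Real.log (Q h) - R) ≤ m * (ε * R) := by
          refine (Finset.sum_le_sum (g := fun _ => ε * R) fun h _ => ?_).trans (by simp)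
          have h1 : r h * Real.log (Q h) - R ≤ ε * R := by linarith [hrup h]
          have h0 : 0 ≤ r h * Real.log (Q h) - R := by linarith [hrlow h]
          calc _ ≤ 1 * (r h * Real.log (Q h) - R) := mul_le_mul_of_nonneg_right (hx1 h) h0
            _ ≤ _ := by linarith
        have e4 := abs_le.1 (hbal i)
        rw [e1, abs_le]
        have e5 : R * (∑ h, (J h i : ℝ) / r h - m / N) ≤ R * (m * ε) := mul_le_mul_of_nonneg_left e4.2 hRpos.le
        have e6 : R * (-(m * ε)) ≤ R * (∑ h, (J h i : ℝ) / r h - m / N) := mul_le_mul_of_nonneg_left e4.1 hRpos.le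
        have e7 : 0 ≤ m * (ε * R) := by positivity
        constructor <;> linarith
      rw [Finset.sum_comm]
      have e1 : ∑ i, ∑ h, a i * (J h i : ℝ) * Real.log (Q h) = R * (m / N) * (-δ) + ∑ i, a i * (∑ h, (J h i : ℝ) * Real.log (Q h) - R * (m / N)) := by
        rw [hδ, neg_neg, Finset.mul_sum, ← Finset.sum_add_distrib]
        refine Finset.sum_congr rfl fun i _ => ?_
        have : ∑ h, a i * (J h i : ℝ) * Real.log (Q h) = a i * ∑ h, (J h i : ℝ) * Real.log (Q h) := by
          rw [Finset.mul_sum]; exact Finset.sum_congr rfl fun h _ => by ring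
        rw [this]; ring
      have e2 : ∑ i, a i * (∑ h, (J h i : ℝ) * Real.log (Q h) - R * (m / N)) ≤ (∑ i, |a i|) * (2 * m * ε * R) := by
        rw [Finset.sum_mul]
        refine Finset.sum_le_sum fun i _ => (le_abs_self _).trans ?_
        rw [abs_mul]
        exact mul_le_mul_of_nonneg_left (hi i) (abs_nonneg _)
      have e3 : (∑ i, |a i|) * (2 * m * ε * R) ≤ A * (2 * m * ε * R) := mul_le_mul_of_nonneg_right (by rw [hA]; linarith) (by positivity)
      have e4 : A * (2 * m * ε * R) = (2 * A * ε) * (m * R) := by ring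
      have e5 : (2 * A * ε) * (m * R) ≤ δ / (4 * N) * (m * R) := mul_le_mul_of_nonneg_right hε2 (by positivity)
      have e6 : δ / (4 * N) * (m * R) = 1 / 4 * (δ * R * m / N) := by field_simp
      have e7 : R * (m / N) * (-δ) = -(δ * R * m / N) := by field_simp
      rw [e1, e7]
      linarith) γ hγ
    have hwt : wt (Sum.elim (fun _ => 0) (fun x => 1 / (r x.1 : ℝ)) : (Fin m × κ) ⊕ (Fin m × ι) → ℝ) γ = ∑ h, ∑ i, (γ (Sum.inr (h, i)) : ℝ) / r h := by
      rw [wt, Fintype.sum_sum_type, Fintype.sum_prod_type (f := fun x : Fin m × ι => _)]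
      simp [div_eq_inv_mul]
    rw [hwt]
    have h1 : ∑ h, ∑ i, (γ (Sum.inr (h, i)) : ℝ) * Real.log (Q h) ≤ 2 * R * ∑ h, ∑ i, (γ (Sum.inr (h, i)) : ℝ) / r h := by
      rw [Finset.mul_sum]
      refine Finset.sum_le_sum fun h _ => ?_
      rw [Finset.mul_sum]
      refine Finset.sum_le_sum fun i _ => ?_
      rw [mul_div_assoc', le_div_iff₀ (hrpos h)]
      have := mul_le_mul_of_nonneg_left (hrup2 h) (Nat.cast_nonneg (α := ℝ) (γ (Sum.inr (h, i))))
      linarith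
    have h2 : A * ∑ h, ∑ i, (γ (Sum.inr (h, i)) : ℝ) * Real.log (Q h) ≤ A * (2 * R * ∑ h, ∑ i, (γ (Sum.inr (h, i)) : ℝ) / r h) :=
      mul_le_mul_of_nonneg_left h1 (by linarith)
    have h3 : (∑ h, (r h : ℝ)) * (Real.log Cst + C1) ≤ 1 / 4 * (δ * R * m / N) := by
      rw [div_le_iff₀ hδpos] at hlA
      have h4 : (∑ h, (r h : ℝ)) * (8 * N * (Real.log Cst + C1)) ≤ (∑ h, (r h : ℝ)) * (l * δ) := mul_le_mul_of_nonneg_left hlA hS0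
      have h5 : (l * ∑ h, (r h : ℝ)) * δ ≤ 2 * m * R * δ := mul_le_mul_of_nonneg_right hS hδpos.le
      have h6 : (∑ h, (r h : ℝ)) * (Real.log Cst + C1) * (8 * N) ≤ 2 * (δ * R * m) := by linarith
      rw [← le_div_iff₀ (by positivity)] at h6
      refine h6.trans (le_of_eq ?_)
      field_simp; norm_num
    have h4 : 1 / 2 * (δ * R * m / N) ≤ A * (2 * R * ∑ h, ∑ i, (γ (Sum.inr (h, i)) : ℝ) / r h) := by linarith
    have h5 : 1 / 2 * (δ * R * m / N) = (2 * A * R) * T := by rw [hT]; field_simp; norm_num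
    rw [h5] at h4
    have h6 : (2 * A * R) * T ≤ (2 * A * R) * ∑ h, ∑ i, (γ (Sum.inr (h, i)) : ℝ) / r h := by linarith
    exact le_of_mul_le_mul_left h6 (by positivity)
  have hfin := index_of_Gpol z P r T hG y (fun h => hspan h (fun i => y (h, i)) (hy h)) α hα
  rw [wt] at hfin
  simp only [one_div_mul_eq_div] at hfin
  linarith

end Schmidt

end PartD4

section PartC1
open NumberField Filter

namespace Schmidt

def crossMat {ι κ R : Type*} (e : Option κ ≃ ι) (z : κ → ι → R) (x : ι → R) : Matrix (Option κ) (Option κ) R :=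
  Matrix.of fun o o' => (o.elim x z : ι → R) (e o')

noncomputable def crossDet {ι κ R : Type*} [Fintype κ] [DecidableEq κ] [CommRing R] (e : Option κ ≃ ι) (z : κ → ι → R) (x : ι → R) : R :=
  (crossMat e z x).det

lemma crossDet_eq {ι κ R : Type*} [Fintype κ] [DecidableEq κ] [Fintype ι] [DecidableEq ι] [CommRing R] (e : Option κ ≃ ι) (z : κ → ι → R) (x : ι → R) :
    crossDet e z x = ∑ i, crossDet e z (Pi.single i 1) * x i := by
  have hupd : ∀ x, crossMat e z x = (crossMat e z 0).updateRow none (fun o' => x (e o')) := by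
    intro x
    ext o o'
    cases o with
    | none => simp [crossMat]
    | some j => simp [crossMat]
  let F : (ι → R) →ₗ[R] R :=
    { toFun := fun x => crossDet e z x
      map_add' := by
        intro x y
        rw [crossDet, crossDet, crossDet, hupd (x + y), hupd x, hupd y]
        exact Matrix.det_updateRow_add _ _ _ _
      map_smul' := by
        intro c x
        rw [crossDet, crossDet, hupd (c • x), hupd x]
        exact Matrix.det_updateRow_smul _ _ _ _ }
  have h1 : x = ∑ i, x i • (Pi.single i 1 : ι → R) := by
    funext k; simp [Finset.sum_apply, Pi.single_apply]
  have h2 : F x = ∑ i, x i • F (Pi.single i 1) := by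
    conv_lhs => rw [h1]
    rw [map_sum]; simp only [map_smul]
  change F x = ∑ i, F (Pi.single i 1) * x i
  rw [h2]
  exact Finset.sum_congr rfl fun i _ => by rw [smul_eq_mul, mul_comm]

lemma crossDet_self {ι κ R : Type*} [Fintype κ] [DecidableEq κ] [CommRing R] (e : Option κ ≃ ι) (z : κ → ι → R) (j : κ) :
    crossDet e z (z j) = 0 := by
  rw [crossDet]
  refine Matrix.det_zero_of_row_eq (i := none) (j := some j) (by simp) ?_
  rfl

lemma crossDet_map {ι κ R S : Type*} [Fintype κ] [DecidableEq κ] [CommRing R] [CommRing S] (g : R →+* S) (e : Option κ ≃ ι) (z : κ → ι → R) (x : ι → R) :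
    g (crossDet e z x) = crossDet e (fun j i => g (z j i)) (fun i => g (x i)) := by
  rw [crossDet, RingHom.map_det, crossDet]
  congr 1
  ext o o'
  cases o <;> rfl

lemma crossDet_ne_zero {ι κ F : Type*} [Fintype κ] [DecidableEq κ] [Fintype ι] [Field F] (e : Option κ ≃ ι) (z : κ → ι → F) (x : ι → F)
    (hz : LinearIndependent F z) (hx : x ∉ Submodule.span F (Set.range z)) : crossDet e z x ≠ 0 := by
  have h1 : LinearIndependent F (fun o : Option κ => (o.elim x z : ι → F)) := by
    have := (linearIndependent_option' (K := F) (v := z) (x := x)).2 ⟨hz, hx⟩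
    have h : (fun o : Option κ => (o.elim x z : ι → F)) = (fun o => Option.casesOn' o x z) := by
      funext o; cases o <;> rfl
    rw [h]; exact this
  have h2 : LinearIndependent F (crossMat e z x).row := by
    have := h1.map' (LinearMap.funLeft F F e) (LinearMap.ker_eq_bot.2 (LinearMap.funLeft_injective_of_surjective F F e e.surjective))
    exact this
  exact (Matrix.isUnit_iff_isUnit_det _ |>.1 (Matrix.linearIndependent_rows_iff_isUnit.1 h2)).ne_zero

lemma exists_normal {ι κ : Type*} [Fintype κ] [DecidableEq κ] [Fintype ι] [DecidableEq ι] (e : Option κ ≃ ι) (z : κ → ι → ℤ)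
    (hz : LinearIndependent ℚ (fun j i => (z j i : ℚ))) :
    ∃ (n : ι → ℤ) (g : ℤ) (s0 : ι), g ≠ 0 ∧ (∀ i, crossDet e z (Pi.single i 1) = g * n i) ∧ n s0 ≠ 0 ∧ (∀ d : ℤ, (∀ i, d ∣ n i) → IsUnit d) ∧
      (∀ i, |n i| ≤ |n s0|) ∧ ∀ y : ι → ℚ, ∑ i, (n i : ℚ) * y i = 0 → ∃ t : κ → ℚ, ∀ i, y i = ∑ j, t j * z j i := by
  have hne : Nonempty ι := ⟨e none⟩
  set zq : κ → ι → ℚ := fun j i => (z j i : ℚ) with hzq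
  obtain ⟨n, hn, hn1⟩ := Finset.extract_gcd (s := Finset.univ) (fun i => crossDet e z (Pi.single i 1)) Finset.univ_nonempty
  set g := Finset.univ.gcd (fun i => crossDet e z (Pi.single i 1)) with hg
  have hcq : ∀ x : ι → ℚ, crossDet e zq x = g * ∑ i, (n i : ℚ) * x i := by
    intro x
    rw [crossDet_eq, Finset.mul_sum]
    refine Finset.sum_congr rfl fun i _ => ?_
    have h1 := crossDet_map (Int.castRingHom ℚ) e z (Pi.single i 1)
    have h2 : (fun k => (Int.castRingHom ℚ) ((Pi.single i 1 : ι → ℤ) k)) = (Pi.single i 1 : ι → ℚ) := by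
      funext k; by_cases hk : k = i
      · subst hk; simp
      · simp [hk]
    rw [h2] at h1
    change _ = crossDet e zq _ at h1
    rw [← h1, hn i (Finset.mem_univ _)]
    push_cast [eq_intCast]; ring
  have hspan : ∀ y : ι → ℚ, ∑ i, (n i : ℚ) * y i = 0 → y ∈ Submodule.span ℚ (Set.range zq) := by
    intro y hy
    by_contra hcon
    exact crossDet_ne_zero e zq y hz hcon (by rw [hcq, hy, mul_zero])
  have hg0 : g ≠ 0 := by
    intro h0
    have htop : Submodule.span ℚ (Set.range zq) = ⊤ := by
      rw [eq_top_iff]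
      intro y _
      by_contra hcon
      exact crossDet_ne_zero e zq y hz hcon (by rw [hcq, h0]; simp)
    have h1 := finrank_span_eq_card hz
    rw [htop, finrank_top, Module.finrank_fintype_fun_eq_card] at h1
    have h2 := Fintype.card_congr e
    rw [Fintype.card_option] at h2
    omega
  obtain ⟨s0, _, hs0⟩ := Finset.exists_max_image Finset.univ (fun i => |n i|) Finset.univ_nonempty
  refine ⟨n, g, s0, hg0, fun i => hn i (Finset.mem_univ _), ?_, ?_, fun i => hs0 i (Finset.mem_univ _), ?_⟩
  · intro h0
    have : ∀ i, n i = 0 := fun i => by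
      have := hs0 i (Finset.mem_univ _)
      simp [h0] at this; exact this
    have h2 : Finset.univ.gcd n = 0 := Finset.gcd_eq_zero_iff.2 fun i _ => this i
    rw [h2] at hn1; exact absurd hn1 (by norm_num)
  · intro d hd
    have : d ∣ Finset.univ.gcd n := Finset.dvd_gcd fun i _ => hd i
    rw [hn1] at this
    exact isUnit_of_dvd_one this
  · intro y hy
    obtain ⟨t, ht⟩ := (Submodule.mem_span_range_iff_exists_fun ℚ).1 (hspan y hy)
    refine ⟨t, fun i => ?_⟩
    rw [← ht]; simp [zq, Finset.sum_apply]

lemma liouville {K : Type*} [Field K] [NumberField K] (σ : K →+* ℝ) {ι : Type*} [Fintype ι] (M : ι → ι → 𝓞 K) :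
    ∃ B : ℝ, 1 ≤ B ∧ ∀ (n : ι → ℤ) (X : ℝ), (∀ i, |(n i : ℝ)| ≤ X) → ∀ i, ∑ k, (n k : ℝ) * σ (M k i) ≠ 0 →
      1 ≤ |∑ k, (n k : ℝ) * σ (M k i)| * (B * X) ^ (Module.finrank ℚ K - 1) := by
  set B : ℝ := 1 + ∑ i, ∑ k, nK K (M k i) with hB
  have h0 : 0 ≤ ∑ i, ∑ k, nK K (M k i) := Finset.sum_nonneg fun _ _ => Finset.sum_nonneg fun _ _ => apply_nonneg _ _
  refine ⟨B, by rw [hB]; linarith, ?_⟩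
  intro n X hX i hi
  have hX0 : 0 ≤ X := (abs_nonneg _).trans (hX i)
  set γ : 𝓞 K := ∑ k, (n k : 𝓞 K) * M k i with hγ
  have hσ : σ (γ : K) = ∑ k, (n k : ℝ) * σ (M k i) := by
    rw [hγ]; push_cast; rw [map_sum]; simp
  have hγ0 : γ ≠ 0 := by
    intro h; rw [h] at hσ; simp at hσ; exact hi hσ.symm
  have hhouse : house (γ : K) ≤ B * X := by
    rw [← nK_apply, hγ]
    refine (Finset.le_sum_of_subadditive (nK K) (map_zero (nK K)).le (fun x y => map_add_le_add _ _ _) _ _).trans ?_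
    have : ∀ k ∈ Finset.univ, nK K ((n k : 𝓞 K) * M k i) ≤ nK K (M k i) * X := by
      intro k _
      refine (map_mul_le_mul _ _ _).trans ?_
      rw [nK_int, mul_comm]
      exact mul_le_mul_of_nonneg_left (hX k) (apply_nonneg _ _)
    refine (Finset.sum_le_sum this).trans ?_
    rw [← Finset.sum_mul]
    refine mul_le_mul_of_nonneg_right ?_ hX0
    have := Finset.single_le_sum (f := fun i => ∑ k, nK K (M k i)) (fun _ _ => Finset.sum_nonneg fun _ _ => apply_nonneg _ _) (Finset.mem_univ i)
    rw [hB]; linarith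
  have h1 := norm_norm_le_norm_mul_house_pow (γ : K) (Complex.ofRealHom.comp σ)
  have h2 : 1 ≤ ‖Algebra.norm ℚ (γ : K)‖ := by
    rw [← Algebra.coe_norm_int]
    have : Algebra.norm ℤ γ ≠ 0 := Algebra.norm_ne_zero_iff.2 hγ0
    have h3 := Int.one_le_abs this
    rw [← Rat.norm_cast_real]
    simp only [Rat.cast_intCast, Real.norm_eq_abs]
    exact_mod_cast h3
  rw [← hσ]
  refine h2.trans (h1.trans ?_)
  have h4 : ‖(Complex.ofRealHom.comp σ) (γ : K)‖ = |σ (γ : K)| := by simp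
  rw [h4]
  exact mul_le_mul_of_nonneg_left (pow_le_pow_left₀ (house_nonneg _) hhouse _) (abs_nonneg _)

lemma crossDet_bound {ι κ : Type*} [Fintype κ] [DecidableEq κ] [Fintype ι] [DecidableEq ι] (e : Option κ ≃ ι) (A : Matrix ι ι ℝ)
    (z : κ → ι → ℝ) (x : ι → ℝ) (i : ι) (d : ℝ) (hd : 0 ≤ d) (hx : ∀ l, ∑ k, A l k * x k = if l = i then d else 0) (w : ι → ℝ) (hw : ∀ l, 0 < w l)
    (hz : ∀ l j, |∑ k, A l k * z j k| ≤ w l) :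
    |crossDet e z x| * |A.det| ≤ (Fintype.card ι).factorial * (d * ((∏ l, w l) / w i)) := by
  set W : Matrix (Option κ) ι ℝ := Matrix.of fun o => (o.elim x z : ι → ℝ) with hW
  have h1 : (W * A.transpose).submatrix id e = crossMat e z x * A.transpose.submatrix e e := by
    ext o o'
    simp only [Matrix.submatrix_apply, Matrix.mul_apply, id]
    rw [← Equiv.sum_comp e]
    rfl
  have h2 : crossDet e z x * A.det = ((W * A.transpose).submatrix id e).det := by
    rw [h1, Matrix.det_mul, Matrix.det_submatrix_equiv_self, Matrix.det_transpose, crossDet]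
  rw [← abs_mul, h2, Matrix.det_apply]
  refine (Finset.abs_sum_le_sum_abs _ _).trans ?_
  have hterm : ∀ τ ∈ (Finset.univ : Finset (Equiv.Perm (Option κ))), |Equiv.Perm.sign τ • ∏ o, ((W * A.transpose).submatrix id e) (τ o) o| ≤ d * ((∏ l, w l) / w i) := by
    intro τ _
    have hsign : |Equiv.Perm.sign τ • ∏ o, ((W * A.transpose).submatrix id e) (τ o) o| = |∏ o, ((W * A.transpose).submatrix id e) (τ o) o| := by
      rcases Int.units_eq_one_or (Equiv.Perm.sign τ) with h | h <;> rw [h] <;> simp [Units.smul_def]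
    rw [hsign, Finset.abs_prod]
    have hent : ∀ o ∈ (Finset.univ : Finset (Option κ)), |((W * A.transpose).submatrix id e) (τ o) o| ≤ w (e o) * (if τ o = none then d / w i else 1) := by
      intro o _
      have hval : ((W * A.transpose).submatrix id e) (τ o) o = ∑ k, A (e o) k * W (τ o) k := by
        simp only [Matrix.submatrix_apply, Matrix.mul_apply, id, Matrix.transpose_apply]
        exact Finset.sum_congr rfl fun k _ => mul_comm _ _
      rw [hval]
      cases hτ : τ o with
      | none =>
        have : ∑ k, A (e o) k * W none k = if e o = i then d else 0 := hx (e o)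
        rw [this]
        simp only [if_true]
        have := hw i; have := hw (e o)
        split_ifs with h
        · rw [h, abs_of_nonneg hd, mul_div_cancel₀ _ (hw i).ne']
        · simp; positivity
      | some j =>
        have : |∑ k, A (e o) k * W (some j) k| ≤ w (e o) := hz (e o) j
        simpa using this
    refine (Finset.prod_le_prod (fun _ _ => abs_nonneg _) hent).trans ?_
    rw [Finset.prod_mul_distrib, Equiv.prod_comp e w, Equiv.prod_comp τ (fun o => if o = none then d / w i else 1)]
    simp only [Finset.prod_ite_eq', Finset.mem_univ, if_true]
    apply le_of_eq; ring
  refine (Finset.sum_le_sum hterm).trans ?_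
  rw [Finset.sum_const, nsmul_eq_mul, Finset.card_univ, Fintype.card_perm, Fintype.card_congr e]

end Schmidt

end PartC1

section PartC2
open NumberField Filter

namespace Schmidt

theorem penult {K : Type*} [Field K] [NumberField K] (σ : K →+* ℝ) {ι κ : Type*} [Fintype ι] [DecidableEq ι]
    [Fintype κ] [DecidableEq κ] (e : Option κ ≃ ι) (L : ι → ι → K) (hdet : (Matrix.of L).det ≠ 0) (a : ι → ℝ) (ha : ∑ i, a i < 0)
    (Pr : ℝ → (κ → ι → ℤ) → Prop)
    (h : ∃ᶠ Q : ℝ in atTop, ∃ z : κ → ι → ℤ, LinearIndependent ℚ (fun j i => (z j i : ℚ)) ∧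
      (∀ i j, |∑ k, σ (L i k) * z j k| ≤ Q ^ a i) ∧ Pr Q z) :
    ∃ n : ι → ℤ, n ≠ 0 ∧ ∃ᶠ Q : ℝ in atTop, ∃ z : κ → ι → ℤ, (∀ j, ∑ i, n i * z j i = 0) ∧
      (∀ i j, |∑ k, σ (L i k) * z j k| ≤ Q ^ a i) ∧ Pr Q z := by
  haveI : Nonempty ι := ⟨e none⟩
  set δ := -∑ i, a i with hδ
  have hδpos : 0 < δ := by rw [hδ]; linarith
  set D := Module.finrank ℚ K with hD
  have hDpos : 0 < D := Module.finrank_pos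
  have hDr : (0:ℝ) < D := by exact_mod_cast hDpos
  set η : ℝ := δ / (4 * D) with hη
  have hηpos : 0 < η := by positivity
  have hno := no_large_normals (κ := κ) σ L hdet a ha η hηpos
  rw [not_frequently] at hno
  obtain ⟨M, d, hd, hML⟩ := exists_integral_inv L hdet
  have hdr : (0:ℝ) < d := by exact_mod_cast hd
  obtain ⟨B, hB1, hliou⟩ := liouville σ M
  set A : Matrix ι ι ℝ := Matrix.of fun i k => σ (L i k) with hA
  have hAdet : A.det ≠ 0 := by
    have : A.det = σ (Matrix.of L).det := by
      rw [RingHom.map_det]; rfl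
    rw [this]; exact (map_ne_zero σ).2 hdet
  have hLM : ∀ i l, ∑ k, A l k * σ (M k i) = if l = i then (d:ℝ) else 0 := by
    have h1 : (Matrix.of fun i j => (M i j : K)) * Matrix.of L = (d : K) • (1 : Matrix ι ι K) := by
      ext i k
      rw [Matrix.mul_apply, Matrix.smul_apply, Matrix.one_apply]
      simp only [Matrix.of_apply, smul_eq_mul, mul_ite, mul_one, mul_zero]
      exact hML i k
    have hdK : (d : K) ≠ 0 := by exact_mod_cast (by omega : d ≠ 0)
    have h2 : ((d:K)⁻¹ • (Matrix.of fun i j => (M i j : K))) * Matrix.of L = 1 := by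
      rw [smul_mul_assoc, h1, smul_smul, inv_mul_cancel₀ hdK, one_smul]
    have h3 := mul_eq_one_comm.1 h2
    intro i l
    have h4 := congrFun (congrFun h3 l) i
    rw [mul_smul_comm, Matrix.smul_apply, Matrix.mul_apply, Matrix.one_apply, smul_eq_mul] at h4
    have h5 : ∑ k, L l k * (M k i : K) = if l = i then (d:K) else 0 := by
      simp only [Matrix.of_apply] at h4
      rw [inv_mul_eq_iff_eq_mul₀ hdK] at h4
      rw [h4]; split_ifs <;> simp
    have h6 := congrArg σ h5
    rw [map_sum] at h6
    simp only [map_mul] at h6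
    rw [show (∑ k, A l k * σ (M k i)) = ∑ k, σ (L l k) * σ (M k i) from rfl, h6]
    split_ifs <;> simp
  set C2 : ℝ := (Fintype.card ι).factorial * d / |A.det| with hC2
  have hdetpos : 0 < |A.det| := abs_pos.2 hAdet
  have hC2pos : 0 < C2 := by positivity
  have hev1 : ∀ᶠ Q : ℝ in atTop, C2 * B ^ (D - 1) < Q ^ (δ / 2) :=
    (tendsto_rpow_atTop (by positivity)).eventually_gt_atTop _
  have hev2 : ∀ᶠ Q : ℝ in atTop, Fintype.card ι * C2 < Q ^ δ :=
    (tendsto_rpow_atTop hδpos).eventually_gt_atTop _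
  obtain ⟨Q, ⟨z, hzli, hzb, hzP⟩, hnoQ, hQ1, hQ2, hQ3⟩ :=
    (h.and_eventually (hno.and (hev1.and (hev2.and (eventually_ge_atTop (1:ℝ)))))).exists
  have hQ0 : 0 < Q := by linarith
  obtain ⟨n, g, s0, hg, hcr, hns0, hprim, hmax, hspan⟩ := exists_normal e z hzli
  have hX : |(n s0 : ℝ)| < Q ^ η := by
    by_contra hcon
    push Not at hcon
    exact hnoQ ⟨z, hzb, n, s0, hprim, hmax, hcon, hspan⟩
  set b : ι → ℝ := fun i => ∑ k, (n k : ℝ) * σ (M k i) with hb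
  have hbb : ∀ i, |b i| ≤ C2 * Q ^ (-δ - a i) := by
    intro i
    set zr : κ → ι → ℝ := fun j k => (z j k : ℝ) with hzr
    have h1 := crossDet_bound e A zr (fun k => σ (M k i)) i d hdr.le (hLM i) (fun l => Q ^ a l) (fun l => Real.rpow_pos_of_pos hQ0 _) hzb
    have h2 : crossDet e zr (fun k => σ (M k i)) = g * b i := by
      rw [crossDet_eq, hb, Finset.mul_sum]
      refine Finset.sum_congr rfl fun k _ => ?_
      have h1 := crossDet_map (Int.castRingHom ℝ) e z (Pi.single k 1)
      have h2 : (fun l => (Int.castRingHom ℝ) ((Pi.single k 1 : ι → ℤ) l)) = (Pi.single k 1 : ι → ℝ) := by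
        funext l; by_cases hk : l = k
        · subst hk; simp
        · simp [hk]
      rw [h2] at h1
      change _ = crossDet e zr _ at h1
      rw [← h1, hcr k]
      push_cast [eq_intCast]; ring
    have h3 : |b i| ≤ |crossDet e zr (fun k => σ (M k i))| := by
      rw [h2, abs_mul]
      have : (1:ℝ) ≤ |(g:ℝ)| := by exact_mod_cast Int.one_le_abs hg
      nlinarith [abs_nonneg (b i)]
    have h4 : (∏ l, Q ^ a l) / Q ^ a i = Q ^ (-δ - a i) := by
      rw [← Real.rpow_sum_of_pos hQ0, ← Real.rpow_sub hQ0, hδ, neg_neg]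
    rw [h4] at h1
    refine h3.trans ?_
    rw [hC2, div_mul_eq_mul_div, le_div_iff₀ hdetpos]
    refine h1.trans (le_of_eq ?_); ring
  have hneg : ∀ i, b i ≠ 0 → a i < 0 := by
    intro i hi
    by_contra hai
    push Not at hai
    have h1 := hliou n (Q ^ η) (fun k => le_trans (by exact_mod_cast hmax k) hX.le) i hi
    have h2 : (B * Q ^ η) ^ (D - 1) ≤ B ^ (D-1) * Q ^ (δ / 2) := by
      rw [mul_pow]
      refine mul_le_mul_of_nonneg_left ?_ (by positivity)
      rw [← Real.rpow_natCast, ← Real.rpow_mul hQ0.le]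
      refine Real.rpow_le_rpow_of_exponent_le hQ3 ?_
      have : ((D - 1 : ℕ) : ℝ) ≤ D := by exact_mod_cast Nat.sub_le _ _
      calc η * ((D-1:ℕ):ℝ) ≤ η * D := mul_le_mul_of_nonneg_left this hηpos.le
        _ = δ / 4 := by rw [hη]; field_simp
        _ ≤ δ / 2 := by linarith
    have h3 : |b i| ≤ C2 * Q ^ (-δ) :=
      (hbb i).trans (mul_le_mul_of_nonneg_left (Real.rpow_le_rpow_of_exponent_le hQ3 (by linarith)) hC2pos.le)
    have h4 : 1 ≤ (C2 * Q ^ (-δ)) * (B ^ (D-1) * Q ^ (δ / 2)) :=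
      h1.trans (mul_le_mul h3 h2 (by positivity) (by positivity))
    have h5 : (C2 * Q ^ (-δ)) * (B ^ (D-1) * Q ^ (δ / 2)) = C2 * B ^ (D-1) * Q ^ (-(δ/2)) := by
      rw [show -(δ/2) = -δ + δ/2 by ring, Real.rpow_add hQ0]; ring
    rw [h5, Real.rpow_neg hQ0.le, ← div_eq_mul_inv, le_div_iff₀ (Real.rpow_pos_of_pos hQ0 _)] at h4
    linarith
  refine ⟨n, fun h0 => hns0 (by rw [h0]; rfl), ?_⟩
  refine (h.and_eventually (eventually_ge_atTop Q)).mono ?_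
  rintro Q' ⟨⟨z', _, hz'b, hz'P⟩, hQ'⟩
  refine ⟨z', fun j => ?_, hz'b, hz'P⟩
  have hQ'0 : 0 < Q' := by linarith
  have hid : ∑ i, b i * ∑ k, A i k * (z' j k : ℝ) = d * ∑ i, (n i : ℝ) * z' j i := by
    have hMA : ∀ k l, ∑ i, σ (M k i) * A i l = if k = l then (d:ℝ) else 0 := by
      intro k l
      have h6 := congrArg σ (hML k l)
      rw [map_sum] at h6
      simp only [map_mul] at h6
      rw [show (∑ i, σ (M k i) * A i l) = ∑ i, σ (M k i) * σ (L i l) from rfl, h6]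
      split_ifs <;> simp
    calc ∑ i, b i * ∑ k, A i k * (z' j k : ℝ) = ∑ i, ∑ k, ∑ l, (n l : ℝ) * (z' j k) * (σ (M l i) * A i k) := by
          refine Finset.sum_congr rfl fun i _ => ?_
          rw [Finset.mul_sum]
          refine Finset.sum_congr rfl fun k _ => ?_
          rw [hb, Finset.sum_mul]
          exact Finset.sum_congr rfl fun l _ => by ring
      _ = ∑ k, ∑ l, ∑ i, (n l : ℝ) * (z' j k) * (σ (M l i) * A i k) := by
          rw [Finset.sum_comm]
          exact Finset.sum_congr rfl fun k _ => Finset.sum_comm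
      _ = d * ∑ i, (n i : ℝ) * z' j i := by
          rw [Finset.mul_sum]
          refine Finset.sum_congr rfl fun k _ => ?_
          simp only [← Finset.mul_sum, hMA]
          simp; ring
  have hsmall : |∑ i, b i * ∑ k, A i k * (z' j k : ℝ)| < 1 := by
    have hterm : ∀ i ∈ Finset.univ, |b i * ∑ k, A i k * (z' j k : ℝ)| ≤ C2 * Q ^ (-δ) := by
      intro i _
      rw [abs_mul]
      by_cases hi : b i = 0
      · rw [hi]; simp; positivity
      · have h1 : |∑ k, A i k * (z' j k : ℝ)| ≤ Q ^ a i :=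
          (hz'b i j).trans (Real.rpow_le_rpow_of_nonpos hQ0 hQ' (hneg i hi).le)
        calc _ ≤ (C2 * Q ^ (-δ - a i)) * Q ^ a i := mul_le_mul (hbb i) h1 (abs_nonneg _) (by positivity)
          _ = C2 * Q ^ (-δ) := by rw [mul_assoc, ← Real.rpow_add hQ0]; congr 2; ring
    refine ((Finset.abs_sum_le_sum_abs _ _).trans (Finset.sum_le_sum hterm)).trans_lt ?_
    rw [Finset.sum_const, nsmul_eq_mul, Finset.card_univ, Real.rpow_neg hQ0.le, ← mul_assoc, ← div_eq_mul_inv, div_lt_one (Real.rpow_pos_of_pos hQ0 _)]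
    exact hQ2
  rw [hid, abs_mul, abs_of_pos hdr] at hsmall
  have h1 : |∑ i, (n i : ℝ) * z' j i| < 1 := by
    have : (1:ℝ) ≤ d := by exact_mod_cast hd
    nlinarith [abs_nonneg (∑ i, (n i : ℝ) * z' j i)]
  have h2 : |∑ i, n i * z' j i| < 1 := by exact_mod_cast h1
  exact Int.abs_lt_one_iff.1 h2

end Schmidt

end PartC2

section PartG1
open Module

namespace Schmidt

lemma exists_shortest {Λ : Type} [AddCommGroup Λ] [Module.IsTorsionFree ℤ Λ] [Nontrivial Λ] {N : ℕ} (f : Λ →ₗ[ℤ] (Fin (N + 1) → ℝ))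
    (hf : ∀ R : ℝ, {x | ∀ l, |f x l| ≤ R}.Finite) :
    ∃ (v : Λ) (p : Fin (N + 1)), v ≠ 0 ∧ 0 < |f v p| ∧ (∀ l, |f v l| ≤ |f v p|) ∧ ∀ x, x ≠ 0 → ∃ l, |f v p| ≤ |f x l| := by
  obtain ⟨x0, hx0⟩ := exists_ne (0 : Λ)
  have hfin : ({x | x ≠ 0 ∧ ‖f x‖ ≤ ‖f x0‖}).Finite := by
    refine (hf ‖f x0‖).subset ?_
    rintro x ⟨_, hx⟩ l
    exact (norm_le_pi_norm (f x) l).trans hx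
  obtain ⟨v, hv, hmin⟩ := Set.exists_min_image _ (fun x => ‖f x‖) hfin ⟨x0, hx0, le_rfl⟩
  have hmin' : ∀ x, x ≠ 0 → ‖f v‖ ≤ ‖f x‖ := by
    intro x hx
    by_cases h : ‖f x‖ ≤ ‖f x0‖
    · exact hmin x ⟨hx, h⟩
    · exact hv.2.trans (not_le.1 h).le
  have hmax : ∀ x, ∃ p, ∀ l, |f x l| ≤ |f x p| := fun x => by
    obtain ⟨p, _, hp⟩ := Finset.exists_max_image Finset.univ (fun l => |f x l|) Finset.univ_nonempty
    exact ⟨p, fun l => hp l (Finset.mem_univ _)⟩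
  have hnorm : ∀ x p, (∀ l, |f x l| ≤ |f x p|) → ‖f x‖ = |f x p| := fun x p h =>
    le_antisymm ((pi_norm_le_iff_of_nonneg (abs_nonneg _)).2 h) (norm_le_pi_norm (f x) p)
  obtain ⟨p, hp⟩ := hmax v
  refine ⟨v, p, hv.1, ?_, hp, ?_⟩
  · by_contra hcon
    have h0 : |f v p| = 0 := le_antisymm (not_lt.1 hcon) (abs_nonneg _)
    have hfv : f v = 0 := by
      funext l
      have := hp l
      rw [h0] at this
      exact abs_eq_zero.1 (le_antisymm this (abs_nonneg _))
    have : Set.range (fun n : ℤ => n • v) ⊆ {x | ∀ l, |f x l| ≤ (0:ℝ)} := by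
      rintro _ ⟨n, rfl⟩ l
      simp [hfv]
    refine Set.infinite_range_of_injective ?_ ((hf 0).subset this)
    intro m n hmn
    exact smul_left_injective ℤ hv.1 hmn
  · intro x hx
    obtain ⟨q, hq⟩ := hmax x
    refine ⟨q, ?_⟩
    rw [← hnorm v p hp, ← hnorm x q hq]
    exact hmin' x hx

theorem reduction (N : ℕ) : ∃ C : ℝ, 1 ≤ C ∧ ∀ (Λ : Type) [AddCommGroup Λ] [Module.Free ℤ Λ] [Module.Finite ℤ Λ],
    finrank ℤ Λ = N → ∀ (f : Λ →ₗ[ℤ] (Fin N → ℝ)), (∀ R : ℝ, {x | ∀ l, |f x l| ≤ R}.Finite) →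
    ∃ (y : Fin N → Λ) (τ : Fin N → Fin N) (μ : Fin N → ℝ), Function.Injective τ ∧ (∀ i, 0 < μ i) ∧
      (∀ i, y i ≠ 0) ∧ (⊤ ≤ Submodule.span ℤ (Set.range y)) ∧
      (∀ i j, i ≤ j → μ i ≤ C * μ j) ∧ (∀ i l, |f (y i) (τ l)| ≤ C * min (μ l) (μ i)) ∧
      |(Matrix.of fun i l => f (y i) (τ l)).det| = ∏ i, μ i ∧
      ∀ x k, (∀ l, C * |f x l| < μ k) → x ∈ Submodule.span ℤ (y '' {i | i < k}) := by
  induction N with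
  | zero =>
    refine ⟨1, le_rfl, ?_⟩
    intro Λ _ _ _ hr f hf
    have hsub : Subsingleton Λ := finrank_zero_iff.1 hr
    refine ⟨fun _ => 0, id, fun _ => 1, Function.injective_id, fun i => i.elim0, fun i => i.elim0, ?_, fun i => i.elim0, fun i => i.elim0, by simp, fun x k => k.elim0⟩
    intro x _
    rw [Subsingleton.elim x 0]; exact Submodule.zero_mem _
  | succ N ih =>
    obtain ⟨C, hC, ih⟩ := ih
    refine ⟨4 * C, by linarith, ?_⟩
    intro Λ _ _ _ hr f hf
    have hnt : Nontrivial Λ := nontrivial_of_finrank_pos (R := ℤ) (by omega)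
    obtain ⟨v, p, hv0, hlam, hvl, hmin⟩ := exists_shortest f hf
    set lam := |f v p| with hlamdef
    have hfvp : f v p ≠ 0 := abs_pos.1 hlam
    set S := Submodule.span ℤ {v} with hS
    have htf : Module.IsTorsionFree ℤ (Λ ⧸ S) := by
      refine Module.IsTorsionFree.of_smul_eq_zero ?_
      intro n x' hx'
      obtain ⟨x, rfl⟩ := Submodule.mkQ_surjective S x'
      by_contra hcon
      push Not at hcon
      obtain ⟨hn, hx⟩ := hcon
      rw [← map_smul, Submodule.mkQ_apply, Submodule.Quotient.mk_eq_zero, hS, Submodule.mem_span_singleton] at hx'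
      obtain ⟨m, hm⟩ := hx'
      apply hx
      rw [Submodule.mkQ_apply, Submodule.Quotient.mk_eq_zero, hS, Submodule.mem_span_singleton]
      refine ⟨m / n, ?_⟩
      by_contra hne
      obtain ⟨l, hl⟩ := hmin (x - (m / n) • v) (fun h => hne (sub_eq_zero.1 h).symm)
      have hnr : (n:ℝ) ≠ 0 := by exact_mod_cast hn
      have h1 : (n:ℝ) * f (x - (m/n) • v) l = ((m % n : ℤ) : ℝ) * f v l := by
        have h2 : n • (x - (m/n) • v) = (m % n) • v := by
          rw [smul_sub, ← hm, smul_smul, ← sub_smul, Int.emod_def]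
        have h3 := congrFun (congrArg f h2) l
        simpa only [map_smul, Pi.smul_apply, zsmul_eq_mul] using h3
      have h4 : |(n:ℝ)| * |f (x - (m/n) • v) l| = |((m % n : ℤ) : ℝ)| * |f v l| := by
        rw [← abs_mul, h1, abs_mul]
      have h5 : |((m % n : ℤ) : ℝ)| < |(n:ℝ)| := by
        rw [← Int.cast_abs, ← Int.cast_abs]
        have := Int.emod_lt_abs m hn
        have h0 := Int.emod_nonneg m hn
        rw [abs_of_nonneg h0]
        exact_mod_cast this
      have h6 := hvl l
      have hnpos : 0 < |(n:ℝ)| := abs_pos.2 hnr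
      have h7 : |(n:ℝ)| * lam ≤ |(n:ℝ)| * |f (x - (m/n) • v) l| := mul_le_mul_of_nonneg_left hl hnpos.le
      have h8 : |((m % n : ℤ) : ℝ)| * |f v l| ≤ |((m % n : ℤ) : ℝ)| * lam := mul_le_mul_of_nonneg_left h6 (abs_nonneg _)
      nlinarith
    have hfree : Module.Free ℤ (Λ ⧸ S) := inferInstance
    have hrank : finrank ℤ (Λ ⧸ S) = N := by
      have h1 := Submodule.finrank_quotient_add_finrank S
      have h2 : finrank ℤ S = 1 := by
        rw [← (LinearEquiv.toSpanNonzeroSingleton ℤ Λ v hv0).finrank_eq]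
        simp
      omega
    let g : Λ →ₗ[ℤ] (Fin N → ℝ) :=
      { toFun := fun x l => f x (p.succAbove l) - (f x p / f v p) * f v (p.succAbove l)
        map_add' := by
          intro x y; funext l
          simp only [map_add, Pi.add_apply]; ring
        map_smul' := by
          intro n x; funext l
          simp only [map_smul, Pi.smul_apply, zsmul_eq_mul, RingHom.id_apply, eq_intCast, Int.cast_id]; ring }
    have hgdef : ∀ x l, g x l = f x (p.succAbove l) - (f x p / f v p) * f v (p.succAbove l) := fun _ _ => rfl
    have hgv : S ≤ LinearMap.ker g := by
      rw [hS, Submodule.span_le, Set.singleton_subset_iff]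
      change g v = 0
      funext l
      rw [hgdef, div_self hfvp]; simp
    set f' := S.liftQ g hgv with hf'
    have hf'mk : ∀ x, f' (S.mkQ x) = g x := fun x => by
      rw [hf', Submodule.mkQ_apply, Submodule.liftQ_apply]
    have hlift : ∀ x' : Λ ⧸ S, ∃ x, S.mkQ x = x' ∧ |f x p| ≤ lam / 2 := by
      intro x'
      obtain ⟨x, rfl⟩ := Submodule.mkQ_surjective S x'
      refine ⟨x - round (f x p / f v p) • v, ?_, ?_⟩
      · rw [map_sub, map_smul]
        have : S.mkQ v = 0 := by
          rw [Submodule.mkQ_apply, Submodule.Quotient.mk_eq_zero]; exact Submodule.mem_span_singleton_self v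
        rw [this, smul_zero, sub_zero]
      · have h1 := abs_sub_round (f x p / f v p)
        have h2 : f (x - round (f x p / f v p) • v) p = (f x p / f v p - round (f x p / f v p)) * f v p := by
          rw [map_sub, map_smul, Pi.sub_apply, Pi.smul_apply, zsmul_eq_mul]
          field_simp
        rw [h2, abs_mul]
        nlinarith
    have hdiv : ∀ x l, |(f x p / f v p) * f v l| ≤ |f x p| := by
      intro x l
      rw [abs_mul, abs_div, div_mul_eq_mul_div, div_le_iff₀ hlam]
      exact mul_le_mul_of_nonneg_left (hvl l) (abs_nonneg _)
    have hup : ∀ x l, |f x (p.succAbove l)| ≤ |g x l| + |f x p| := by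
      intro x l
      have h1 : f x (p.succAbove l) = g x l + (f x p / f v p) * f v (p.succAbove l) := by rw [hgdef]; ring
      rw [h1]
      exact (abs_add_le _ _).trans (by have := hdiv x (p.succAbove l); linarith)
    have hgup : ∀ x l, |g x l| ≤ |f x (p.succAbove l)| + |f x p| := by
      intro x l
      rw [hgdef]
      exact (abs_sub _ _).trans (by have := hdiv x (p.succAbove l); linarith)
    have hf'fin : ∀ R : ℝ, {x | ∀ l, |f' x l| ≤ R}.Finite := by
      intro R
      refine ((hf (max (lam / 2) (R + lam / 2))).image S.mkQ).subset ?_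
      intro x' hx'
      obtain ⟨x, rfl, hx⟩ := hlift x'
      refine ⟨x, ?_, rfl⟩
      intro l
      rcases Fin.eq_self_or_eq_succAbove p l with h | ⟨l', h⟩
      · rw [h]; exact hx.trans (le_max_left _ _)
      · rw [h]
        refine le_trans ?_ (le_max_right _ _)
        have h1 := hup x l'
        have h2 := hx' l'
        rw [hf'mk] at h2
        linarith
    obtain ⟨y', τ', μ', hτ', hμ', hy'0, hspan', hmono', hent', hdet', hgap'⟩ := ih (Λ ⧸ S) hrank f' hf'fin
    choose y hy hyp using fun i => hlift (y' i)
    have hlow : ∀ i, lam ≤ 2 * C * μ' i := by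
      intro i
      have hyi : y i ≠ 0 := fun h => hy'0 i (by rw [← hy i, h, map_zero])
      obtain ⟨l, hl⟩ := hmin (y i) hyi
      rcases Fin.eq_self_or_eq_succAbove p l with h | ⟨l', h⟩
      · rw [h] at hl
        have := hyp i; linarith
      · rw [h] at hl
        have h1 := hup (y i) l'
        have h2 := hyp i
        have hbij := Finite.injective_iff_bijective.1 hτ'
        obtain ⟨l'', rfl⟩ := hbij.2 l'
        have h3 := hent' i l''
        rw [← hy i, hf'mk] at h3
        have h4 := min_le_right (μ' l'') (μ' i)
        nlinarith
    refine ⟨Fin.cons v y, Fin.cons p (fun l => p.succAbove (τ' l)), Fin.cons lam μ', ?_, ?_, ?_, ?_, ?_, ?_, ?_, ?_⟩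
    · rw [Fin.cons_injective_iff]
      refine ⟨?_, fun a b hab => hτ' (Fin.succAbove_right_injective hab)⟩
      rintro ⟨l, hl⟩
      exact Fin.succAbove_ne p _ hl
    · intro i
      refine Fin.cases ?_ (fun i => ?_) i
      · simpa using hlam
      · simpa using hμ' i
    · intro i
      refine Fin.cases ?_ (fun i => ?_) i
      · simpa using hv0
      · simp only [Fin.cons_succ]
        exact fun h => hy'0 i (by rw [← hy i, h, map_zero])
    · intro x _
      have h1 : S.mkQ x ∈ Submodule.span ℤ (Set.range y') := hspan' trivial
      have h2 : Set.range y' = S.mkQ '' (Set.range y) := by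
        rw [← Set.range_comp]; congr 1; funext i; exact (hy i).symm
      rw [h2, ← Submodule.map_span] at h1
      obtain ⟨w, hw, hwx⟩ := h1
      have h3 : x - w ∈ S := by
        rw [← Submodule.Quotient.mk_eq_zero, ← Submodule.mkQ_apply, map_sub, hwx, sub_self]
      rw [Fin.range_cons]
      have h4 : x = (x - w) + w := by abel
      rw [h4]
      refine Submodule.add_mem _ (Submodule.span_mono ?_ h3) (Submodule.span_mono ?_ hw)
      · simp
      · exact Set.subset_insert _ _
    · intro i j
      refine Fin.cases ?_ (fun i => ?_) i <;> refine Fin.cases ?_ (fun j => ?_) j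
      · intro _; simp only [Fin.cons_zero]; nlinarith
      · intro _; simp only [Fin.cons_zero, Fin.cons_succ]
        have := hlow j; have := hμ' j; nlinarith
      · intro h; exact absurd h (by simp)
      · intro h; simp only [Fin.cons_succ]
        have := hmono' i j (Fin.succ_le_succ_iff.1 h)
        have := hμ' j; nlinarith
    · intro i l
      refine Fin.cases ?_ (fun i => ?_) i <;> refine Fin.cases ?_ (fun l => ?_) l
      · simp only [Fin.cons_zero, min_self]; rw [← hlamdef]; nlinarith
      · simp only [Fin.cons_zero, Fin.cons_succ]
        refine (hvl _).trans ?_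
        rw [mul_min_of_nonneg _ _ (by linarith)]
        have := hlow l; have := hμ' l
        exact le_min (by nlinarith) (by nlinarith)
      · simp only [Fin.cons_zero, Fin.cons_succ]
        refine (hyp i).trans ?_
        rw [mul_min_of_nonneg _ _ (by linarith)]
        have := hlow i; have := hμ' i
        exact le_min (by nlinarith) (by nlinarith)
      · simp only [Fin.cons_succ]
        refine (hup _ _).trans ?_
        have h1 := hent' i l
        rw [← hy i, hf'mk] at h1
        have h2 := hyp i
        have h3 : lam ≤ 2 * C * min (μ' l) (μ' i) := by
          rw [mul_min_of_nonneg _ _ (by linarith)]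
          exact le_min (hlow l) (hlow i)
        linarith
    · rw [Fin.prod_univ_succ]
      simp only [Fin.cons_zero, Fin.cons_succ]
      rw [← hdet', hlamdef, ← abs_mul]
      congr 1
      set B : Matrix (Fin (N+1)) (Fin (N+1)) ℝ := Matrix.of
        (Fin.cons (fun l => f v ((Fin.cons p (fun l => p.succAbove (τ' l)) : Fin (N+1) → Fin (N+1)) l)) (fun i => (Fin.cons 0 (fun l => g (y i) (τ' l)) : Fin (N+1) → ℝ))) with hB
      have h1 := Matrix.det_eq_of_forall_row_eq_smul_add_const
        (A := Matrix.of fun i l => f ((Fin.cons v y : Fin (N+1) → Λ) i) ((Fin.cons p (fun l => p.succAbove (τ' l)) : Fin (N+1) → Fin (N+1)) l))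
        (B := B) (Fin.cons 0 (fun i => f (y i) p / f v p)) 0 (by simp) (by
          intro i l
          refine Fin.cases ?_ (fun i => ?_) i <;> refine Fin.cases ?_ (fun l => ?_) l
          · simp [hB]
          · simp [hB]
          · simp only [hB, Matrix.of_apply, Fin.cons_zero, Fin.cons_succ]
            field_simp; ring
          · simp only [hB, Matrix.of_apply, Fin.cons_zero, Fin.cons_succ]
            rw [hgdef]; ring)
      rw [h1, Matrix.det_succ_column_zero, Fin.sum_univ_succ]
      have h2 : ∀ i : Fin N, B i.succ 0 = 0 := fun i => by simp [hB]
      have h3 : B 0 0 = f v p := by simp [hB]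
      have h4 : (B.submatrix (Fin.succAbove 0) Fin.succ) = Matrix.of fun i l => f' (y' i) (τ' l) := by
        ext i l
        simp only [hB, Matrix.submatrix_apply, Matrix.of_apply, Fin.zero_succAbove, Fin.cons_succ]
        rw [← hy i, hf'mk]
      rw [h3, h4]
      simp [h2]
    · intro x k
      refine Fin.cases ?_ (fun k => ?_) k
      · intro hx
        simp only [Fin.cons_zero] at hx
        have : x = 0 := by
          by_contra h
          obtain ⟨l, hl⟩ := hmin x h
          have := hx l
          nlinarith [abs_nonneg (f x l)]
        rw [this]; exact Submodule.zero_mem _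
      · intro hx
        simp only [Fin.cons_succ] at hx
        have h1 : S.mkQ x ∈ Submodule.span ℤ (y' '' {i | i < k}) := by
          apply hgap'
          intro l
          rw [hf'mk]
          have h2 := hgup x l
          have h3 := hx (p.succAbove l)
          have h4 := hx p
          have h5 : C * |g x l| ≤ C * (|f x (p.succAbove l)| + |f x p|) := mul_le_mul_of_nonneg_left h2 (by linarith)
          have h6 := hμ' k
          linarith
        have h2 : y' '' {i | i < k} = S.mkQ '' (y '' {i | i < k}) := by
          rw [← Set.image_comp]; congr 1; funext i; exact (hy i).symm
        rw [h2, ← Submodule.map_span] at h1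
        obtain ⟨w, hw, hwx⟩ := h1
        have h3 : x - w ∈ S := by
          rw [← Submodule.Quotient.mk_eq_zero, ← Submodule.mkQ_apply, map_sub, hwx, sub_self]
        have h4 : x = (x - w) + w := by abel
        rw [h4]
        refine Submodule.add_mem _ (Submodule.span_mono ?_ h3) (Submodule.span_mono ?_ hw)
        · rw [Set.singleton_subset_iff]
          exact ⟨0, Fin.succ_pos k, by simp⟩
        · rintro _ ⟨i, hi, rfl⟩
          exact ⟨i.succ, Fin.succ_lt_succ_iff.2 hi, by simp⟩

end Schmidt

end PartG1

section PartG2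
open Module

namespace Schmidt

theorem reduce_matrix (N : ℕ) : ∃ C : ℝ, 1 ≤ C ∧ ∀ A : Matrix (Fin N) (Fin N) ℝ, A.det ≠ 0 →
    ∃ (b : Basis (Fin N) ℤ (Fin N → ℤ)) (τ : Equiv.Perm (Fin N)) (μ : Fin N → ℝ), (∀ i, 0 < μ i) ∧
      (∀ i j, i ≤ j → μ i ≤ C * μ j) ∧ (∀ i l, |∑ k, A (τ l) k * (b i k : ℝ)| ≤ C * min (μ l) (μ i)) ∧
      ∏ i, μ i = |A.det| ∧ IsUnit (Matrix.of fun i j => b i j).det ∧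
      ∀ x k, (∀ l, C * |∑ j, A l j * (x j : ℝ)| < μ k) → x ∈ Submodule.span ℤ (b '' {i | i < k}) := by
  obtain ⟨C, hC, hred⟩ := reduction N
  refine ⟨C, hC, ?_⟩
  intro A hA
  let f : (Fin N → ℤ) →ₗ[ℤ] (Fin N → ℝ) :=
    { toFun := fun x l => ∑ j, A l j * (x j : ℝ)
      map_add' := by
        intro x y; funext l
        simp only [Pi.add_apply, Int.cast_add, mul_add, Finset.sum_add_distrib]
      map_smul' := by
        intro n x; funext l
        simp only [Pi.smul_apply, smul_eq_mul, Int.cast_mul, zsmul_eq_mul, eq_intCast, Int.cast_id, Finset.mul_sum]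
        exact Finset.sum_congr rfl fun _ _ => by ring }
  have hfd : ∀ x l, f x l = ∑ j, A l j * (x j : ℝ) := fun _ _ => rfl
  have hf : ∀ R : ℝ, {x | ∀ l, |f x l| ≤ R}.Finite := by
    intro R
    set Z : ℤ := ⌈∑ i, ∑ j, |A⁻¹ i j| * R⌉ with hZ
    refine (Set.finite_Icc (fun _ => -Z : Fin N → ℤ) (fun _ => Z)).subset ?_
    intro x hx
    have h1 : ∀ i, |(x i : ℝ)| ≤ Z := by
      intro i
      have hR : 0 ≤ R := (abs_nonneg _).trans (hx i)
      have h2 : (x i : ℝ) = ∑ j, A⁻¹ i j * f x j := by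
        have h3 : A⁻¹.mulVec (A.mulVec (fun j => (x j : ℝ))) = fun j => (x j : ℝ) := by
          rw [Matrix.mulVec_mulVec, Matrix.nonsing_inv_mul _ (isUnit_iff_ne_zero.2 hA), Matrix.one_mulVec]
        exact (congrFun h3 i).symm
      rw [h2]
      refine (Finset.abs_sum_le_sum_abs _ _).trans ?_
      have h3 : ∑ j, |A⁻¹ i j * f x j| ≤ ∑ j, |A⁻¹ i j| * R :=
        Finset.sum_le_sum fun j _ => by rw [abs_mul]; exact mul_le_mul_of_nonneg_left (hx j) (abs_nonneg _)
      have h4 := Finset.single_le_sum (f := fun i => ∑ j, |A⁻¹ i j| * R) (fun _ _ => Finset.sum_nonneg fun _ _ => by positivity) (Finset.mem_univ i)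
      exact (h3.trans h4).trans (Int.le_ceil _)
    constructor
    · intro i
      have := (abs_le.1 (h1 i)).1
      exact_mod_cast this
    · intro i
      have := (abs_le.1 (h1 i)).2
      exact_mod_cast this
  obtain ⟨y, τ, μ, hτ, hμ, _, hspan, hmono, hent, hdet, hgap⟩ := hred (Fin N → ℤ) (by simp) f hf
  set Y : Matrix (Fin N) (Fin N) ℤ := Matrix.of fun i j => y i j with hY
  set τ' : Equiv.Perm (Fin N) := Equiv.ofBijective τ (Finite.injective_iff_bijective.1 hτ) with hτ'
  have hτa : ∀ l, τ' l = τ l := fun _ => rfl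
  have hunit : IsUnit Y.det := by
    have : ∀ i, ∃ c : Fin N → ℤ, ∑ j, c j • y j = Pi.single i 1 := fun i =>
      (Submodule.mem_span_range_iff_exists_fun ℤ).1 (hspan trivial)
    choose c hc using this
    have h1 : (Matrix.of c) * Y = 1 := by
      ext i j
      have := congrFun (hc i) j
      rw [Finset.sum_apply] at this
      simp only [Pi.smul_apply, smul_eq_mul] at this
      rw [Matrix.mul_apply, Matrix.one_apply]
      simp only [Matrix.of_apply, hY]
      rw [this, Pi.single_apply]; simp [eq_comm]
    have h2 := congrArg Matrix.det h1
    rw [Matrix.det_mul, Matrix.det_one] at h2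
    exact IsUnit.of_mul_eq_one _ (by rw [mul_comm]; exact h2)
  have hli : LinearIndependent ℤ y := Matrix.linearIndependent_rows_of_det_ne_zero (A := Y) hunit.ne_zero
  refine ⟨Basis.mk hli hspan, τ', μ, hμ, hmono, ?_, ?_, ?_, ?_⟩
  · intro i l
    rw [Basis.mk_apply]
    exact hent i l
  · rw [← hdet]
    have h1 : (Matrix.of fun i l => f (y i) (τ l)) = ((Y.map (Int.castRingHom ℝ)) * A.transpose).submatrix id τ' := by
      ext i l
      simp only [Matrix.submatrix_apply, Matrix.mul_apply, Matrix.transpose_apply, Matrix.of_apply, hfd, id]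
      exact Finset.sum_congr rfl fun j _ => by rw [mul_comm]; rfl
    rw [h1, Matrix.det_permute', Matrix.det_mul, Matrix.det_transpose]
    have h2 : ((Y.map (Int.castRingHom ℝ))).det = ((Y.det : ℤ) : ℝ) := by
      rw [← RingHom.mapMatrix_apply, ← RingHom.map_det]; rfl
    rw [h2, abs_mul, abs_mul]
    have h3 : |((Y.det : ℤ) : ℝ)| = 1 := by
      rw [← Int.cast_abs, Int.isUnit_iff_abs_eq.1 hunit]; simp
    rw [h3]
    rcases Int.units_eq_one_or (Equiv.Perm.sign τ') with h | h <;> rw [h] <;> simp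
  · simp only [Basis.mk_apply]; exact hunit
  · intro x k hx
    rw [Basis.coe_mk]
    exact hgap x k hx

end Schmidt

end PartG2

section PartW1
open Module

namespace Schmidt

abbrev PS (N p : ℕ) := Set.powersetCard (Fin N) p

noncomputable def emb {N p : ℕ} (s : PS N p) : Fin p ↪o Fin N := Set.powersetCard.ofFinEmbEquiv.symm s

lemma mem_range_emb {N p : ℕ} (s : PS N p) (i : Fin N) : i ∈ Set.range (emb s) ↔ i ∈ s.1 :=
  Set.powersetCard.mem_range_ofFinEmbEquiv_symm_iff_mem s i

lemma emb_surj {N p : ℕ} (f : Fin p ↪o Fin N) : ∃ s : PS N p, emb s = f :=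
  ⟨Set.powersetCard.ofFinEmbEquiv f, by simp [emb]⟩

lemma sum_emb {N p : ℕ} (s : PS N p) (u : Fin N → ℝ) : ∑ i, u (emb s i) = ∑ l ∈ s.1, u l := by
  have h : s.1 = Finset.univ.map (emb s).toEmbedding := by
    ext l
    rw [← mem_range_emb]; simp
  rw [h, Finset.sum_map]; rfl

lemma prod_emb {N p : ℕ} (s : PS N p) (u : Fin N → ℝ) : ∏ i, u (emb s i) = ∏ l ∈ s.1, u l := by
  have h : s.1 = Finset.univ.map (emb s).toEmbedding := by
    ext l
    rw [← mem_range_emb]; simp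
  rw [h, Finset.prod_map]; rfl

noncomputable def cmp {R : Type*} [CommRing R] {N : ℕ} (p : ℕ) (A : Matrix (Fin N) (Fin N) R) : Matrix (PS N p) (PS N p) R :=
  Matrix.of fun s t => (A.submatrix (emb s) (emb t)).det

lemma cmp_eq {R : Type*} [CommRing R] {N : ℕ} (p : ℕ) (A : Matrix (Fin N) (Fin N) R) :
    cmp p A = LinearMap.toMatrix ((Pi.basisFun R (Fin N)).exteriorPower p) ((Pi.basisFun R (Fin N)).exteriorPower p)
      (exteriorPower.map p (Matrix.toLin' A)) := by
  ext s t
  rw [LinearMap.toMatrix_apply, exteriorPower.basis_repr_apply, exteriorPower.basis_apply, exteriorPower.ιMulti_family,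
    exteriorPower.map_apply_ιMulti, exteriorPower.ιMultiDual_apply_ιMulti, cmp, Matrix.of_apply, ← Matrix.det_transpose]
  congr 1
  ext i j
  simp [emb]

lemma cmp_mul {R : Type*} [CommRing R] {N : ℕ} (p : ℕ) (A B : Matrix (Fin N) (Fin N) R) : cmp p (A * B) = cmp p A * cmp p B := by
  rw [cmp_eq, cmp_eq, cmp_eq, Matrix.toLin'_mul, exteriorPower.map_comp, LinearMap.toMatrix_comp _ ((Pi.basisFun R (Fin N)).exteriorPower p)]

lemma cmp_one {R : Type*} [CommRing R] {N : ℕ} (p : ℕ) : cmp p (1 : Matrix (Fin N) (Fin N) R) = 1 := by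
  rw [cmp_eq, Matrix.toLin'_one, exteriorPower.map_id, LinearMap.toMatrix_id]

lemma cmp_transpose {R : Type*} [CommRing R] {N : ℕ} (p : ℕ) (A : Matrix (Fin N) (Fin N) R) : cmp p A.transpose = (cmp p A).transpose := by
  ext s t
  rw [Matrix.transpose_apply, cmp, cmp, Matrix.of_apply, Matrix.of_apply, ← Matrix.det_transpose]
  rfl

lemma cmp_map {R S : Type*} [CommRing R] [CommRing S] (g : R →+* S) {N : ℕ} (p : ℕ) (A : Matrix (Fin N) (Fin N) R) (s t : PS N p) :
    g (cmp p A s t) = cmp p (A.map g) s t := by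
  rw [cmp, cmp, Matrix.of_apply, Matrix.of_apply, RingHom.map_det]
  rfl

lemma cmp_det_ne {R : Type*} [CommRing R] [IsDomain R] {N : ℕ} (p : ℕ) (A : Matrix (Fin N) (Fin N) R) (h : IsUnit A.det) : (cmp p A).det ≠ 0 := by
  have h1 : cmp p A * cmp p A⁻¹ = 1 := by
    rw [← cmp_mul, Matrix.mul_nonsing_inv _ h, cmp_one]
  have h2 := congrArg Matrix.det h1
  rw [Matrix.det_mul, Matrix.det_one] at h2
  exact left_ne_zero_of_mul_eq_one h2

lemma alt_sum_apply {ι α M : Type*} [AddCommGroup M] [Module ℤ M] (t : Finset α) (g : α → M [⋀^ι]→ₗ[ℤ] ℤ) (w : ι → M) :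
    (∑ a ∈ t, g a) w = ∑ a ∈ t, g a w := by
  classical
  induction t using Finset.induction_on with
  | empty => simp
  | insert a t ha ih => rw [Finset.sum_insert ha, Finset.sum_insert ha, AlternatingMap.add_apply, ih]

noncomputable def altF {N p : ℕ} (n : PS N p → ℤ) : (Fin N → ℤ) [⋀^Fin p]→ₗ[ℤ] ℤ :=
  ∑ J, n J • (Matrix.detRowAlternating (n := Fin p) (R := ℤ)).compLinearMap (LinearMap.funLeft ℤ ℤ (emb J))

lemma altF_apply {N p : ℕ} (n : PS N p → ℤ) (w : Fin p → Fin N → ℤ) :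
    altF n w = ∑ J, n J * (Matrix.of fun i j => w i (emb J j)).det := by
  rw [altF, alt_sum_apply]
  rfl

lemma kill {N p : ℕ} (k : Fin N) (n : PS N (p + 1) → ℤ) (hn : n ≠ 0) : ∃ h : Fin N → ℤ, h ≠ 0 ∧
    ∀ b : Basis (Fin N) ℤ (Fin N → ℤ), (∀ S : PS N (p + 1), (∃ i ∈ S.1, i < k) → ∑ J, n J * cmp (p + 1) (Matrix.of fun i j => b i j) S J = 0) →
      ∀ x ∈ Submodule.span ℤ (b '' {i | i < k}), ∑ l, h l * x l = 0 := by
  obtain ⟨J0, hJ0⟩ : ∃ J, n J ≠ 0 := by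
    by_contra hcon
    push Not at hcon
    exact hn (funext hcon)
  have hcmp : ∀ (b : Fin N → Fin N → ℤ) (S : PS N (p + 1)), altF n (fun i => b (emb S i)) = ∑ J, n J * cmp (p + 1) (Matrix.of fun i j => b i j) S J := by
    intro b S
    rw [altF_apply]; rfl
  set E : Fin N → Fin N → ℤ := fun l => Pi.single l 1 with hE
  set w : Fin p → Fin N → ℤ := fun i => E (emb J0 i.succ) with hw
  have hlin : ∀ x : Fin N → ℤ, ∑ l, (altF n).curryLeft (E l) w * x l = (altF n).curryLeft x w := by
    intro x
    have h1 : x = ∑ l, x l • E l := by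
      funext k; simp [hE, Finset.sum_apply, Pi.single_apply]
    conv_rhs => rw [h1]
    rw [map_sum, alt_sum_apply]
    refine Finset.sum_congr rfl fun l _ => ?_
    rw [map_smul, AlternatingMap.smul_apply, smul_eq_mul, mul_comm]
  refine ⟨fun l => (altF n).curryLeft (E l) w, ?_, ?_⟩
  · intro h0
    have h1 := congrFun h0 (emb J0 0)
    simp only [Pi.zero_apply] at h1
    rw [AlternatingMap.curryLeft_apply_apply] at h1
    have h2 : Matrix.vecCons (E (emb J0 0)) w = fun i => E (emb J0 i) := by
      funext i
      refine Fin.cases ?_ (fun i => ?_) i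
      · simp
      · simp [hw]
    rw [h2, hcmp] at h1
    have h3 : (Matrix.of fun i j => E i j) = (1 : Matrix (Fin N) (Fin N) ℤ) := by
      ext i j
      simp only [hE, Matrix.of_apply, Matrix.one_apply, Pi.single_apply]
      simp [eq_comm]
    rw [h3, cmp_one] at h1
    simp [Matrix.one_apply] at h1
    exact hJ0 h1
  · intro b hb x hx
    rw [hlin]
    have key : ∀ s : Fin (p + 1) → Fin N, (∃ i, s i < k) → altF n (fun i => b (s i)) = 0 := by
      rintro s ⟨i0, hi0⟩
      by_cases hs : Function.Injective s
      · have hmono : StrictMono (s ∘ Tuple.sort s) :=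
          (Tuple.monotone_sort s).strictMono_of_injective (hs.comp (Tuple.sort s).injective)
        obtain ⟨S, hS⟩ := emb_surj (OrderEmbedding.ofStrictMono _ hmono)
        have hSi : ∀ i, emb S i = s (Tuple.sort s i) := fun i => by rw [hS]; rfl
        have h1 := hb S ⟨s i0, by
          rw [← mem_range_emb]
          exact ⟨(Tuple.sort s).symm i0, by rw [hSi]; simp⟩, hi0⟩
        rw [← hcmp (fun i => b i) S] at h1
        have h2 : (fun i => b (emb S i)) = (fun i => b (s i)) ∘ (Tuple.sort s) := by
          funext i; simp [hSi]
        rw [h2, AlternatingMap.map_perm] at h1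
        rcases Int.units_eq_one_or (Equiv.Perm.sign (Tuple.sort s)) with h | h
        · rw [h] at h1; simpa using h1
        · rw [h] at h1; simpa using h1
      · refine AlternatingMap.map_eq_zero_of_not_injective _ _ ?_
        intro h
        apply hs
        intro i j hij
        exact h (by simp only [hij])
    have hcur : ∀ i, i < k → (altF n).curryLeft (b i) = 0 := by
      intro i hi
      refine Basis.ext_alternating b ?_
      intro v _
      rw [AlternatingMap.curryLeft_apply_apply]
      have h1 := key (Fin.cons i v) ⟨0, by simpa using hi⟩
      have h2 : (fun j => b ((Fin.cons i v : Fin (p+1) → Fin N) j)) = Matrix.vecCons (b i) (fun i => b (v i)) := by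
        funext j
        refine Fin.cases ?_ (fun j => ?_) j <;> simp
      rw [h2] at h1
      rw [h1]; rfl
    have hsp : Submodule.span ℤ (b '' {i | i < k}) ≤ LinearMap.ker (altF n).curryLeft := by
      rw [Submodule.span_le]
      rintro _ ⟨i, hi, rfl⟩
      exact hcur i hi
    have := hsp hx
    rw [LinearMap.mem_ker] at this
    rw [this]; rfl

end Schmidt

end PartW1

section PartW2
open Module NumberField Filter

namespace Schmidt

lemma det_rpow_bound {p : ℕ} (M : Matrix (Fin p) (Fin p) ℝ) (g : Fin p → Fin p → ℝ) (C Q G : ℝ) (hC : 0 ≤ C) (hQ : 1 ≤ Q)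
    (hM : ∀ i j, |M i j| ≤ C * Q ^ g i j) (hg : ∀ ρ : Equiv.Perm (Fin p), ∑ i, g (ρ i) i ≤ G) :
    |M.det| ≤ p.factorial * C ^ p * Q ^ G := by
  have hQ0 : 0 < Q := by linarith
  rw [Matrix.det_apply]
  refine (Finset.abs_sum_le_sum_abs _ _).trans ?_
  have hterm : ∀ ρ ∈ (Finset.univ : Finset (Equiv.Perm (Fin p))), |Equiv.Perm.sign ρ • ∏ i, M (ρ i) i| ≤ C ^ p * Q ^ G := by
    intro ρ _
    have hsign : |Equiv.Perm.sign ρ • ∏ i, M (ρ i) i| = |∏ i, M (ρ i) i| := by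
      rcases Int.units_eq_one_or (Equiv.Perm.sign ρ) with h | h <;> rw [h] <;> simp [Units.smul_def]
    rw [hsign, Finset.abs_prod]
    refine (Finset.prod_le_prod (fun _ _ => abs_nonneg _) (fun i _ => hM (ρ i) i)).trans ?_
    rw [Finset.prod_mul_distrib, Finset.prod_const, Finset.card_univ, Fintype.card_fin, ← Real.rpow_sum_of_pos hQ0]
    exact mul_le_mul_of_nonneg_left (Real.rpow_le_rpow_of_exponent_le hQ (hg ρ)) (by positivity)
  refine (Finset.sum_le_sum hterm).trans (le_of_eq ?_)
  rw [Finset.sum_const, nsmul_eq_mul, Finset.card_univ, Fintype.card_perm, Fintype.card_fin, mul_assoc]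

lemma sum_PS {N p : ℕ} (u : Fin N → ℝ) : ∃ m : ℕ, m ≤ 2 ^ N ∧ ∑ I : PS N (p + 1), ∑ l ∈ I.1, u l = m * ∑ l, u l := by
  refine ⟨(N - 1).choose p, (Nat.choose_le_two_pow _ _).trans (Nat.pow_le_pow_right (by norm_num) (Nat.sub_le _ _)), ?_⟩
  have h1 : ∑ I : PS N (p + 1), ∑ l ∈ I.1, u l = ∑ I ∈ Finset.powersetCard (p + 1) (Finset.univ : Finset (Fin N)), ∑ l ∈ I, u l := by
    refine Finset.sum_bij (fun I _ => I.1) ?_ ?_ ?_ ?_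
    · intro I _
      rw [Finset.mem_powersetCard]; exact ⟨Finset.subset_univ _, I.2⟩
    · intro I _ J _ h; exact Subtype.ext h
    · intro I hI
      rw [Finset.mem_powersetCard] at hI
      exact ⟨⟨I, hI.2⟩, Finset.mem_univ _, rfl⟩
    · intro I _; rfl
  rw [h1]
  have h2 : ∀ I : Finset (Fin N), ∑ l ∈ I, u l = ∑ l, if l ∈ I then u l else 0 := fun I => by simp
  rw [Finset.sum_congr rfl fun I _ => h2 I, Finset.sum_comm, Finset.mul_sum]
  refine Finset.sum_congr rfl fun l _ => ?_
  rw [← Finset.sum_filter, Finset.sum_const, nsmul_eq_mul]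
  congr 2
  have := Finset.card_filter_powersetCard_subset {l} (Finset.univ : Finset (Fin N)) (p + 1) (Finset.subset_univ _) (by simp)
  simpa using this

lemma sum_swap {N p : ℕ} (k : Fin N) (e : Fin N → ℝ) (D : ℝ) (hD : 0 ≤ D) (he : ∀ i j, i < k → k ≤ j → e i ≤ e j - D)
    (I S : Finset (Fin N)) (hI : ∀ l, l ∈ I ↔ k ≤ l) (hcard : S.card = I.card) (hS : ∃ i ∈ S, i < k) : ∑ l ∈ S, e l ≤ ∑ l ∈ I, e l - D := by
  have h1 : (S \ I).card = (I \ S).card := Finset.card_sdiff_comm hcard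
  have h2 : ∑ l ∈ S, e l = ∑ l ∈ S \ I, e l + ∑ l ∈ S ∩ I, e l := by
    rw [add_comm, Finset.sum_inter_add_sum_sdiff]
  have h3 : ∑ l ∈ I, e l = ∑ l ∈ I \ S, e l + ∑ l ∈ S ∩ I, e l := by
    rw [add_comm, Finset.inter_comm, Finset.sum_inter_add_sum_sdiff]
  obtain ⟨i0, hi0, hik⟩ := hS
  have hmem : i0 ∈ S \ I := by
    rw [Finset.mem_sdiff, hI]; exact ⟨hi0, not_le.2 hik⟩
  have hne : (I \ S).Nonempty := by
    rw [← Finset.card_pos, ← h1]; exact Finset.card_pos.2 ⟨i0, hmem⟩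
  obtain ⟨j0, hj0, hmin⟩ := Finset.exists_min_image (I \ S) e hne
  have hj0k : k ≤ j0 := (hI j0).1 (Finset.mem_sdiff.1 hj0).1
  have h4 : ∑ l ∈ S \ I, e l ≤ (S \ I).card • (e j0 - D) := by
    refine Finset.sum_le_card_nsmul _ _ _ ?_
    intro l hl
    rw [Finset.mem_sdiff, hI] at hl
    exact he l j0 (not_le.1 hl.2) hj0k
  have h5 : (I \ S).card • e j0 ≤ ∑ l ∈ I \ S, e l := Finset.card_nsmul_le_sum _ _ _ hmin
  have h6 : (1:ℝ) ≤ ((I \ S).card : ℝ) := by exact_mod_cast Finset.card_pos.2 hne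
  rw [h1] at h4
  rw [nsmul_eq_mul] at h4 h5
  nlinarith

theorem wedge_step {K : Type*} [Field K] [NumberField K] (σ : K →+* ℝ) {N : ℕ} (L : Fin N → Fin N → K) (hdet : (Matrix.of L).det ≠ 0)
    (c : Fin N → ℝ) (k : Fin N) (hk : 0 < k.val) (e : Fin N → ℝ) (τ : Equiv.Perm (Fin N)) (C ε D : ℝ) (hC : 1 ≤ C) (hε : 0 < ε) (hD : 0 < D)
    (h1 : ∑ l, (e l + c (τ l)) ≤ (N + 1) * ε) (h2 : ∀ i j, i < k → k ≤ j → e i ≤ e j - D) (hεD : 2 ^ N * (N + 2) * ε < D)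
    (P : ℝ → (Fin N → ℤ) → Prop)
    (hfr : ∃ᶠ Q : ℝ in atTop, ∃ (b : Basis (Fin N) ℤ (Fin N → ℤ)) (x : Fin N → ℤ),
      (∀ i l, |∑ j, σ (L (τ l) j) * (b i j : ℝ)| ≤ C * Q ^ (min (e l) (e i) + c (τ l))) ∧ IsUnit (Matrix.of fun i j => b i j).det ∧
      x ∈ Submodule.span ℤ (b '' {i | i < k}) ∧ P Q x) :
    ∃ h : Fin N → ℤ, h ≠ 0 ∧ ∃ᶠ Q : ℝ in atTop, ∃ x : Fin N → ℤ, ∑ l, h l * x l = 0 ∧ P Q x := by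
  classical
  obtain ⟨p, hp⟩ : ∃ p, N - k.val = p + 1 := ⟨N - k.val - 1, by have := k.2; omega⟩
  set I0 : PS N (p + 1) := ⟨Finset.Ici k, by
    rw [Set.powersetCard.mem_iff, Fin.card_Ici, hp]⟩ with hI0
  have hI0mem : ∀ l, l ∈ I0.1 ↔ k ≤ l := fun l => by simp [hI0]
  have hne : ∀ S : PS N (p + 1), S ≠ I0 ↔ ∃ i ∈ S.1, i < k := by
    intro S
    constructor
    · intro h
      obtain ⟨i, hi, hi2⟩ := (Set.powersetCard.exists_mem_notMem_iff_ne S I0).1 h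
      exact ⟨i, hi, not_le.1 fun h' => hi2 ((hI0mem i).2 h')⟩
    · rintro ⟨i, hi, hik⟩ rfl
      exact absurd ((hI0mem i).1 hi) (not_le.2 hik)
  set a : PS N (p + 1) → ℝ := fun I => ∑ l ∈ I.1, (e l + c (τ l)) + ε + (if I = I0 then -D else 0) with ha
  have hcardPS : (Fintype.card (PS N (p + 1)) : ℝ) ≤ 2 ^ N := by
    have h : Fintype.card (PS N (p + 1)) ≤ Fintype.card (Finset (Fin N)) := Fintype.card_le_of_injective (fun s => s.1) Subtype.val_injective
    rw [Fintype.card_finset, Fintype.card_fin] at h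
    exact_mod_cast h
  have hsum : ∑ I, a I < 0 := by
    obtain ⟨m, hm, hms⟩ := sum_PS (p := p) (fun l => e l + c (τ l))
    rw [ha]
    rw [Finset.sum_add_distrib, Finset.sum_add_distrib, hms, Finset.sum_const, nsmul_eq_mul, Finset.card_univ, Finset.sum_ite_eq' Finset.univ I0]
    simp only [Finset.mem_univ, if_true]
    have hmr : (m:ℝ) ≤ 2 ^ N := by exact_mod_cast hm
    have h3 : (m:ℝ) * ∑ l, (e l + c (τ l)) ≤ 2 ^ N * ((N + 1) * ε) :=
      (mul_le_mul_of_nonneg_left h1 (by positivity)).trans (mul_le_mul_of_nonneg_right hmr (by positivity))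
    have h4 : (Fintype.card (PS N (p + 1)) : ℝ) * ε ≤ 2 ^ N * ε := mul_le_mul_of_nonneg_right hcardPS hε.le
    nlinarith
  set Lp : Matrix (Fin N) (Fin N) K := Matrix.of fun i j => L (τ i) j with hLp
  have hLpdet : IsUnit Lp.det := by
    have : Lp = (Matrix.of L).submatrix τ id := rfl
    rw [this, Matrix.det_permute]
    refine isUnit_iff_ne_zero.2 (mul_ne_zero ?_ hdet)
    rcases Int.units_eq_one_or (Equiv.Perm.sign τ) with h | h <;> rw [h] <;> simp
  have hpen := penult σ (Equiv.optionSubtypeNe I0) (fun I J => cmp (p + 1) Lp I J) (cmp_det_ne (p + 1) Lp hLpdet) a hsum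
    (fun Q z => ∃ (b : Basis (Fin N) ℤ (Fin N → ℤ)) (x : Fin N → ℤ), (∀ S J, z S J = cmp (p + 1) (Matrix.of fun i j => b i j) S.1 J) ∧
      x ∈ Submodule.span ℤ (b '' {i | i < k}) ∧ P Q x) ?_
  · obtain ⟨n, hn, hfr2⟩ := hpen
    obtain ⟨h, hh, hkill⟩ := kill k n hn
    refine ⟨h, hh, hfr2.mono ?_⟩
    rintro Q ⟨z, hz0, _, b, x, hzb, hx, hP⟩
    refine ⟨x, hkill b ?_ x hx, hP⟩
    intro S hS
    have := hz0 ⟨S, (hne S).2 hS⟩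
    simpa only [hzb] using this
  · have hev : ∀ᶠ Q : ℝ in atTop, ((p + 1).factorial : ℝ) * C ^ (p + 1) ≤ Q ^ ε := (tendsto_rpow_atTop hε).eventually_ge_atTop _
    refine (hfr.and_eventually (hev.and (eventually_ge_atTop 1))).mono ?_
    rintro Q ⟨⟨b, x, hb, hunit, hx, hP⟩, hQε, hQ1⟩
    have hQ0 : 0 < Q := by linarith
    refine ⟨fun S J => cmp (p + 1) (Matrix.of fun i j => b i j) S.1 J, ?_, ?_, b, x, fun _ _ => rfl, hx, hP⟩
    · have h3 : LinearIndependent ℚ ((cmp (p + 1) (Matrix.of fun i j => b i j)).map (Int.castRingHom ℚ)).row := by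
        refine Matrix.linearIndependent_rows_of_det_ne_zero (A := (cmp (p + 1) (Matrix.of fun i j => b i j)).map (Int.castRingHom ℚ)) ?_
        rw [← RingHom.mapMatrix_apply, ← RingHom.map_det]
        have := cmp_det_ne (p + 1) (Matrix.of fun i j => b i j) hunit
        rw [eq_intCast]; exact_mod_cast this
      exact h3.comp (fun S : {S // S ≠ I0} => S.1) Subtype.val_injective
    · intro I S
      have hcb : ∑ J, σ (cmp (p + 1) Lp I J) * ((cmp (p + 1) (Matrix.of fun i j => b i j) S.1 J : ℤ) : ℝ)
          = (Matrix.of fun i j => ∑ l, σ (L (τ (emb I i)) l) * (b (emb S.1 j) l : ℝ)).det := by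
        have h3 := congrFun (congrFun (cmp_mul (p + 1) (Lp.map σ) (((Matrix.of fun i j => b i j).map (Int.castRingHom ℝ)).transpose)) I) S.1
        rw [Matrix.mul_apply] at h3
        have h4 : ∀ J, cmp (p + 1) (Lp.map σ) I J * cmp (p + 1) (((Matrix.of fun i j => b i j).map (Int.castRingHom ℝ)).transpose) J S.1
            = σ (cmp (p + 1) Lp I J) * ((cmp (p + 1) (Matrix.of fun i j => b i j) S.1 J : ℤ) : ℝ) := by
          intro J
          rw [cmp_transpose, Matrix.transpose_apply, ← cmp_map, ← cmp_map]; rfl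
        simp only [h4] at h3
        rw [← h3]; rfl
      rw [hcb]
      have hfinal : ∀ G, (∀ ρ : Equiv.Perm (Fin (p + 1)), ∑ i, (min (e (emb I (ρ i))) (e (emb S.1 i)) + c (τ (emb I (ρ i)))) ≤ G) →
          |(Matrix.of fun i j => ∑ l, σ (L (τ (emb I i)) l) * (b (emb S.1 j) l : ℝ)).det| ≤ Q ^ (G + ε) := by
        intro G hG
        refine (det_rpow_bound _ (fun i j => min (e (emb I i)) (e (emb S.1 j)) + c (τ (emb I i))) C Q G (by linarith) hQ1 (fun i j => hb _ _) hG).trans ?_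
        rw [add_comm G, Real.rpow_add hQ0]
        exact mul_le_mul_of_nonneg_right hQε (by positivity)
      by_cases hII : I = I0
      · have h3 := hfinal (∑ l ∈ I.1, (e l + c (τ l)) - D) ?_
        · refine h3.trans (le_of_eq ?_)
          congr 1
          rw [ha]; simp only [hII, if_true]; ring
        · intro ρ
          have h4 := sum_swap (p := p) k e D hD.le h2 I.1 S.1.1 (by rw [hII]; exact hI0mem) (by rw [S.1.2, I.2]) ((hne S.1).1 S.2)
          calc ∑ i, (min (e (emb I (ρ i))) (e (emb S.1 i)) + c (τ (emb I (ρ i)))) ≤ ∑ i, (e (emb S.1 i) + c (τ (emb I (ρ i)))) :=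
                Finset.sum_le_sum fun i _ => by have := min_le_right (e (emb I (ρ i))) (e (emb S.1 i)); linarith
            _ = ∑ l ∈ S.1.1, e l + ∑ l ∈ I.1, c (τ l) := by
                rw [Finset.sum_add_distrib, sum_emb S.1 e, Equiv.sum_comp ρ (fun i => c (τ (emb I i))), sum_emb I (fun l => c (τ l))]
            _ ≤ _ := by rw [Finset.sum_add_distrib]; linarith
      · have h3 := hfinal (∑ l ∈ I.1, (e l + c (τ l))) ?_
        · refine h3.trans (le_of_eq ?_)
          congr 1
          rw [ha]; simp only [hII, if_false]; ring
        · intro ρ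
          calc ∑ i, (min (e (emb I (ρ i))) (e (emb S.1 i)) + c (τ (emb I (ρ i)))) ≤ ∑ i, (e (emb I (ρ i)) + c (τ (emb I (ρ i)))) :=
                Finset.sum_le_sum fun i _ => by have := min_le_left (e (emb I (ρ i))) (e (emb S.1 i)); linarith
            _ = _ := by
                rw [Equiv.sum_comp ρ (fun i => e (emb I i) + c (τ (emb I i))), sum_emb I (fun l => e l + c (τ l))]

end Schmidt

end PartW2

section PartW3
open Module NumberField Filter

namespace Schmidt

lemma matrix_lower {N : ℕ} (A : Matrix (Fin N) (Fin N) ℝ) (hA : A.det ≠ 0) :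
    ∃ C : ℝ, 0 < C ∧ ∀ (x : Fin N → ℤ) (M : ℝ), x ≠ 0 → (∀ l, |∑ j, A l j * (x j : ℝ)| ≤ M) → 1 ≤ C * M := by
  refine ⟨∑ i, ∑ j, |A⁻¹ i j| + 1, by positivity, ?_⟩
  intro x M hx hM
  obtain ⟨i, hi⟩ : ∃ i, x i ≠ 0 := Function.ne_iff.1 hx
  have hM0 : 0 ≤ M := (abs_nonneg _).trans (hM i)
  have h1 : (1:ℝ) ≤ |(x i : ℝ)| := by exact_mod_cast Int.one_le_abs hi
  have h2 : (x i : ℝ) = ∑ j, A⁻¹ i j * ∑ l, A j l * (x l : ℝ) := by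
    have h3 : A⁻¹.mulVec (A.mulVec (fun l => (x l : ℝ))) = fun l => (x l : ℝ) := by
      rw [Matrix.mulVec_mulVec, Matrix.nonsing_inv_mul _ (isUnit_iff_ne_zero.2 hA), Matrix.one_mulVec]
    exact (congrFun h3 i).symm
  have h4 : |(x i : ℝ)| ≤ ∑ j, |A⁻¹ i j| * M := by
    rw [h2]
    refine (Finset.abs_sum_le_sum_abs _ _).trans (Finset.sum_le_sum fun j _ => ?_)
    rw [abs_mul]
    exact mul_le_mul_of_nonneg_left (hM j) (abs_nonneg _)
  rw [← Finset.sum_mul] at h4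
  have h5 : ∑ j, |A⁻¹ i j| ≤ ∑ i, ∑ j, |A⁻¹ i j| :=
    Finset.single_le_sum (f := fun i => ∑ j, |A⁻¹ i j|) (fun i _ => Finset.sum_nonneg fun _ _ => abs_nonneg _) (Finset.mem_univ i)
  nlinarith

lemma scaled_det {N : ℕ} (A : Matrix (Fin N) (Fin N) ℝ) (c : Fin N → ℝ) (Q : ℝ) (hQ : 0 < Q) :
    |(Matrix.of fun i j => Q ^ (-c i) * A i j).det| = Q ^ (-∑ i, c i) * |A.det| := by
  rw [Matrix.det_mul_column (fun i => Q ^ (-c i)) A, abs_mul, ← Finset.sum_neg_distrib, Real.rpow_sum_of_pos hQ, abs_of_pos]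
  exact Finset.prod_pos fun i _ => Real.rpow_pos_of_pos hQ _

lemma eventually_mul_rpow_le (C a b : ℝ) (hab : a < b) : ∀ᶠ Q : ℝ in atTop, C * Q ^ a < Q ^ b := by
  have h : ∀ᶠ Q : ℝ in atTop, C < Q ^ (b - a) := (tendsto_rpow_atTop (sub_pos.2 hab)).eventually_gt_atTop _
  filter_upwards [h, eventually_gt_atTop 0] with Q h1 hQ
  rw [Real.rpow_sub hQ, lt_div_iff₀ (Real.rpow_pos_of_pos hQ _)] at h1
  exact h1

lemma box_reduce {N : ℕ} (hN : 0 < N) (A : Matrix (Fin N) (Fin N) ℝ) (hA : A.det ≠ 0) (c : Fin N → ℝ) (hc : ∑ i, c i < 0) (δ' : ℝ) (hδ' : 0 < δ')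
    (hδ'c : N * N * δ' < -∑ i, c i) :
    ∃ C B : ℝ, 1 ≤ C ∧ 0 < B ∧ ∀ᶠ Q : ℝ in atTop, ∀ x : Fin N → ℤ, x ≠ 0 → (∀ i, |∑ j, A i j * (x j : ℝ)| ≤ Q ^ c i) →
      ∃ (b : Basis (Fin N) ℤ (Fin N → ℤ)) (τ : Equiv.Perm (Fin N)) (μ : Fin N → ℝ) (k : Fin N),
        (∀ i, Q ^ (-B) ≤ μ i ∧ μ i ≤ Q ^ B) ∧ (∀ i l, |∑ j, A (τ l) j * (b i j : ℝ)| ≤ C * (min (μ l) (μ i) * Q ^ c (τ l))) ∧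
        ∏ i, μ i = Q ^ (-∑ i, c i) * |A.det| ∧ IsUnit (Matrix.of fun i j => b i j).det ∧
        x ∈ Submodule.span ℤ (b '' {i | i < k}) ∧ ∀ i j, i < k → k ≤ j → Q ^ δ' * μ i ≤ C * μ j := by
  obtain ⟨C, hC, hred⟩ := reduce_matrix N
  obtain ⟨CA, hCA, hlow⟩ := matrix_lower A hA
  set δ := -∑ i, c i with hδ
  have hδ0 : 0 < δ := by rw [hδ]; linarith
  set B0 : ℝ := ∑ i, |c i| + 1 with hB0
  have hcB0 : ∀ i, c i ≤ B0 - 1 := fun i => by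
    have := Finset.single_le_sum (f := fun i => |c i|) (fun i _ => abs_nonneg _) (Finset.mem_univ i)
    have h2 := le_abs_self (c i)
    linarith
  have hB0p : 0 < B0 := by positivity
  refine ⟨C, N * B0 + δ + 1 + B0, hC, by positivity, ?_⟩
  have e1 := eventually_mul_rpow_le (CA * C) (B0 - 1) B0 (by linarith)
  have e2 := eventually_mul_rpow_le |A.det| (N * B0 + δ) (N * B0 + δ + 1) (by linarith)
  have e3 := eventually_mul_rpow_le (C ^ N / |A.det|) (N * N * δ') δ hδ'c
  filter_upwards [e1, e2, e3, eventually_ge_atTop 1] with Q q1 q2 q3 hQ1 x hx hxb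
  have hQ0 : 0 < Q := by linarith
  have hdp : 0 < |A.det| := abs_pos.2 hA
  set AQ : Matrix (Fin N) (Fin N) ℝ := Matrix.of fun i j => Q ^ (-c i) * A i j with hAQ
  have hdet : |AQ.det| = Q ^ δ * |A.det| := scaled_det A c Q hQ0
  have hAQ0 : AQ.det ≠ 0 := by
    rw [← abs_pos, hdet]; exact mul_pos (Real.rpow_pos_of_pos hQ0 _) hdp
  obtain ⟨b, τ, μ, hμ, hmono, hbd, hprod, hunit, hspan⟩ := hred AQ hAQ0
  have hAQs : ∀ (l : Fin N) (y : Fin N → ℤ), ∑ j, AQ l j * (y j : ℝ) = Q ^ (-c l) * ∑ j, A l j * (y j : ℝ) := by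
    intro l y
    rw [Finset.mul_sum]
    exact Finset.sum_congr rfl fun j _ => by rw [hAQ, Matrix.of_apply, mul_assoc]
  have hAs : ∀ (l : Fin N) (y : Fin N → ℤ), |∑ j, A l j * (y j : ℝ)| = Q ^ c l * |∑ j, AQ l j * (y j : ℝ)| := by
    intro l y
    rw [hAQs, abs_mul, abs_of_pos (Real.rpow_pos_of_pos hQ0 _), ← mul_assoc, ← Real.rpow_add hQ0]
    simp
  have hAx : ∀ l, |∑ j, AQ l j * (x j : ℝ)| ≤ 1 := by
    intro l
    have h := hxb l
    rw [hAs] at h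
    have hp := Real.rpow_pos_of_pos hQ0 (c l)
    nlinarith
  have hlb : ∀ i l, |∑ j, A (τ l) j * (b i j : ℝ)| ≤ C * (min (μ l) (μ i) * Q ^ c (τ l)) := by
    intro i l
    rw [hAs]
    have h := hbd i l
    have hp := Real.rpow_pos_of_pos hQ0 (c (τ l))
    calc Q ^ c (τ l) * |∑ j, AQ (τ l) j * (b i j : ℝ)| ≤ Q ^ c (τ l) * (C * min (μ l) (μ i)) := mul_le_mul_of_nonneg_left h hp.le
      _ = _ := by ring
  have hmulow : ∀ i, Q ^ (-B0) ≤ μ i := by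
    intro i
    have h := hlow (b i) (C * (μ i * Q ^ (B0 - 1))) (b.ne_zero i) ?_
    · rw [Real.rpow_neg hQ0.le, inv_le_iff_one_le_mul₀ (Real.rpow_pos_of_pos hQ0 _)]
      have hmi := hμ i
      nlinarith
    · intro l
      have h2 := hlb i (τ.symm l)
      rw [Equiv.apply_symm_apply] at h2
      refine h2.trans (mul_le_mul_of_nonneg_left ?_ (by linarith))
      exact mul_le_mul (min_le_right _ _) (Real.rpow_le_rpow_of_exponent_le hQ1 (hcB0 l)) (by positivity) (hμ i).le
  have hmuup : ∀ i, μ i ≤ Q ^ (N * B0 + δ + 1) := by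
    intro i
    have h1 : ∀ j, 1 ≤ μ j * Q ^ B0 := by
      intro j
      have h := hmulow j
      rwa [Real.rpow_neg hQ0.le, inv_le_iff_one_le_mul₀ (Real.rpow_pos_of_pos hQ0 _)] at h
    have h2 : μ i * Q ^ B0 ≤ ∏ j, (μ j * Q ^ B0) := by
      rw [← Finset.mul_prod_erase _ _ (Finset.mem_univ i)]
      refine le_mul_of_one_le_right (by linarith [h1 i]) ?_
      refine Finset.prod_induction _ (fun z => 1 ≤ z) (fun a b ha hb => one_le_mul_of_one_le_of_one_le ha hb) le_rfl fun j _ => h1 j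
    rw [Finset.prod_mul_distrib, Finset.prod_const, Finset.card_univ, Fintype.card_fin, hprod, hdet] at h2
    have h3 : μ i ≤ μ i * Q ^ B0 := le_mul_of_one_le_right (hμ i).le (Real.one_le_rpow hQ1 hB0p.le)
    refine (h3.trans h2).trans (le_trans (le_of_eq ?_) q2.le)
    rw [Real.rpow_add hQ0 (N * B0), mul_comm (N:ℝ), Real.rpow_mul hQ0.le, Real.rpow_natCast]
    ring
  have hex : ∃ k : Fin N, C * Q ^ (k.val * δ') < μ k := by
    by_contra hcon
    push Not at hcon
    have h1 : ∏ i, μ i ≤ ∏ _i : Fin N, (C * Q ^ (N * δ')) := by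
      refine Finset.prod_le_prod (fun i _ => (hμ i).le) fun i _ => (hcon i).trans ?_
      refine mul_le_mul_of_nonneg_left (Real.rpow_le_rpow_of_exponent_le hQ1 ?_) (by linarith)
      exact mul_le_mul_of_nonneg_right (by exact_mod_cast i.2.le) hδ'.le
    rw [Finset.prod_const, Finset.card_univ, Fintype.card_fin, hprod, hdet, mul_pow, ← Real.rpow_mul_natCast hQ0.le] at h1
    rw [div_mul_eq_mul_div, div_lt_iff₀ hdp] at q3
    have : (N:ℝ) * δ' * N = N * N * δ' := by ring
    rw [this] at h1
    linarith
  classical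
  obtain ⟨k, hk, hmin⟩ : ∃ k : Fin N, C * Q ^ (k.val * δ') < μ k ∧ ∀ i, i < k → μ i ≤ C * Q ^ (i.val * δ') := by
    obtain ⟨k, hk, hm⟩ := Finset.exists_min_image (Finset.univ.filter fun k : Fin N => C * Q ^ (k.val * δ') < μ k) id
      (by obtain ⟨k, hk⟩ := hex; exact ⟨k, by simpa using hk⟩)
    refine ⟨k, by simpa using hk, fun i hi => ?_⟩
    by_contra hcon
    push Not at hcon
    exact absurd (hm i (by simpa using hcon)) (not_le.2 hi)
  refine ⟨b, τ, μ, k, ?_, hlb, by rw [hprod, hdet], hunit, ?_, ?_⟩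
  · intro i
    refine ⟨le_trans (Real.rpow_le_rpow_of_exponent_le hQ1 ?_) (hmulow i), (hmuup i).trans (Real.rpow_le_rpow_of_exponent_le hQ1 ?_)⟩
    · have : 0 ≤ N * B0 := by positivity
      linarith
    · linarith
  · refine hspan x k fun l => lt_of_le_of_lt ?_ hk
    refine mul_le_mul_of_nonneg_left ((hAx l).trans (Real.one_le_rpow hQ1 (by positivity))) (by linarith)
  · intro i j hi hj
    have h1 := hmin i hi
    have h2 := hmono k j hj
    have h3 : Q ^ δ' * μ i ≤ C * Q ^ (k.val * δ') := by
      refine (mul_le_mul_of_nonneg_left h1 (by positivity)).trans ?_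
      rw [mul_left_comm, ← Real.rpow_add hQ0]
      refine mul_le_mul_of_nonneg_left (Real.rpow_le_rpow_of_exponent_le hQ1 ?_) (by linarith)
      have : ((i.val + 1 : ℕ) : ℝ) ≤ k.val := by exact_mod_cast hi
      push_cast at this
      nlinarith
    linarith

lemma frequently_exists_finite {α ι : Type*} [Finite ι] {l : Filter α} {p : ι → α → Prop} (h : ∃ᶠ a in l, ∃ i, p i a) : ∃ i, ∃ᶠ a in l, p i a := by
  by_contra hcon
  push Not at hcon
  apply h
  have := eventually_all.2 hcon
  filter_upwards [this] with a ha
  rintro ⟨i, hi⟩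
  exact ha i hi

theorem subspace {K : Type*} [Field K] [NumberField K] (σ : K →+* ℝ) {N : ℕ} (L : Fin N → Fin N → K) (hdet : (Matrix.of L).det ≠ 0)
    (c : Fin N → ℝ) (hc : ∑ i, c i < 0) (P : ℝ → (Fin N → ℤ) → Prop)
    (hfr : ∃ᶠ Q : ℝ in atTop, ∃ x : Fin N → ℤ, x ≠ 0 ∧ (∀ i, |∑ j, σ (L i j) * (x j : ℝ)| ≤ Q ^ c i) ∧ P Q x) :
    ∃ h : Fin N → ℤ, h ≠ 0 ∧ ∃ᶠ Q : ℝ in atTop, ∃ x : Fin N → ℤ, ∑ l, h l * x l = 0 ∧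
      x ≠ 0 ∧ (∀ i, |∑ j, σ (L i j) * (x j : ℝ)| ≤ Q ^ c i) ∧ P Q x := by
  classical
  rcases Nat.eq_zero_or_pos N with rfl | hN
  · simp at hc
  set δ := -∑ i, c i with hδ
  have hδ0 : 0 < δ := by rw [hδ]; linarith
  have hNr : (0:ℝ) < N := by exact_mod_cast hN
  set δ' : ℝ := δ / (2 * N * N) with hδ'
  have hδ'0 : 0 < δ' := by positivity
  have hA : ((Matrix.of L).map σ).det ≠ 0 := by
    rw [← RingHom.mapMatrix_apply, ← RingHom.map_det]
    exact (map_ne_zero σ).2 hdet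
  obtain ⟨C, B, hC, hB, hev⟩ := box_reduce hN ((Matrix.of L).map σ) hA c hc δ' hδ'0 (by
    rw [hδ', ← hδ]
    have : (N:ℝ) * N * (δ / (2 * N * N)) = δ / 2 := by field_simp
    linarith)
  set E : ℝ := 2 ^ N * (N + 2) + 2 with hE
  have hE0 : 0 < E := by positivity
  set ε : ℝ := δ' / (2 * E) with hε
  have hε0 : 0 < ε := by positivity
  set D : ℝ := δ' - 2 * ε with hD
  have hδE : δ' = 2 * E * ε := by rw [hε]; field_simp
  have hεD : 2 ^ N * (N + 2) * ε < D := by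
    rw [hD, hδE, hE]
    have : 0 < 2 ^ N * ((N:ℝ) + 2) * ε := by positivity
    nlinarith
  have hD0 : 0 < D := lt_trans (by positivity) hεD
  set R : ℤ := ⌈B / ε⌉ + 1 with hR
  have e1 := eventually_mul_rpow_le |((Matrix.of L).map σ).det| 0 ε hε0
  have e2 := eventually_mul_rpow_le C 0 ε hε0
  have key : ∃ᶠ Q : ℝ in atTop, ∃ d : Fin N × Equiv.Perm (Fin N) × (Fin N → Set.Icc (-R) R),
      (0 < d.1.val ∧ ∑ l, (ε * ((d.2.2 l).1 : ℝ) + c (d.2.1 l)) ≤ (N + 1) * ε ∧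
        ∀ i j, i < d.1 → d.1 ≤ j → ε * ((d.2.2 i).1 : ℝ) ≤ ε * ((d.2.2 j).1 : ℝ) - D) ∧
      ∃ (b : Basis (Fin N) ℤ (Fin N → ℤ)) (x : Fin N → ℤ),
      (∀ i l, |∑ j, σ (L (d.2.1 l) j) * (b i j : ℝ)| ≤ C * Q ^ (min (ε * ((d.2.2 l).1 : ℝ)) (ε * ((d.2.2 i).1 : ℝ)) + c (d.2.1 l))) ∧
      IsUnit (Matrix.of fun i j => b i j).det ∧ x ∈ Submodule.span ℤ (b '' {i | i < d.1}) ∧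
      x ≠ 0 ∧ (∀ i, |∑ j, σ (L i j) * (x j : ℝ)| ≤ Q ^ c i) ∧ P Q x := by
    refine (hfr.and_eventually (hev.and (e1.and (e2.and (eventually_gt_atTop 1))))).mono ?_
    rintro Q ⟨⟨x, hx, hxb, hP⟩, hev, q1, q2, hQ1⟩
    have hQ0 : 0 < Q := by linarith
    obtain ⟨b, τ, μ, k, hμB, hlb, hprod, hunit, hspan, hgap⟩ := hev x hx hxb
    have hμ : ∀ i, 0 < μ i := fun i => (Real.rpow_pos_of_pos hQ0 _).trans_le (hμB i).1
    have hlog : 0 < Real.log Q := Real.log_pos hQ1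
    set s : Fin N → ℝ := fun i => Real.log (μ i) / Real.log Q with hs
    have hμs : ∀ i, μ i = Q ^ s i := by
      intro i
      rw [Real.rpow_def_of_pos hQ0, hs]
      simp only
      rw [mul_div_cancel₀ _ hlog.ne', Real.exp_log (hμ i)]
    have hsB : ∀ i, -B ≤ s i ∧ s i ≤ B := by
      intro i
      have h := hμB i
      rw [hμs, Real.rpow_le_rpow_left_iff hQ1, Real.rpow_le_rpow_left_iff hQ1] at h
      exact h
    have hBε : B / ε ≤ R - 1 := by rw [hR]; push_cast; linarith [Int.le_ceil (B / ε)]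
    have ht : ∀ i, ⌈s i / ε⌉ ∈ Set.Icc (-R) R := by
      intro i
      have h1 : s i / ε ≤ B / ε := div_le_div_of_nonneg_right (hsB i).2 hε0.le
      have h2 : -(B / ε) ≤ s i / ε := by rw [← neg_div]; exact div_le_div_of_nonneg_right (hsB i).1 hε0.le
      have h3 := Int.le_ceil (s i / ε)
      have h4 := Int.ceil_lt_add_one (s i / ε)
      constructor
      · have : ((-R : ℤ) : ℝ) ≤ ⌈s i / ε⌉ := by push_cast; linarith
        exact_mod_cast this
      · have : ((⌈s i / ε⌉ : ℤ) : ℝ) ≤ R := by linarith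
        exact_mod_cast this
    set e : Fin N → ℝ := fun i => ε * (⌈s i / ε⌉ : ℝ) with he
    have hse : ∀ i, s i ≤ e i := by
      intro i
      have h3 := Int.le_ceil (s i / ε)
      rw [div_le_iff₀ hε0] at h3
      simp only [he]; linarith
    have hes : ∀ i, e i ≤ s i + ε := by
      intro i
      have h4 := (Int.ceil_lt_add_one (s i / ε)).le
      have h5 := mul_le_mul_of_nonneg_left h4 hε0.le
      rw [mul_add, mul_div_cancel₀ _ hε0.ne'] at h5
      simp only [he]; linarith
    rw [Real.rpow_zero, mul_one] at q1 q2
    refine ⟨⟨k, τ, fun i => ⟨_, ht i⟩⟩, ⟨?_, ?_, ?_⟩, b, x, ?_, hunit, hspan, hx, hxb, hP⟩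
    · by_contra h0
      apply hx
      have h1 : {i : Fin N | i < k} = ∅ := by
        ext i; simp only [Set.mem_ofPred_eq, Set.mem_empty_iff_false, iff_false, not_lt]
        rw [Fin.le_def]; simp only at h0; omega
      rw [h1] at hspan
      simpa using hspan
    · change ∑ l, (e l + c (τ l)) ≤ (N + 1) * ε
      rw [Finset.sum_add_distrib, Equiv.sum_comp τ c]
      have h1 : ∑ i, s i ≤ δ + ε := by
        rw [← Real.rpow_le_rpow_left_iff hQ1, Real.rpow_sum_of_pos hQ0, ← Finset.prod_congr rfl fun i _ => hμs i, hprod, Real.rpow_add hQ0]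
        exact mul_le_mul_of_nonneg_left q1.le (by positivity)
      have h2 : ∑ i, e i ≤ ∑ i, (s i + ε) := Finset.sum_le_sum fun i _ => hes i
      rw [Finset.sum_add_distrib, Finset.sum_const, Finset.card_univ, Fintype.card_fin, nsmul_eq_mul] at h2
      have h3 : ∑ i, c i = -δ := by rw [hδ]; ring
      rw [h3]; linarith
    · intro i j hi hj
      change e i ≤ e j - D
      have h1 := hgap i j hi hj
      have h2 : δ' + s i ≤ ε + s j := by
        rw [← Real.rpow_le_rpow_left_iff hQ1, Real.rpow_add hQ0, Real.rpow_add hQ0, ← hμs, ← hμs]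
        exact h1.trans (mul_le_mul_of_nonneg_right q2.le (hμ j).le)
      have h3 := hes i
      have h4 := hse j
      rw [hD]; linarith
    · intro i l
      refine (hlb i l).trans (mul_le_mul_of_nonneg_left ?_ (by linarith))
      change _ ≤ Q ^ (min (e l) (e i) + c (τ l))
      rw [Real.rpow_add hQ0]
      refine mul_le_mul_of_nonneg_right ?_ (by positivity)
      rcases le_total (e l) (e i) with h | h
      · rw [min_eq_left h]
        refine (min_le_left _ _).trans ?_
        rw [hμs]; exact Real.rpow_le_rpow_of_exponent_le hQ1.le (hse l)
      · rw [min_eq_right h]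
        refine (min_le_right _ _).trans ?_
        rw [hμs]; exact Real.rpow_le_rpow_of_exponent_le hQ1.le (hse i)
  obtain ⟨⟨k, τ, t⟩, hd⟩ := frequently_exists_finite key
  obtain ⟨Q0, ⟨hk, h1, h2⟩, -⟩ := hd.exists
  exact wedge_step σ L hdet c k hk (fun i => ε * ((t i).1 : ℝ)) τ C ε D hC hε0 hD0 h1 h2 hεD _ (hd.mono fun Q hQ => hQ.2)

end Schmidt

end PartW3

section PartW4
open Module NumberField Filter

namespace Schmidt

noncomputable def dst (x : ℝ) : ℝ := |x - round x|

noncomputable def formMat {K : Type*} [Field K] {n : ℕ} (θ : Fin n → K) : Fin (n + 1) → Fin (n + 1) → K := fun i j =>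
  Fin.cases (motive := fun _ => K) (if j = 0 then 1 else 0) (fun l => if j = 0 then θ l else if j = l.succ then -1 else 0) i

lemma formMat_det {K : Type*} [Field K] {n : ℕ} (θ : Fin n → K) : (Matrix.of (formMat θ)).det ≠ 0 := by
  rw [Matrix.det_of_lowerTriangular]
  · refine Finset.prod_ne_zero_iff.2 fun i _ => ?_
    refine Fin.cases ?_ (fun l => ?_) i
    · simp [formMat]
    · simp [formMat, Fin.succ_ne_zero]
  · intro i j hij
    change i < j at hij
    revert hij
    refine Fin.cases ?_ (fun l => ?_) i
    · intro hij
      simp [formMat, hij.ne']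
    · intro hij
      have h0 : j ≠ 0 := ((Fin.zero_le _).trans_lt hij).ne'
      simp [formMat, h0, hij.ne']

lemma formMat_sum {K : Type*} [Field K] {n : ℕ} (θ : Fin n → K) (σ : K →+* ℝ) (x : Fin (n + 1) → ℤ) :
    (∑ j, σ (formMat θ 0 j) * (x j : ℝ) = x 0) ∧ ∀ l : Fin n, ∑ j, σ (formMat θ l.succ j) * (x j : ℝ) = σ (θ l) * x 0 - x l.succ := by
  constructor
  · rw [Fin.sum_univ_succ]
    simp [formMat, Fin.succ_ne_zero]
  · intro l
    rw [Fin.sum_univ_succ]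
    simp [formMat, Fin.succ_ne_zero, apply_ite σ]
    ring

lemma grid_exponents {n : ℕ} (κ : ℝ) (hκ : 0 < κ) : ∃ (R : ℕ) (ε : ℝ), 0 < ε ∧ ∀ s : Fin n → ℝ, (∀ l, 0 ≤ s l) → 1 + κ ≤ ∑ l, s l →
    ∃ t : Fin n → Fin (R + 1), (∀ l, ε * ((t l).val : ℝ) ≤ s l) ∧ 1 + κ / 2 ≤ ∑ l, ε * ((t l).val : ℝ) := by
  set ε : ℝ := κ / (2 * (n + 1)) with hε
  have hε0 : 0 < ε := by positivity
  set R : ℕ := ⌈(1 + κ) / ε⌉₊ with hR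
  refine ⟨R, ε, hε0, ?_⟩
  intro s hs hsum
  refine ⟨fun l => ⟨min ⌊s l / ε⌋₊ R, Nat.lt_succ_of_le (min_le_right _ _)⟩, ?_, ?_⟩
  · intro l
    have h1 : ((min ⌊s l / ε⌋₊ R : ℕ) : ℝ) ≤ s l / ε :=
      le_trans (by exact_mod_cast min_le_left _ _) (Nat.floor_le (div_nonneg (hs l) hε0.le))
    rw [le_div_iff₀ hε0] at h1
    simp only
    linarith
  · simp only
    by_cases hcase : ∃ l, R ≤ ⌊s l / ε⌋₊
    · obtain ⟨l, hl⟩ := hcase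
      have h1 : ε * ((min ⌊s l / ε⌋₊ R : ℕ) : ℝ) ≤ ∑ l, ε * ((min ⌊s l / ε⌋₊ R : ℕ) : ℝ) :=
        Finset.single_le_sum (f := fun l => ε * ((min ⌊s l / ε⌋₊ R : ℕ) : ℝ)) (fun i _ => by positivity) (Finset.mem_univ l)
      rw [min_eq_right hl] at h1
      have h2 := Nat.le_ceil ((1 + κ) / ε)
      rw [← hR, div_le_iff₀ hε0] at h2
      linarith
    · push Not at hcase
      have h1 : ∀ l, s l - ε ≤ ε * ((min ⌊s l / ε⌋₊ R : ℕ) : ℝ) := by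
        intro l
        rw [min_eq_left (hcase l).le]
        have h2 := (Nat.lt_floor_add_one (s l / ε)).le
        rw [div_le_iff₀ hε0] at h2
        linarith
      have h3 := Finset.sum_le_sum fun l (_ : l ∈ Finset.univ) => h1 l
      rw [Finset.sum_sub_distrib, Finset.sum_const, Finset.card_univ, Fintype.card_fin, nsmul_eq_mul] at h3
      have h4 : (n:ℝ) * ε ≤ κ / 2 := by
        have : ((n:ℝ) + 1) * ε = κ / 2 := by rw [hε]; field_simp
        linarith
      linarith

lemma lin_ne {n : ℕ} (θ : Fin n → ℝ) (hli : LinearIndependent ℚ (Fin.cons (1 : ℝ) θ : Fin (n + 1) → ℝ)) (h : Fin (n + 1) → ℤ) (hh : h ≠ 0) :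
    (h 0 : ℝ) + ∑ l : Fin n, (h l.succ : ℝ) * θ l ≠ 0 := by
  intro h0
  apply hh
  rw [Fintype.linearIndependent_iff] at hli
  have := hli (fun i => (h i : ℚ)) (by
    rw [Fin.sum_univ_succ]
    simpa [Rat.smul_def] using h0)
  ext i
  exact_mod_cast this i

lemma dst_pos {n : ℕ} (θ : Fin n → ℝ) (hli : LinearIndependent ℚ (Fin.cons (1 : ℝ) θ : Fin (n + 1) → ℝ)) (l : Fin n) (m : ℤ) (hm : m ≠ 0) :
    0 < dst (θ l * m) := by
  rw [dst, abs_pos]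
  intro h0
  refine lin_ne θ hli (Fin.cons (-round (θ l * m)) (Pi.single l m)) ?_ ?_
  · intro h
    have := congrFun h l.succ
    simp at this
    exact hm this
  · simp only [Fin.cons_zero, Fin.cons_succ]
    rw [Finset.sum_eq_single l]
    · simp; linarith
    · intro b _ hb; simp [hb]
    · simp

theorem schmidt {n : ℕ} (θ : Fin n → ℝ) (halg : ∀ j, IsAlgebraic ℚ (θ j))
    (hli : LinearIndependent ℚ (Fin.cons (1 : ℝ) θ : Fin (n + 1) → ℝ)) (κ : ℝ) (hκ : 0 < κ) :
    ∃ c : ℝ, 0 < c ∧ ∀ m : ℤ, m ≠ 0 → c ≤ |(m:ℝ)| ^ (1 + κ) * ∏ l, dst (θ l * m) := by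
  classical
  by_contra hcon
  push Not at hcon
  set F : ℤ → ℝ := fun m => |(m:ℝ)| ^ (1 + κ) * ∏ l, dst (θ l * m) with hF
  have hFpos : ∀ m, m ≠ 0 → 0 < F m := fun m hm => by
    have : 0 < |(m:ℝ)| := by positivity
    exact mul_pos (Real.rpow_pos_of_pos this _) (Finset.prod_pos fun l _ => dst_pos θ hli l m hm)
  have hfr : ∃ᶠ Q : ℝ in atTop, ∃ m : ℤ, m ≠ 0 ∧ |(m:ℝ)| = Q ∧ F m < 1 := by
    rw [frequently_atTop]
    intro a
    obtain ⟨c, hc0, hc1, hc⟩ : ∃ c : ℝ, 0 < c ∧ c ≤ 1 ∧ ∀ m : ℤ, m ≠ 0 → |(m:ℝ)| < a → c ≤ F m := by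
      set S : Finset ℤ := (Finset.Icc (-⌈a⌉) ⌈a⌉).filter fun m => m ≠ 0 with hS
      have hmemS : ∀ m : ℤ, m ≠ 0 → |(m:ℝ)| < a → m ∈ S := by
        intro m hm hma
        rw [hS, Finset.mem_filter, Finset.mem_Icc]
        rw [abs_lt] at hma
        have h1 := Int.le_ceil a
        refine ⟨⟨?_, ?_⟩, hm⟩
        · have : ((-⌈a⌉ : ℤ) : ℝ) ≤ m := by push_cast; linarith
          exact_mod_cast this
        · have : (m : ℝ) ≤ (⌈a⌉ : ℤ) := by linarith
          exact_mod_cast this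
      rcases S.eq_empty_or_nonempty with hSe | hSn
      · exact ⟨1, one_pos, le_rfl, fun m hm hma => by have := hmemS m hm hma; rw [hSe] at this; simp at this⟩
      · obtain ⟨m0, hm0, hmin⟩ := Finset.exists_min_image S F hSn
        refine ⟨min 1 (F m0), lt_min one_pos (hFpos m0 (Finset.mem_filter.1 hm0).2), min_le_left _ _, fun m hm hma => ?_⟩
        exact (min_le_right _ _).trans (hmin m (hmemS m hm hma))
    obtain ⟨m, hm, hmc⟩ := hcon c hc0
    refine ⟨|(m:ℝ)|, ?_, m, hm, rfl, lt_of_lt_of_le hmc hc1⟩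
    by_contra hlt
    push Not at hlt
    exact absurd (hc m hm hlt) (not_le.2 hmc)
  let K := IntermediateField.adjoin ℚ (Set.range θ)
  haveI : FiniteDimensional ℚ K := IntermediateField.finiteDimensional_adjoin (by
    rintro _ ⟨j, rfl⟩
    exact (halg j).isIntegral)
  haveI : NumberField K := ⟨⟩
  let σ : K →+* ℝ := algebraMap K ℝ
  let ϑ : Fin n → K := fun l => ⟨θ l, IntermediateField.subset_adjoin ℚ _ ⟨l, rfl⟩⟩
  have hσ : ∀ l, σ (ϑ l) = θ l := fun l => rfl
  obtain ⟨R, ε, hε, hgrid⟩ := grid_exponents (n := n) κ hκ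
  have key : ∃ᶠ Q : ℝ in atTop, ∃ t : Fin n → Fin (R + 1), 1 + κ / 2 ≤ ∑ l, ε * ((t l).val : ℝ) ∧
      ∃ x : Fin (n + 1) → ℤ, x ≠ 0 ∧ (∀ i, |∑ j, σ (formMat ϑ i j) * (x j : ℝ)| ≤ Q ^ (Fin.cons 1 (fun l => -(ε * ((t l).val : ℝ))) : Fin (n + 1) → ℝ) i) ∧
        (|(x 0 : ℝ)| = Q ∧ ∀ l : Fin n, |θ l * x 0 - x l.succ| ≤ 1) := by
    refine (hfr.and_eventually (eventually_gt_atTop 1)).mono ?_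
    rintro Q ⟨⟨m, hm, hmQ, hFm⟩, hQ1⟩
    have hQ0 : 0 < Q := by linarith
    have hlog := Real.log_pos hQ1
    set s : Fin n → ℝ := fun l => -Real.log (dst (θ l * m)) / Real.log Q with hs
    have hds : ∀ l, dst (θ l * m) = Q ^ (-s l) := by
      intro l
      rw [Real.rpow_def_of_pos hQ0, hs]
      simp only
      rw [neg_div, neg_neg, mul_div_cancel₀ _ hlog.ne', Real.exp_log (dst_pos θ hli l m hm)]
    have hd1 : ∀ l, dst (θ l * m) ≤ 1 := fun l => (abs_sub_round _).trans (by norm_num)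
    have hs0 : ∀ l, 0 ≤ s l := by
      intro l
      refine div_nonneg ?_ hlog.le
      have := Real.log_nonpos (dst_pos θ hli l m hm).le (hd1 l)
      linarith
    have hsum : 1 + κ ≤ ∑ l, s l := by
      have h1 : Q ^ (1 + κ + ∑ l, -s l) < Q ^ (0:ℝ) := by
        rw [Real.rpow_add hQ0, Real.rpow_sum_of_pos hQ0, ← Finset.prod_congr rfl fun l _ => hds l, Real.rpow_zero]
        simp only [hF, hmQ] at hFm
        exact hFm
      rw [Real.rpow_lt_rpow_left_iff hQ1, Finset.sum_neg_distrib] at h1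
      linarith
    obtain ⟨t, ht1, ht2⟩ := hgrid s hs0 hsum
    refine ⟨t, ht2, Fin.cons m fun l => round (θ l * m), ?_, ?_, ?_, ?_⟩
    · intro h
      exact hm (by simpa using congrFun h 0)
    · obtain ⟨f1, f2⟩ := formMat_sum ϑ σ (Fin.cons m fun l => round (θ l * m))
      intro i
      refine Fin.cases ?_ (fun l => ?_) i
      · rw [f1]; simp [hmQ]
      · rw [f2]
        simp only [Fin.cons_zero, Fin.cons_succ, hσ]
        change dst (θ l * m) ≤ _
        rw [hds]
        exact Real.rpow_le_rpow_of_exponent_le hQ1.le (neg_le_neg (ht1 l))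
    · simpa using hmQ
    · intro l
      simp only [Fin.cons_zero, Fin.cons_succ]
      exact hd1 l
  obtain ⟨t, ht⟩ := frequently_exists_finite key
  obtain ⟨_, ht2, -⟩ := ht.exists
  obtain ⟨h, hh, hfr2⟩ := subspace σ (formMat ϑ) (formMat_det ϑ) (Fin.cons 1 (fun l => -(ε * ((t l).val : ℝ))) : Fin (n + 1) → ℝ) (by
    rw [Fin.sum_univ_succ]
    simp only [Fin.cons_zero, Fin.cons_succ, Finset.sum_neg_distrib]
    linarith) (fun Q x => |(x 0 : ℝ)| = Q ∧ ∀ l : Fin n, |θ l * x 0 - x l.succ| ≤ 1) (ht.mono fun Q hQ => hQ.2)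
  have hβ := lin_ne θ hli h hh
  set β := (h 0 : ℝ) + ∑ l : Fin n, (h l.succ : ℝ) * θ l with hβd
  obtain ⟨Q, ⟨x, hx0, -, -, hxQ, hxl⟩, hQ⟩ := (hfr2.and_eventually (eventually_gt_atTop ((∑ l : Fin n, |(h l.succ : ℝ)|) / |β|))).exists
  rw [div_lt_iff₀ (abs_pos.2 hβ)] at hQ
  have h1 : β * x 0 = ∑ l : Fin n, (h l.succ : ℝ) * (θ l * x 0 - x l.succ) := by
    have h2 : (h 0 : ℝ) * x 0 + ∑ l : Fin n, (h l.succ : ℝ) * x l.succ = 0 := by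
      rw [Fin.sum_univ_succ] at hx0
      exact_mod_cast hx0
    have h3 : ∑ l : Fin n, (h l.succ : ℝ) * (θ l * x 0 - x l.succ) = (∑ l : Fin n, (h l.succ : ℝ) * θ l) * x 0 - ∑ l : Fin n, (h l.succ : ℝ) * x l.succ := by
      rw [Finset.sum_mul, ← Finset.sum_sub_distrib]
      exact Finset.sum_congr rfl fun l _ => by ring
    rw [h3, hβd]
    linarith
  have h4 : |β| * Q ≤ ∑ l : Fin n, |(h l.succ : ℝ)| := by
    rw [← hxQ, ← abs_mul, h1]
    refine (Finset.abs_sum_le_sum_abs _ _).trans (Finset.sum_le_sum fun l _ => ?_)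
    rw [abs_mul]
    exact mul_le_of_le_one_right (abs_nonneg _) (hxl l)
  linarith

end Schmidt

end PartW4

section PartS1
open Module NumberField Filter

namespace Schmidt

lemma sep_card (S : Finset ℤ) (X G : ℝ) (hG : 0 < G) (hX : 0 ≤ X) (h1 : ∀ m ∈ S, |(m:ℝ)| ≤ X)
    (h2 : ∀ m ∈ S, ∀ m' ∈ S, m ≠ m' → G ≤ |(m:ℝ) - m'|) : (S.card : ℝ) ≤ 2 * X / G + 1 := by
  have hle : S.card ≤ (Finset.range (⌊2 * X / G⌋₊ + 1)).card := by
    refine Finset.card_le_card_of_injOn (fun m => ⌊((m:ℝ) + X) / G⌋₊) ?_ ?_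
    · intro m hm
      have hm1 := abs_le.1 (h1 m hm)
      simp only [Finset.coe_range, Set.mem_Iio]
      refine Nat.lt_succ_of_le (Nat.floor_le_floor ?_)
      exact div_le_div_of_nonneg_right (by linarith) hG.le
    · intro m hm m' hm' heq
      by_contra hne
      have h := h2 m hm m' hm' hne
      have a1 := abs_le.1 (h1 m hm)
      have a2 := abs_le.1 (h1 m' hm')
      simp only at heq
      have b1 := Nat.floor_le (div_nonneg (by linarith : 0 ≤ (m:ℝ) + X) hG.le)
      have b2 := Nat.lt_floor_add_one (((m:ℝ) + X) / G)
      have b3 := Nat.floor_le (div_nonneg (by linarith : 0 ≤ (m':ℝ) + X) hG.le)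
      have b4 := Nat.lt_floor_add_one (((m':ℝ) + X) / G)
      rw [heq] at b1 b2
      rw [le_div_iff₀ hG] at b1 b3
      rw [div_lt_iff₀ hG] at b2 b4
      rcases le_abs'.1 h with h | h <;> nlinarith
  rw [Finset.card_range] at hle
  have h3 : (S.card : ℝ) ≤ ⌊2 * X / G⌋₊ + 1 := by exact_mod_cast hle
  have h4 := Nat.floor_le (div_nonneg (by linarith : 0 ≤ 2 * X) hG.le)
  linarith

lemma fiber_bound {n : ℕ} (θ : Fin n → ℝ) (hpos : ∀ l (m : ℤ), m ≠ 0 → 0 < dst (θ l * m)) (η κ c : ℝ) (hη : 0 < η) (hκ : κ = η / 4) (hc : 0 < c)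
    (hs : ∀ m : ℤ, m ≠ 0 → c ≤ |(m:ℝ)| ^ (1 + κ) * ∏ l, dst (θ l * m)) :
    ∃ C : ℝ, 0 < C ∧ ∀ (K : ℕ) (k : Fin n → ℕ) (s : Fin n → Bool) (S : Finset ℤ),
      (∀ m ∈ S, m ≠ 0 ∧ (2:ℝ) ^ K ≤ |(m:ℝ)| ∧ |(m:ℝ)| ≤ 2 ^ (K + 1) ∧
        ∀ l, dst (θ l * m) ≤ (1 / 2) ^ k l ∧ (dst (θ l * m))⁻¹ ≤ 2 ^ (k l + 1) ∧ (s l = true ↔ 0 ≤ θ l * m - round (θ l * m))) →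
      ∑ m ∈ S, |(m:ℝ)| ^ (-(1 + η)) * ∏ l, (dst (θ l * m))⁻¹ ≤
        C * (((2:ℝ) ^ (-(η / 2))) ^ K * ∏ l, (((1:ℝ) / 2) ^ (κ / (1 + κ))) ^ k l) := by
  have hκ0 : 0 < κ := by rw [hκ]; linarith
  set p := 1 + κ with hp
  have hp0 : 0 < p := by linarith
  refine ⟨3 * 2 ^ (1 + η) * 2 ^ n / c * c ^ (-(κ / p)), by positivity, ?_⟩
  intro K k s S hS
  rcases S.eq_empty_or_nonempty with rfl | ⟨m0, hm0⟩
  · rw [Finset.sum_empty]; positivity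
  set X : ℝ := 2 ^ (K + 1) with hX
  set V : ℝ := ∏ l, ((1:ℝ) / 2) ^ k l with hV
  have hV0 : 0 < V := Finset.prod_pos fun l _ => by positivity
  have hX0 : 0 < X := by positivity
  set G : ℝ := (c / V) ^ (1 / p) with hG
  have hG0 : 0 < G := Real.rpow_pos_of_pos (by positivity) _
  have hGp : G ^ p = c / V := by
    rw [hG, ← Real.rpow_mul (by positivity), one_div_mul_cancel hp0.ne', Real.rpow_one]
  have hgen : ∀ m : ℤ, m ≠ 0 → (∀ l, dst (θ l * m) ≤ (1 / 2) ^ k l) → G ≤ |(m:ℝ)| := by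
    intro m hm hd
    have h1 : c ≤ |(m:ℝ)| ^ p * V := (hs m hm).trans (mul_le_mul_of_nonneg_left
      (Finset.prod_le_prod (fun l _ => abs_nonneg _) fun l _ => hd l) (by positivity))
    rw [← div_le_iff₀ hV0, ← hGp, Real.rpow_le_rpow_iff hG0.le (abs_nonneg _) hp0] at h1
    exact h1
  have hGX : G ≤ X := (hgen m0 (hS m0 hm0).1 fun l => ((hS m0 hm0).2.2.2 l).1).trans (hS m0 hm0).2.2.1
  have hcard : (S.card : ℝ) ≤ 3 * X / G := by
    have h1 := sep_card S X G hG0 hX0.le (fun m hm => (hS m hm).2.2.1) ?_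
    · have h2 : 1 ≤ X / G := (one_le_div hG0).2 hGX
      have h3 : 3 * X / G = 2 * X / G + X / G := by ring
      linarith
    · intro m hm m' hm' hne
      have h2 := hgen (m - m') (sub_ne_zero.2 hne) ?_
      · simpa using h2
      · intro l
        obtain ⟨a1, -, a3⟩ := (hS m hm).2.2.2 l
        obtain ⟨b1, -, b3⟩ := (hS m' hm').2.2.2 l
        have h3 := round_le (θ l * ((m - m' : ℤ) : ℝ)) (round (θ l * m) - round (θ l * m'))
        rw [dst] at a1 b1 ⊢
        refine h3.trans ?_
        have h4 : θ l * ((m - m' : ℤ) : ℝ) - ((round (θ l * m) - round (θ l * m') : ℤ) : ℝ) = (θ l * m - round (θ l * m)) - (θ l * m' - round (θ l * m')) := by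
          push_cast; ring
        rw [h4]
        rw [abs_le] at a1 b1 ⊢
        cases hsl : s l with
        | true =>
          have a4 := a3.1 hsl
          have b4 := b3.1 hsl
          constructor <;> linarith
        | false =>
          have a4 : ¬ _ := fun h => by have := a3.2 h; rw [hsl] at this; exact absurd this (by simp)
          have b4 : ¬ _ := fun h => by have := b3.2 h; rw [hsl] at this; exact absurd this (by simp)
          constructor <;> linarith
  have hterm : ∀ m ∈ S, |(m:ℝ)| ^ (-(1 + η)) * ∏ l, (dst (θ l * m))⁻¹ ≤ (X / 2) ^ (-(1 + η)) * (2 ^ n / V) := by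
    intro m hm
    obtain ⟨hm1, hm2, hm3, hm4⟩ := hS m hm
    have hX2 : X / 2 = 2 ^ K := by rw [hX, pow_succ]; ring
    refine mul_le_mul ?_ ?_ (Finset.prod_nonneg fun l _ => inv_nonneg.2 (abs_nonneg _)) (by positivity)
    · rw [hX2]
      exact Real.rpow_le_rpow_of_nonpos (by positivity) hm2 (by linarith)
    · refine (Finset.prod_le_prod (fun l _ => inv_nonneg.2 (abs_nonneg _)) fun l _ => (hm4 l).2.1).trans (le_of_eq ?_)
      rw [hV, eq_div_iff (ne_of_gt hV0), ← Finset.prod_mul_distrib]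
      have : ∀ l, (2:ℝ) ^ (k l + 1) * (1 / 2) ^ k l = 2 := fun l => by
        rw [pow_succ, one_div, inv_pow]; field_simp
      simp only [this]; simp
  have hsum := Finset.sum_le_card_nsmul S _ _ hterm
  rw [nsmul_eq_mul] at hsum
  refine hsum.trans ((mul_le_mul_of_nonneg_right hcard (by positivity)).trans ?_)
  have hVeq : V = c / G ^ p := by rw [hGp]; field_simp
  have hGk : G ^ (-κ) = c ^ (-(κ / p)) * ∏ l, (((1:ℝ) / 2) ^ (κ / p)) ^ k l := by
    have h1 : ∏ l, (((1:ℝ) / 2) ^ (κ / p)) ^ k l = V ^ (κ / p) := by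
      rw [hV, ← Real.finsetProd_rpow _ _ (fun l _ => by positivity)]
      refine Finset.prod_congr rfl fun l _ => ?_
      rw [← Real.rpow_natCast, ← Real.rpow_natCast, ← Real.rpow_mul (by norm_num), ← Real.rpow_mul (by norm_num), mul_comm]
    rw [h1, hG, ← Real.rpow_mul (by positivity), Real.div_rpow hc.le hV0.le]
    have h2 : 1 / p * -κ = -(κ / p) := by ring
    rw [h2, Real.rpow_neg hV0.le, div_inv_eq_mul]
  have hXk : X ^ (-(η / 2)) ≤ ((2:ℝ) ^ (-(η / 2))) ^ K := by
    rw [← Real.rpow_mul_natCast (by norm_num), hX, ← Real.rpow_natCast, ← Real.rpow_mul (by norm_num)]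
    refine Real.rpow_le_rpow_of_exponent_le (by norm_num) ?_
    push_cast
    nlinarith
  have hmain : 3 * X / G * ((X / 2) ^ (-(1 + η)) * (2 ^ n / V)) = 3 * 2 ^ (1 + η) * 2 ^ n / c * (X ^ (-η) * G ^ κ) := by
    rw [hVeq, Real.div_rpow hX0.le (by norm_num), Real.rpow_neg (by norm_num : (0:ℝ) ≤ 2), neg_add, Real.rpow_add hX0, hp, Real.rpow_add hG0, Real.rpow_one,
      Real.rpow_neg_one]
    field_simp
  have hcomb : X ^ (-η) * G ^ κ ≤ X ^ (-(η / 2)) * G ^ (-κ) := by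
    have h1 : G ^ κ = G ^ (2 * κ) * G ^ (-κ) := by rw [← Real.rpow_add hG0]; congr 1; ring
    have h2 : X ^ (-(η / 2)) = X ^ (-η) * X ^ (2 * κ) := by rw [← Real.rpow_add hX0]; congr 1; rw [hκ]; ring
    rw [h1, h2, mul_assoc]
    refine mul_le_mul_of_nonneg_left (mul_le_mul_of_nonneg_right ?_ (by positivity)) (by positivity)
    exact Real.rpow_le_rpow hG0.le hGX (by linarith)
  rw [hmain, mul_assoc _ (c ^ (-(κ / p)))]
  refine mul_le_mul_of_nonneg_left (hcomb.trans ?_) (by positivity)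
  rw [hGk]
  calc _ ≤ ((2:ℝ) ^ (-(η / 2))) ^ K * (c ^ (-(κ / p)) * ∏ l, (((1:ℝ) / 2) ^ (κ / p)) ^ k l) := mul_le_mul_of_nonneg_right hXk (by positivity)
    _ = _ := by ring

lemma pi_sum_le {α : Type*} {n : ℕ} (f : Fin n → α → ℝ) (B : Fin n → ℝ) (hf : ∀ l a, 0 ≤ f l a) (hB : ∀ l (t : Finset α), ∑ a ∈ t, f l a ≤ B l)
    (s : Finset (Fin n → α)) : ∑ p ∈ s, ∏ l, f l (p l) ≤ ∏ l, B l := by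
  classical
  have hsub : s ⊆ Fintype.piFinset fun l => s.image fun p => p l := by
    intro p hp
    rw [Fintype.mem_piFinset]
    exact fun l => Finset.mem_image_of_mem _ hp
  refine (Finset.sum_le_sum_of_subset_of_nonneg hsub fun p _ _ => Finset.prod_nonneg fun l _ => hf l _).trans ?_
  rw [← Finset.prod_univ_sum]
  exact Finset.prod_le_prod (fun l _ => Finset.sum_nonneg fun a _ => hf l a) fun l _ => hB l _

lemma dyadic_nat (m : ℤ) (hm : m ≠ 0) : ∃ K : ℕ, (2:ℝ) ^ K ≤ |(m:ℝ)| ∧ |(m:ℝ)| ≤ 2 ^ (K + 1) := by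
  have h0 : m.natAbs ≠ 0 := Int.natAbs_ne_zero.2 hm
  have h1 : |(m:ℝ)| = (m.natAbs : ℝ) := by rw [Nat.cast_natAbs]; push_cast; rfl
  refine ⟨Nat.log 2 m.natAbs, ?_, ?_⟩
  · rw [h1]; exact_mod_cast Nat.pow_log_le_self 2 h0
  · rw [h1]; exact_mod_cast (Nat.lt_pow_succ_log_self (by norm_num) _).le

lemma dyadic_inv (d : ℝ) (hd : 0 < d) (hd1 : d ≤ 1) : ∃ k : ℕ, d ≤ (1 / 2) ^ k ∧ d⁻¹ ≤ 2 ^ (k + 1) := by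
  have h1 : 1 ≤ d⁻¹ := (one_le_inv₀ hd).2 hd1
  have h0 : ⌊d⁻¹⌋₊ ≠ 0 := by
    have : 1 ≤ ⌊d⁻¹⌋₊ := Nat.le_floor (by simpa using h1)
    omega
  refine ⟨Nat.log 2 ⌊d⁻¹⌋₊, ?_, ?_⟩
  · have h2 : ((2 ^ Nat.log 2 ⌊d⁻¹⌋₊ : ℕ) : ℝ) ≤ d⁻¹ := le_trans (by exact_mod_cast Nat.pow_log_le_self 2 h0) (Nat.floor_le (by linarith))
    push_cast at h2
    rw [one_div, inv_pow, le_inv_comm₀ hd (by positivity)]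
    exact h2
  · have h2 := Nat.lt_pow_succ_log_self (b := 2) (by norm_num) ⌊d⁻¹⌋₊
    rw [Nat.floor_lt (by linarith)] at h2
    push_cast at h2
    exact h2.le

set_option maxHeartbeats 2000000 in
theorem outer_bound {n : ℕ} (θ : Fin n → ℝ) (halg : ∀ j, IsAlgebraic ℚ (θ j))
    (hli : LinearIndependent ℚ (Fin.cons (1 : ℝ) θ : Fin (n + 1) → ℝ)) (η : ℝ) (hη : 0 < η) :
    ∃ C : ℝ, 0 ≤ C ∧ ∀ S : Finset ℤ, (∀ m ∈ S, m ≠ 0) → ∑ m ∈ S, |(m:ℝ)| ^ (-(1 + η)) * ∏ l, (dst (θ l * m))⁻¹ ≤ C := by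
  classical
  obtain ⟨c, hc, hs⟩ := schmidt θ halg hli (η / 4) (by linarith)
  have hpos := dst_pos θ hli
  obtain ⟨C, hC, hfib⟩ := fiber_bound θ hpos η (η / 4) c hη rfl hc hs
  set r1 : ℝ := (2:ℝ) ^ (-(η / 2)) with hr1
  set r2 : ℝ := ((1:ℝ) / 2) ^ ((η / 4) / (1 + η / 4)) with hr2
  have hr1p : 0 < r1 := by positivity
  have hr2p : 0 < r2 := by positivity
  have hr11 : r1 < 1 := Real.rpow_lt_one_of_one_lt_of_neg (by norm_num) (by linarith)
  have hr21 : r2 < 1 := Real.rpow_lt_one (by norm_num) (by norm_num) (by positivity)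
  have g1 : Summable fun K : ℕ => r1 ^ K := summable_geometric_of_lt_one hr1p.le hr11
  have g2 : Summable fun q : ℕ × Bool => r2 ^ q.1 * (1:ℝ) :=
    (summable_geometric_of_lt_one hr2p.le hr21).mul_of_nonneg (Summable.of_finite (f := fun _ : Bool => (1:ℝ))) (fun _ => by positivity) (fun _ => zero_le_one)
  have g3 : Summable fun q : Fin n → ℕ × Bool => ∏ l, (r2 ^ (q l).1 * (1:ℝ)) :=
    summable_of_sum_le (fun q => by positivity) (pi_sum_le (fun _ q => r2 ^ q.1 * (1:ℝ)) (fun _ => ∑' q : ℕ × Bool, r2 ^ q.1 * (1:ℝ))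
      (fun _ _ => by positivity) (fun _ t => g2.sum_le_tsum t fun _ _ => by positivity))
  have g4 : Summable fun q : ℕ × (Fin n → ℕ × Bool) => r1 ^ q.1 * ∏ l, (r2 ^ (q.2 l).1 * (1:ℝ)) :=
    g1.mul_of_nonneg g3 (fun _ => by positivity) (fun _ => by positivity)
  refine ⟨C * ∑' q : ℕ × (Fin n → ℕ × Bool), r1 ^ q.1 * ∏ l, (r2 ^ (q.2 l).1 * (1:ℝ)), mul_nonneg hC.le (tsum_nonneg fun _ => by positivity), ?_⟩
  intro S hS
  have hex : ∀ m : ℤ, ∃ q : ℕ × (Fin n → ℕ × Bool), m ≠ 0 → ((2:ℝ) ^ q.1 ≤ |(m:ℝ)| ∧ |(m:ℝ)| ≤ 2 ^ (q.1 + 1) ∧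
        ∀ l, dst (θ l * m) ≤ (1 / 2) ^ (q.2 l).1 ∧ (dst (θ l * m))⁻¹ ≤ 2 ^ ((q.2 l).1 + 1) ∧ ((q.2 l).2 = true ↔ 0 ≤ θ l * m - round (θ l * m))) := by
    intro m
    by_cases hm : m = 0
    · exact ⟨⟨0, fun _ => (0, true)⟩, fun h => absurd hm h⟩
    · obtain ⟨K, hK1, hK2⟩ := dyadic_nat m hm
      choose k hk1 hk2 using fun l => dyadic_inv (dst (θ l * m)) (hpos l m hm) ((abs_sub_round _).trans (by norm_num))
      exact ⟨⟨K, fun l => (k l, decide (0 ≤ θ l * m - round (θ l * m)))⟩, fun _ => ⟨hK1, hK2, fun l => ⟨hk1 l, hk2 l, by simp⟩⟩⟩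
  choose q hq using hex
  rw [← Finset.sum_fiberwise_of_maps_to (fun m hm => Finset.mem_image_of_mem q hm)]
  have hstep : ∀ y ∈ S.image q, ∑ m ∈ S with q m = y, |(m:ℝ)| ^ (-(1 + η)) * ∏ l, (dst (θ l * m))⁻¹ ≤ C * (r1 ^ y.1 * ∏ l, (r2 ^ (y.2 l).1 * (1:ℝ))) := by
    intro y _
    have h1 := hfib y.1 (fun l => (y.2 l).1) (fun l => (y.2 l).2) (S.filter fun m => q m = y) ?_
    · simpa only [mul_one] using h1
    · intro m hm
      rw [Finset.mem_filter] at hm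
      have h2 := hq m (hS m hm.1)
      rw [hm.2] at h2
      exact ⟨hS m hm.1, h2⟩
  refine (Finset.sum_le_sum hstep).trans ?_
  rw [← Finset.mul_sum]
  exact mul_le_mul_of_nonneg_left (g4.sum_le_tsum _ fun _ _ => by positivity) hC.le

end Schmidt

end PartS1

section PartS2
open Module NumberField Filter
open scoped Real

namespace Schmidt

lemma one_add_summable (η : ℝ) (hη : 0 < η) : Summable fun j : ℤ => (1 + |(j:ℝ)|) ^ (-(1 + η)) := by
  have h1 : Summable fun j : ℤ => |(j:ℝ)| ^ (-(1 + η)) := Real.summable_abs_int_rpow (by linarith)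
  refine Summable.of_norm_bounded_eventually h1 ?_
  have hfin : ({0} : Set ℤ).Finite := Set.finite_singleton 0
  filter_upwards [hfin.compl_mem_cofinite] with j hj
  have hj0 : j ≠ 0 := by simpa using hj
  have hjp : 0 < |(j:ℝ)| := by positivity
  rw [Real.norm_of_nonneg (by positivity)]
  exact Real.rpow_le_rpow_of_nonpos hjp (by linarith) (by linarith)

lemma inner_bound (η : ℝ) (hη : 0 < η) : ∃ B : ℝ, 0 ≤ B ∧ ∀ x : ℝ, 0 < dst x → ∀ t : Finset ℤ,
    ∑ j ∈ t, |x - j|⁻¹ * (1 + |(j:ℝ)|) ^ (-η) ≤ B * (dst x)⁻¹ := by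
  have hsm := one_add_summable η hη
  set A := ∑' j : ℤ, (1 + |(j:ℝ)|) ^ (-(1 + η)) with hA
  have hA0 : 0 ≤ A := tsum_nonneg fun _ => by positivity
  refine ⟨2 * (A + A), by positivity, ?_⟩
  intro x hx t
  have hterm : ∀ j ∈ t, |x - j|⁻¹ * (1 + |(j:ℝ)|) ^ (-η) ≤
      2 * (dst x)⁻¹ * ((1 + |((j - round x : ℤ):ℝ)|) ^ (-(1 + η)) + (1 + |(j:ℝ)|) ^ (-(1 + η))) := by
    intro j _
    set X : ℝ := 1 + |((j - round x : ℤ):ℝ)| with hX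
    set Y : ℝ := 1 + |(j:ℝ)| with hY
    have hX0 : 0 < X := by positivity
    have hY0 : 0 < Y := by positivity
    have hlow : dst x * X / 2 ≤ |x - j| := by
      have hd : dst x ≤ 1 / 2 := abs_sub_round x
      have hd2 : dst x ≤ |x - j| := round_le x j
      by_cases hj : j = round x
      · rw [hX, hj]; simp; rw [hj] at hd2; linarith
      · have h1 : (1:ℝ) ≤ |((j - round x : ℤ):ℝ)| := by
          exact_mod_cast Int.one_le_abs (sub_ne_zero.2 hj)
        have h2 : |((j - round x : ℤ):ℝ)| ≤ |x - j| + dst x := by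
          rw [dst]
          have : ((j - round x : ℤ):ℝ) = (x - round x) - (x - j) := by push_cast; ring
          rw [this]
          exact (abs_sub _ _).trans (by rw [add_comm])
        rw [hX]
        nlinarith
    have hpos : 0 < dst x * X / 2 := by positivity
    have h3 : |x - j|⁻¹ ≤ 2 * (dst x)⁻¹ * X ^ (-1:ℝ) := by
      refine (inv_anti₀ hpos hlow).trans (le_of_eq ?_)
      rw [Real.rpow_neg_one]; field_simp
    have h4 : X ^ (-1:ℝ) * Y ^ (-η) ≤ X ^ (-(1 + η)) + Y ^ (-(1 + η)) := by
      have e1 : ∀ Z : ℝ, 0 < Z → Z ^ (-(1 + η)) = Z ^ (-1:ℝ) * Z ^ (-η) := fun Z hZ => by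
        rw [← Real.rpow_add hZ]; congr 1; ring
      rcases le_total X Y with h | h
      · refine le_trans ?_ (le_add_of_nonneg_right (by positivity))
        rw [e1 X hX0]
        exact mul_le_mul_of_nonneg_left (Real.rpow_le_rpow_of_nonpos hX0 h (by linarith)) (by positivity)
      · refine le_trans ?_ (le_add_of_nonneg_left (by positivity))
        rw [e1 Y hY0]
        exact mul_le_mul_of_nonneg_right (Real.rpow_le_rpow_of_nonpos hY0 h (by norm_num)) (by positivity)
    calc |x - j|⁻¹ * Y ^ (-η) ≤ 2 * (dst x)⁻¹ * X ^ (-1:ℝ) * Y ^ (-η) := mul_le_mul_of_nonneg_right h3 (by positivity)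
      _ = 2 * (dst x)⁻¹ * (X ^ (-1:ℝ) * Y ^ (-η)) := by ring
      _ ≤ _ := mul_le_mul_of_nonneg_left h4 (by positivity)
  refine (Finset.sum_le_sum hterm).trans ?_
  rw [← Finset.mul_sum, Finset.sum_add_distrib]
  have s1 : ∑ j ∈ t, (1 + |(j:ℝ)|) ^ (-(1 + η)) ≤ A := hsm.sum_le_tsum t fun _ _ => by positivity
  have s2 : ∑ j ∈ t, (1 + |((j - round x : ℤ):ℝ)|) ^ (-(1 + η)) ≤ A := by
    have h5 : Summable fun j : ℤ => (1 + |((j - round x : ℤ):ℝ)|) ^ (-(1 + η)) := (Equiv.subRight (round x)).summable_iff.2 hsm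
    have h6 : ∑' j : ℤ, (1 + |((j - round x : ℤ):ℝ)|) ^ (-(1 + η)) = A := (Equiv.subRight (round x)).tsum_eq (fun j : ℤ => (1 + |(j:ℝ)|) ^ (-(1 + η)))
    rw [← h6]
    exact h5.sum_le_tsum t fun _ _ => by positivity
  have hx' : 0 < (dst x)⁻¹ := inv_pos.2 hx
  calc 2 * (dst x)⁻¹ * _ ≤ 2 * (dst x)⁻¹ * (A + A) := mul_le_mul_of_nonneg_left (add_le_add s2 s1) (by positivity)
    _ = _ := by ring

noncomputable def maj {n : ℕ} (θ : Fin n → ℝ) (η : ℝ) (p : (Fin n → ℤ) × ℤ) : ℝ :=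
  if p.2 = 0 then 0 else |(p.2:ℝ)| ^ (-(1 + η)) * ∏ l, (|θ l * p.2 - p.1 l|⁻¹ * (1 + |(p.1 l:ℝ)|) ^ (-η))

lemma maj_nonneg {n : ℕ} (θ : Fin n → ℝ) (η : ℝ) (p : (Fin n → ℤ) × ℤ) : 0 ≤ maj θ η p := by
  rw [maj]; split_ifs
  · exact le_rfl
  · positivity

theorem maj_summable {n : ℕ} (θ : Fin n → ℝ) (halg : ∀ j, IsAlgebraic ℚ (θ j))
    (hli : LinearIndependent ℚ (Fin.cons (1 : ℝ) θ : Fin (n + 1) → ℝ)) (η : ℝ) (hη : 0 < η) : Summable (maj θ η) := by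
  classical
  obtain ⟨C, hC, hout⟩ := outer_bound θ halg hli η hη
  obtain ⟨B, hB, hin⟩ := inner_bound η hη
  refine summable_of_sum_le (c := B ^ n * C) (maj_nonneg θ η) ?_
  intro s
  have hsub : s ⊆ (s.image Prod.fst) ×ˢ (s.image Prod.snd) := by
    intro p hp
    rw [Finset.mem_product]
    exact ⟨Finset.mem_image_of_mem _ hp, Finset.mem_image_of_mem _ hp⟩
  refine (Finset.sum_le_sum_of_subset_of_nonneg hsub fun p _ _ => maj_nonneg θ η p).trans ?_
  rw [Finset.sum_product_right]
  rw [← Finset.sum_filter_of_ne (p := fun m : ℤ => m ≠ 0)]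
  · have hstep : ∀ m ∈ (s.image Prod.snd).filter (fun m : ℤ => m ≠ 0), ∑ q ∈ s.image Prod.fst, maj θ η (q, m) ≤
        B ^ n * (|(m:ℝ)| ^ (-(1 + η)) * ∏ l, (dst (θ l * m))⁻¹) := by
      intro m hm
      have hm0 : m ≠ 0 := (Finset.mem_filter.1 hm).2
      simp only [maj, hm0, if_false]
      rw [← Finset.mul_sum]
      have h1 := pi_sum_le (fun l (j : ℤ) => |θ l * m - j|⁻¹ * (1 + |(j:ℝ)|) ^ (-η)) (fun l => B * (dst (θ l * m))⁻¹) (fun _ _ => by positivity)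
        (fun l t => hin (θ l * m) (dst_pos θ hli l m hm0) t) (s.image Prod.fst)
      rw [Finset.prod_mul_distrib, Finset.prod_const, Finset.card_univ, Fintype.card_fin] at h1
      calc _ ≤ |(m:ℝ)| ^ (-(1 + η)) * (B ^ n * ∏ l, (dst (θ l * m))⁻¹) := mul_le_mul_of_nonneg_left h1 (by positivity)
        _ = _ := by ring
    refine (Finset.sum_le_sum hstep).trans ?_
    rw [← Finset.mul_sum]
    exact mul_le_mul_of_nonneg_left (hout _ fun m hm => (Finset.mem_filter.1 hm).2) (by positivity)
  · intro m _ hne hm0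
    apply hne
    simp [maj, hm0]

lemma phi_decay {N : ℕ} (φ : SchwartzMap (Fin N → ℝ) ℝ) (η : ℝ) (hη : 0 < η) :
    ∃ C : ℝ, 0 < C ∧ ∀ T : ℝ, 1 ≤ T → ∀ z : Fin N → ℝ, |φ (T⁻¹ • z)| ≤ C * T ^ (N * η) * ∏ j, (1 + |z j|) ^ (-η) := by
  set A : ℕ := ⌈N * η⌉₊ with hA
  have hsem := SchwartzMap.one_add_le_sup_seminorm_apply (𝕜 := ℝ) (m := (A, 0)) (k := A) (n := 0) le_rfl le_rfl φ
  set C0 := 2 ^ A * ((Finset.Iic (A, 0)).sup fun m => SchwartzMap.seminorm ℝ m.1 m.2) φ with hC0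
  refine ⟨|C0| + 1, by positivity, ?_⟩
  intro T hT z
  have hT0 : 0 < T := by linarith
  set y := T⁻¹ • z with hy
  have h1 := hsem y
  rw [norm_iteratedFDeriv_zero] at h1
  have hyj : ∀ j, (1 + |z j|) ≤ T * (1 + ‖y‖) := by
    intro j
    have h2 : ‖y j‖ ≤ ‖y‖ := norm_le_pi_norm y j
    have h3 : z j = T * y j := by rw [hy, Pi.smul_apply, smul_eq_mul]; field_simp
    rw [h3, abs_mul, abs_of_pos hT0]
    rw [Real.norm_eq_abs] at h2
    nlinarith
  have h4 : ∏ j, (1 + |z j|) ^ η ≤ T ^ (N * η) * (1 + ‖y‖) ^ A := by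
    have h5 : ∏ j, (1 + |z j|) ^ η ≤ ∏ _j : Fin N, (T * (1 + ‖y‖)) ^ η :=
      Finset.prod_le_prod (fun j _ => by positivity) fun j _ => Real.rpow_le_rpow (by positivity) (hyj j) hη.le
    refine h5.trans ?_
    rw [Finset.prod_const, Finset.card_univ, Fintype.card_fin, ← Real.rpow_mul_natCast (by positivity), mul_comm η, Real.mul_rpow hT0.le (by positivity)]
    refine mul_le_mul_of_nonneg_left ?_ (by positivity)
    rw [← Real.rpow_natCast]
    exact Real.rpow_le_rpow_of_exponent_le (by linarith [norm_nonneg y]) (Nat.le_ceil _)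
  have h6 : ∏ j, (1 + |z j|) ^ (-η) = (∏ j, (1 + |z j|) ^ η)⁻¹ := by
    rw [← Finset.prod_inv_distrib]
    exact Finset.prod_congr rfl fun j _ => Real.rpow_neg (by positivity) _
  have hP : 0 < ∏ j, (1 + |z j|) ^ η := Finset.prod_pos fun j _ => by positivity
  rw [h6, ← div_eq_mul_inv, le_div_iff₀ hP]
  have h7 : (1 + ‖y‖) ^ A * |φ y| ≤ |C0| + 1 := (h1.trans (le_abs_self _)).trans (by linarith)
  calc |φ y| * ∏ j, (1 + |z j|) ^ η ≤ |φ y| * (T ^ (N * η) * (1 + ‖y‖) ^ A) := mul_le_mul_of_nonneg_left h4 (abs_nonneg _)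
    _ = T ^ (N * η) * ((1 + ‖y‖) ^ A * |φ y|) := by ring
    _ ≤ T ^ (N * η) * (|C0| + 1) := mul_le_mul_of_nonneg_left h7 (by positivity)
    _ = _ := by ring

lemma norm_exp_aux (r : ℝ) : ‖Complex.exp (2 * π * Complex.I * (r : ℂ))‖ = 1 := by
  have : (2 * π * Complex.I * (r : ℂ)) = ((2 * π * r : ℝ) : ℂ) * Complex.I := by push_cast; ring
  rw [this, Complex.norm_exp_ofReal_mul_I]

end Schmidt

end PartS2

/-- If `1, θ₁, …, θ_{d-1}` are real algebraic numbers linearly independent over `ℚ` and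
`φ` is Schwartz, then `𝒮(θ,φ,T) = sup_u |𝒮(θ,φ,u,T)| = O_ε(T^ε)` for every `ε > 0`. -/
theorem main_sum_bound_algebraic (n : ℕ) (hn : 1 ≤ n) (θ : Fin n → ℝ)
    (halg : ∀ j, IsAlgebraic ℚ (θ j))
    (hli : LinearIndependent ℚ (Fin.cons (1 : ℝ) θ : Fin (n + 1) → ℝ))
    (φ : SchwartzMap (Fin (n + 1) → ℝ) ℝ) :
    ∀ ε : ℝ, 0 < ε → ∃ C : ℝ, 0 < C ∧ ∀ T : ℝ, 2 ≤ T → ∀ u : Fin (n + 1) → ℝ,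
      ‖∑' p : (Fin n → ℤ) × ℤ, sumTerm n θ φ u T p‖ ≤ C * T ^ ε := by
  intro ε hε
  have hN : (0:ℝ) < ((n + 1 : ℕ) : ℝ) := by positivity
  set η : ℝ := ε / ((n + 1 : ℕ) : ℝ) with hη
  have hη0 : 0 < η := div_pos hε hN
  have hNη : ((n + 1 : ℕ) : ℝ) * η = ε := by rw [hη]; field_simp
  have hsum := Schmidt.maj_summable θ halg hli η hη0
  obtain ⟨C, hC, hφ⟩ := Schmidt.phi_decay φ η hη0
  have hM0 : 0 ≤ ∑' p, Schmidt.maj θ η p := tsum_nonneg (Schmidt.maj_nonneg θ η)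
  refine ⟨C * (∑' p, Schmidt.maj θ η p + 1), by positivity, ?_⟩
  intro T hT u
  have hT0 : 0 < T := by linarith
  have hterm : ∀ p, ‖sumTerm n θ φ u T p‖ ≤ C * T ^ ε * Schmidt.maj θ η p := by
    rintro ⟨q, m⟩
    by_cases hm : m = 0
    · simp [sumTerm, Schmidt.maj, hm]
    · have hmp : 0 < |(m:ℝ)| := by positivity
      simp only [sumTerm, Schmidt.maj, hm, if_false]
      rw [norm_mul, norm_mul, norm_div, Schmidt.norm_exp_aux, norm_prod]
      simp only [norm_div, Schmidt.norm_exp_aux, Complex.norm_real, Real.norm_eq_abs, Complex.norm_intCast, one_div]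
      have h1 := hφ T (by linarith) (Fin.snoc (fun j => (q j : ℝ)) (m : ℝ) : Fin (n + 1) → ℝ)
      rw [hNη, Fin.prod_univ_castSucc] at h1
      simp only [Fin.snoc_castSucc, Fin.snoc_last] at h1
      have h2 : (1 + |(m:ℝ)|) ^ (-η) ≤ |(m:ℝ)| ^ (-η) := Real.rpow_le_rpow_of_nonpos hmp (by linarith) (by linarith)
      have h3 : |(m:ℝ)| ^ (-(1 + η)) = |(m:ℝ)|⁻¹ * |(m:ℝ)| ^ (-η) := by
        rw [neg_add, Real.rpow_add hmp, Real.rpow_neg_one]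
      rw [h3, Finset.prod_mul_distrib]
      calc |(m:ℝ)|⁻¹ * (∏ l, |θ l * (m:ℝ) - (q l:ℝ)|⁻¹) * |φ (T⁻¹ • (Fin.snoc (fun j => (q j : ℝ)) (m : ℝ) : Fin (n + 1) → ℝ))|
          ≤ |(m:ℝ)|⁻¹ * (∏ l, |θ l * (m:ℝ) - (q l:ℝ)|⁻¹) * (C * T ^ ε * ((∏ l, (1 + |(q l:ℝ)|) ^ (-η)) * (1 + |(m:ℝ)|) ^ (-η))) :=
            mul_le_mul_of_nonneg_left h1 (by positivity)
        _ ≤ |(m:ℝ)|⁻¹ * (∏ l, |θ l * (m:ℝ) - (q l:ℝ)|⁻¹) * (C * T ^ ε * ((∏ l, (1 + |(q l:ℝ)|) ^ (-η)) * |(m:ℝ)| ^ (-η))) := by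
            gcongr
        _ = _ := by ring
  have hb := tsum_of_norm_bounded (hsum.mul_left (C * T ^ ε)).hasSum hterm
  rw [tsum_mul_left] at hb
  refine hb.trans ?_
  have hp : 0 < C * T ^ ε := by positivity
  nlinarith
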